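/- arXiv:2206.09804 — 2 statements merged into one kernel-verified Lean document; each statement's English description precedes it below -/
import Mathlib

section
/- Let S be a cap of size 112 in F = (Fin 6 → ZMod 3). Then for every nonzero linear functional ℓ : F → ZMod 3, the slice multiset of ℓ is either {45, 45, 22} or {40, 36, 36}; moreover, among the 364 one-dimensional subspaces of the dual space of F, exactly 56 are spanned by functionals with slice multiset {45, 45, 22} and exactly 308 by functionals with slice multiset {40, 36, 36}. -/
/-- A cap in the `n`-dimensional affine space over the field of three elements. -/
def IsCap {n : ℕ} (S : Finset (Fin n → ZMod 3)) : Prop :=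
  ∀ a ∈ S, ∀ b ∈ S, ∀ c ∈ S, a ≠ b → a ≠ c → b ≠ c → a + b + c ≠ 0

/-- The slice multiset of a linear functional `ℓ` with respect to `S`: the multiset of
the three cardinalities `|S ∩ ℓ⁻¹(i)|` for `i : ZMod 3`. -/
def sliceMul {n : ℕ} (S : Finset (Fin n → ZMod 3))
    (ℓ : (Fin n → ZMod 3) →ₗ[ZMod 3] ZMod 3) : Multiset ℕ :=
  (Finset.univ : Finset (ZMod 3)).val.map fun i => (S.filter fun x => ℓ x = i).card

namespace TernaryCap

open Finset

local notation:65 x:65 " +ₙ " y:66 => Nat.add x y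
local notation:65 x:65 " -ₙ " y:66 => Nat.sub x y
local notation:70 x:70 " *ₙ " y:71 => Nat.mul x y

/-- The linear functionals on a vector space over `ZMod 3`. -/
abbrev Dual (V : Type) [AddCommGroup V] [Module (ZMod 3) V] : Type := Module.Dual (ZMod 3) V

variable {V : Type} [AddCommGroup V] [Module (ZMod 3) V]

/-- A subset of a vector space over `ZMod 3` whose only zero-sum triples are constant. -/
def IsCapSet (S : Finset V) : Prop :=
  ∀ a ∈ S, ∀ b ∈ S, ∀ c ∈ S, a + b + c = 0 → a = b

omit [Module (ZMod 3) V] in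
lemma IsCapSet.mono {S T : Finset V} (hT : IsCapSet T) (h : S ⊆ T) : IsCapSet S :=
  fun a ha b hb c hc => hT a (h ha) b (h hb) c (h hc)

def slice (S : Finset V) (f : Dual V) (i : ZMod 3) : Finset V := {x ∈ S | f x = i}

def sliceCard (S : Finset V) (f : Dual V) (i : ZMod 3) : ℕ := #(slice S f i)

def cellCard (S : Finset V) (f g : Dual V) (i j : ZMod 3) : ℕ := sliceCard (slice S f i) g j

lemma three_smul_eq_zero (x : V) : x + x + x = 0 := by
  have h : ((3 : ZMod 3)) • x = 0 := by
    rw [show (3 : ZMod 3) = 0 from rfl, zero_smul]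
  rw [← h, show (3 : ZMod 3) = 1 + 1 + 1 from rfl, add_smul, add_smul, one_smul]

lemma ne_neg_of_ne_zero {x : V} (hx : x ≠ 0) : x ≠ -x := fun h => hx (by
  have := three_smul_eq_zero x
  rwa [eq_neg_iff_add_eq_zero.1 h, zero_add] at this)

lemma IsCapSet.eq_of_add_eq_zero {S : Finset V} (hS : IsCapSet S) {a b c : V} (ha : a ∈ S)
    (hb : b ∈ S) (hc : c ∈ S) (h : a + b + c = 0) : b = a ∧ c = a := by
  have hab := hS a ha b hb c hc h
  refine ⟨hab.symm, ?_⟩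
  subst hab
  exact add_left_cancel (h.trans (three_smul_eq_zero a).symm)

lemma slice_subset (S : Finset V) (f : Dual V) (i : ZMod 3) : slice S f i ⊆ S :=
  filter_subset _ _

@[simp] lemma mem_slice {S : Finset V} {f : Dual V} {i : ZMod 3} {x : V} :
    x ∈ slice S f i ↔ x ∈ S ∧ f x = i := by simp [slice]

lemma zmod_three_cases (i : ZMod 3) : i = 0 ∨ i = 1 ∨ i = 2 := by
  revert i; decide

lemma sum_comp_dual {M : Type*} [AddCommMonoid M] (S : Finset V) (f : Dual V) (F : ZMod 3 → M) :
    ∑ x ∈ S, F (f x) = sliceCard S f 0 • F 0 + sliceCard S f 1 • F 1 + sliceCard S f 2 • F 2 := by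
  rw [← sum_fiberwise S f fun x => F (f x)]
  have h (i : ZMod 3) : ∑ x ∈ S with f x = i, F (f x) = sliceCard S f i • F i := by
    rw [sum_congr rfl (g := fun _ => F i), sum_const]
    · rfl
    · intro x hx
      rw [(mem_filter.1 hx).2]
  simp only [h]
  exact Fin.sum_univ_three (fun i : Fin 3 => sliceCard S f i • F i)

lemma card_eq_sum_sliceCard (S : Finset V) (f : Dual V) :
    #S = sliceCard S f 0 + sliceCard S f 1 + sliceCard S f 2 := by
  rw [card_eq_sum_ones, sum_comp_dual S f fun _ => 1]
  simp only [smul_eq_mul, mul_one]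

lemma cellCard_comm (S : Finset V) (f g : Dual V) (i j : ZMod 3) :
    cellCard S f g i j = cellCard S g f j i := by
  unfold cellCard sliceCard slice
  rw [filter_comm]

lemma cellCard_sub_smul (S : Finset V) (f g : Dual V) (t i j : ZMod 3) :
    cellCard S f (g - t • f) i j = cellCard S f g i (j + t * i) := by
  unfold cellCard sliceCard
  congr 1
  ext x
  simp only [mem_slice, LinearMap.sub_apply, LinearMap.smul_apply, smul_eq_mul, and_congr_right_iff]
  rintro ⟨-, rfl⟩
  exact sub_eq_iff_eq_add

lemma sliceCard_eq_sum_cellCard (S : Finset V) (f g : Dual V) (j : ZMod 3) :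
    sliceCard S g j = cellCard S f g 0 j + cellCard S f g 1 j + cellCard S f g 2 j := by
  rw [cellCard_comm, cellCard_comm S f g 1, cellCard_comm S f g 2]
  exact card_eq_sum_sliceCard _ f

section Moments

/-- The number of pairs in `A × A` whose difference is killed by `f`. -/
def pairMoment (A : Finset V) (f : Dual V) : ℤ :=
  ∑ x ∈ A, ∑ y ∈ A, if f (x - y) = 0 then 1 else 0

/-- The number of triples in `A × B × C` whose sum is killed by `f`. -/
def tripleMoment (A B C : Finset V) (f : Dual V) : ℤ :=
  ∑ x ∈ A, ∑ y ∈ B, ∑ z ∈ C, if f (x + y + z) = 0 then 1 else 0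

lemma pairMoment_eq (A : Finset V) (f : Dual V) :
    pairMoment A f = sliceCard A f 0 * sliceCard A f 0 + sliceCard A f 1 * sliceCard A f 1 +
      sliceCard A f 2 * sliceCard A f 2 := by
  unfold pairMoment
  simp only [map_sub]
  rw [sum_congr rfl fun x _ => sum_comp_dual A f fun j => if f x - j = 0 then (1 : ℤ) else 0,
    sum_comp_dual A f fun i => sliceCard A f 0 • (if i - 0 = 0 then (1 : ℤ) else 0) +
      sliceCard A f 1 • (if i - 1 = 0 then (1 : ℤ) else 0) +
      sliceCard A f 2 • (if i - 2 = 0 then (1 : ℤ) else 0)]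
  have h1 : (1 : ZMod 3) ≠ 0 := by decide
  have h2 : (2 : ZMod 3) ≠ 0 := by decide
  have h3 : (1 : ZMod 3) - 2 ≠ 0 := by decide
  have h4 : (2 : ZMod 3) - 1 ≠ 0 := by decide
  simp [h1, h2, h3, h4]

lemma tripleMoment_eq (A B C : Finset V) (f : Dual V) :
    tripleMoment A B C f =
      (sliceCard A f 0 * sliceCard B f 0 + (sliceCard A f 1 * sliceCard B f 2 +
        sliceCard A f 2 * sliceCard B f 1)) * sliceCard C f 0 +
      (sliceCard A f 1 * sliceCard B f 1 + (sliceCard A f 0 * sliceCard B f 2 +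
        sliceCard A f 2 * sliceCard B f 0)) * sliceCard C f 1 +
      (sliceCard A f 2 * sliceCard B f 2 + (sliceCard A f 0 * sliceCard B f 1 +
        sliceCard A f 1 * sliceCard B f 0)) * sliceCard C f 2 := by
  unfold tripleMoment
  simp only [map_add]
  have hC (i j : ZMod 3) : ∑ z ∈ C, (if i + j + f z = 0 then (1 : ℤ) else 0) =
      sliceCard C f (-i - j) := by
    rw [sum_comp_dual C f fun k => if i + j + k = 0 then (1 : ℤ) else 0]
    have : ∀ i j k : ZMod 3, i + j + k = 0 ↔ k = -i - j := by decide
    simp only [this]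
    have h1 : (1 : ZMod 3) ≠ 0 := by decide
    have h2 : (2 : ZMod 3) ≠ 0 := by decide
    have h3 : (1 : ZMod 3) ≠ 2 := by decide
    rcases zmod_three_cases (-i - j) with h | h | h <;>
      simp [h, h1, h2, h3, h1.symm, h2.symm, h3.symm]
  simp only [hC]
  rw [sum_congr rfl fun x _ => sum_comp_dual B f fun j => (sliceCard C f (-f x - j) : ℤ),
    sum_comp_dual A f fun i => sliceCard B f 0 • (sliceCard C f (-i - 0) : ℤ) +
      sliceCard B f 1 • (sliceCard C f (-i - 1) : ℤ) +
      sliceCard B f 2 • (sliceCard C f (-i - 2) : ℤ)]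
  simp only [show (-0 - 0 : ZMod 3) = 0 by decide, show (-0 - 1 : ZMod 3) = 2 by decide,
    show (-0 - 2 : ZMod 3) = 1 by decide, show (-1 - 0 : ZMod 3) = 2 by decide,
    show (-1 - 1 : ZMod 3) = 1 by decide, show (-1 - 2 : ZMod 3) = 0 by decide,
    show (-2 - 0 : ZMod 3) = 1 by decide, show (-2 - 1 : ZMod 3) = 0 by decide,
    show (-2 - 2 : ZMod 3) = 2 by decide, nsmul_eq_mul]
  ring

instance [Finite V] : Finite (Dual V) := DFunLike.finite _

lemma natCard_eq [Finite V] {n : ℕ} (hV : Module.finrank (ZMod 3) V = n) : Nat.card V = 3 ^ n := by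
  rw [Module.natCard_eq_pow_finrank (K := ZMod 3), hV]
  simp

lemma card_dual [Finite V] [Fintype (Dual V)] {n : ℕ} (hV : Module.finrank (ZMod 3) V = n) :
    Fintype.card (Dual V) = 3 ^ n := by
  rw [← Nat.card_eq_fintype_card]
  exact natCard_eq (Subspace.dual_finrank_eq.trans hV)

lemma sum_dual_ite [Finite V] [Fintype (Dual V)] {n : ℕ}
    (hV : Module.finrank (ZMod 3) V = n + 1) (v : V) [Decidable (v = 0)] :
    ∑ f : Dual V, (if f v = 0 then (1 : ℤ) else 0) = 3 ^ n + if v = 0 then 2 * 3 ^ n else 0 := by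
  rw [sum_boole]
  by_cases hv : v = 0
  · subst hv
    simp only [map_zero, filter_true, if_true, card_univ, card_dual hV]
    push_cast
    ring
  · rw [if_neg hv]
    have hne : Module.Dual.eval (ZMod 3) V v ≠ 0 := by
      rwa [Ne, Module.eval_apply_eq_zero_iff]
    have hker := Module.Dual.finrank_ker_add_one_of_ne_zero hne
    rw [Subspace.dual_finrank_eq, hV, Nat.add_right_cancel_iff] at hker
    have := natCard_eq (V := LinearMap.ker (Module.Dual.eval (ZMod 3) V v)) hker
    rw [Nat.subtype_card ({f | f v = 0} : Finset (Dual V))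
      (by simp [Module.Dual.eval_apply])] at this
    rw [this]
    simp

lemma sum_pairMoment [Finite V] [Fintype (Dual V)] {n : ℕ}
    (hV : Module.finrank (ZMod 3) V = n + 1) (A : Finset V) :
    ∑ f : Dual V, pairMoment A f = 3 ^ n * ((#A : ℤ) * #A) + 2 * 3 ^ n * #A := by
  classical
  simp only [pairMoment]
  rw [sum_comm]
  simp only [sum_comm (s := univ) (t := A), sum_dual_ite hV, sub_eq_zero, sum_add_distrib,
    sum_const, nsmul_eq_mul, sum_ite_eq]
  rw [sum_congr rfl fun x hx => if_pos hx]
  simp only [sum_const, nsmul_eq_mul]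
  ring

lemma sum_tripleMoment_self [Finite V] [Fintype (Dual V)] {n : ℕ}
    (hV : Module.finrank (ZMod 3) V = n + 1) {A : Finset V} (hA : IsCapSet A) :
    ∑ f : Dual V, tripleMoment A A A f = 3 ^ n * ((#A : ℤ) * #A * #A) + 2 * 3 ^ n * #A := by
  classical
  simp only [tripleMoment]
  rw [sum_comm]
  simp only [sum_comm (s := univ) (t := A), sum_dual_ite hV, sum_add_distrib,
    sum_const, nsmul_eq_mul]
  have h : ∀ x ∈ A, ∑ y ∈ A, ∑ z ∈ A, (if x + y + z = 0 then 2 * (3 : ℤ) ^ n else 0) =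
      2 * 3 ^ n := by
    intro x hx
    rw [sum_eq_single x, sum_eq_single x, if_pos (three_smul_eq_zero x)]
    · intro z hz hzx
      exact if_neg fun h => hzx (hA.eq_of_add_eq_zero hx hx hz h).2
    · exact fun h => (h hx).elim
    · intro y hy hyx
      exact sum_eq_zero fun z hz => if_neg fun h => hyx (hA.eq_of_add_eq_zero hx hy hz h).1
    · exact fun h => (h hx).elim
  rw [sum_congr rfl h]
  simp only [sum_const, nsmul_eq_mul]
  ring

lemma sum_tripleMoment_of_disjoint [Finite V] [Fintype (Dual V)] {n : ℕ}
    (hV : Module.finrank (ZMod 3) V = n + 1) {S A B C : Finset V} (hS : IsCapSet S)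
    (hA : A ⊆ S) (hB : B ⊆ S) (hC : C ⊆ S) (hAB : Disjoint A B) :
    ∑ f : Dual V, tripleMoment A B C f = 3 ^ n * ((#A : ℤ) * #B * #C) := by
  classical
  simp only [tripleMoment]
  rw [sum_comm]
  simp only [sum_comm (s := univ) (t := B), sum_comm (s := univ) (t := C), sum_dual_ite hV]
  have h : ∀ x ∈ A, ∀ y ∈ B, ∀ z ∈ C,
      ((3 : ℤ) ^ n + if x + y + z = 0 then 2 * (3 : ℤ) ^ n else 0) = 3 ^ n := by
    intro x hx y hy z hz
    rw [if_neg, add_zero]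
    intro h
    exact disjoint_left.1 hAB hx (hS x (hA hx) y (hB hy) z (hC hz) h ▸ hy)
  rw [sum_congr rfl fun x hx => sum_congr rfl fun y hy => sum_congr rfl fun z hz =>
    h x hx y hy z hz]
  simp only [sum_const, nsmul_eq_mul]
  ring

lemma pairMoment_of_const {A : Finset V} {f : Dual V} {i : ZMod 3} (h : ∀ x ∈ A, f x = i) :
    pairMoment A f = (#A : ℤ) * #A := by
  unfold pairMoment
  rw [sum_congr rfl fun x hx => sum_congr rfl fun y hy =>
    if_pos (by rw [map_sub, h x hx, h y hy, sub_self])]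
  simp

lemma tripleMoment_of_const {A B C : Finset V} {f : Dual V} {i j k : ZMod 3}
    (hA : ∀ x ∈ A, f x = i) (hB : ∀ x ∈ B, f x = j) (hC : ∀ x ∈ C, f x = k)
    (h : i + j + k = 0) : tripleMoment A B C f = (#A : ℤ) * #B * #C := by
  unfold tripleMoment
  rw [sum_congr rfl fun x hx => sum_congr rfl fun y hy => sum_congr rfl fun z hz =>
    if_pos (by rw [map_add, map_add, hA x hx, hB y hy, hC z hz, h])]
  simp [mul_assoc]

end Moments

def cubeSum (x y z : ℕ) : ℕ := x *ₙ x *ₙ x +ₙ y *ₙ y *ₙ y +ₙ z *ₙ z *ₙ z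

/-- Numerical constraints on the three slice cardinalities `x, y, z` of a cap: an upper bound
for each of them, an upper bound for their sum, and a condition on `x + y + z` and
`x ^ 3 + y ^ 3 + z ^ 3`. -/
structure Profile where
  maxSlice : ℕ
  maxCard : ℕ
  allow : ℕ → ℕ → Bool

def Profile.ok (p : Profile) (x y z : ℕ) : Bool :=
  x.ble p.maxSlice && (y.ble p.maxSlice && (z.ble p.maxSlice && ((x +ₙ y +ₙ z).ble p.maxCard &&
    p.allow (x +ₙ y +ₙ z) (cubeSum x y z))))

lemma cubeSum_rotate (x y z : ℕ) : cubeSum y z x = cubeSum x y z := by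
  simp only [cubeSum, Nat.add_eq, Nat.mul_eq]
  ring

lemma cubeSum_swap (x y z : ℕ) : cubeSum x z y = cubeSum x y z := by
  simp only [cubeSum, Nat.add_eq, Nat.mul_eq]
  ring

lemma Profile.ok_iff {p : Profile} {x y z : ℕ} : p.ok x y z = true ↔
    x ≤ p.maxSlice ∧ y ≤ p.maxSlice ∧ z ≤ p.maxSlice ∧ x + y + z ≤ p.maxCard ∧
      p.allow (x + y + z) (cubeSum x y z) = true := by
  simp [Profile.ok]

lemma Profile.ok_rotate {p : Profile} {x y z : ℕ} (h : p.ok x y z = true) :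
    p.ok y z x = true := by
  rw [Profile.ok_iff] at *
  rw [cubeSum_rotate, show y + z + x = x + y + z by ring]
  tauto

lemma Profile.ok_swap {p : Profile} {x y z : ℕ} (h : p.ok x y z = true) :
    p.ok x z y = true := by
  rw [Profile.ok_iff] at *
  rw [cubeSum_swap, show x + z + y = x + y + z by ring]
  tauto

/-- Every cap in dimension `n` has at most `m` points. -/
def CapBound (n m : ℕ) : Prop :=
  ∀ (V : Type) [AddCommGroup V] [Module (ZMod 3) V] [Finite V], Module.finrank (ZMod 3) V = n →
    ∀ S : Finset V, IsCapSet S → #S ≤ m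

/-- The slices of every cap in dimension `n` satisfy the constraints of `p`. -/
def Profile.Valid (p : Profile) (n : ℕ) : Prop :=
  ∀ (V : Type) [AddCommGroup V] [Module (ZMod 3) V] [Finite V], Module.finrank (ZMod 3) V = n →
    ∀ S : Finset V, IsCapSet S → ∀ f : Dual V, f ≠ 0 →
      p.ok (sliceCard S f 0) (sliceCard S f 1) (sliceCard S f 2) = true

section Fiber

/-- The part of `S` in the coset `v + ker f`, viewed inside `ker f`. -/
noncomputable def fiber (S : Finset V) (f : Dual V) (v : V) : Finset (LinearMap.ker f) :=
  S.preimage (fun w => (w : V) + v) ((add_left_injective v).comp Subtype.val_injective).injOn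

lemma mem_fiber {S : Finset V} {f : Dual V} {v : V} {w : LinearMap.ker f} :
    w ∈ fiber S f v ↔ (w : V) + v ∈ S := mem_preimage

lemma IsCapSet.fiber {S : Finset V} (hS : IsCapSet S) (f : Dual V) (v : V) :
    IsCapSet (fiber S f v) := by
  intro a ha b hb c hc h
  refine Subtype.ext (add_right_cancel (hS _ (mem_fiber.1 ha) _ (mem_fiber.1 hb) _
    (mem_fiber.1 hc) ?_))
  have h' : (a : V) + b + c = 0 := congrArg Subtype.val h
  calc (a : V) + v + (b + v) + (c + v) = (a + b + c) + (v + v + v) := by abel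
    _ = 0 := by rw [h', three_smul_eq_zero, add_zero]

lemma card_fiber_of_const {T : Finset V} {f : Dual V} {v : V} (hT : ∀ x ∈ T, f x = f v) :
    #(fiber T f v) = #T := by
  classical
  rw [fiber, card_preimage, filter_true_of_mem]
  intro x hx
  exact ⟨⟨x - v, by simp [hT x hx]⟩, by simp⟩

lemma card_fiber (S : Finset V) (f : Dual V) (v : V) : #(fiber S f v) = sliceCard S f (f v) := by
  rw [sliceCard, ← card_fiber_of_const fun x hx => (mem_slice.1 hx).2]
  congr 1
  ext w
  simp [mem_fiber]

lemma sliceCard_fiber (S : Finset V) (f g : Dual V) {v : V} (hv : g v = 0) (j : ZMod 3) :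
    sliceCard (fiber S f v) (g.domRestrict (LinearMap.ker f)) j = cellCard S f g (f v) j := by
  rw [cellCard, sliceCard, sliceCard,
    ← card_fiber_of_const (f := f) (v := v) fun x hx => (mem_slice.1 (mem_slice.1 hx).1).2]
  congr 1
  ext w
  simp [mem_fiber, hv]

end Fiber

lemma finrank_ker {n : ℕ} [Finite V] (hV : Module.finrank (ZMod 3) V = n + 1) {f : Dual V}
    (hf : f ≠ 0) : Module.finrank (ZMod 3) (LinearMap.ker f) = n := by
  have := Module.Dual.finrank_ker_add_one_of_ne_zero hf
  rwa [hV, Nat.add_right_cancel_iff] at this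

lemma exists_eq {f : Dual V} (hf : f ≠ 0) (i : ZMod 3) : ∃ v, f v = i :=
  LinearMap.surjective hf i

lemma CapBound.sliceCard_le {n m : ℕ} (h : CapBound n m) [Finite V]
    (hV : Module.finrank (ZMod 3) V = n + 1) {S : Finset V} (hS : IsCapSet S) {f : Dual V}
    (hf : f ≠ 0) (i : ZMod 3) : sliceCard S f i ≤ m := by
  obtain ⟨v, rfl⟩ := exists_eq hf i
  rw [← card_fiber]
  exact h _ (finrank_ker hV hf) _ (hS.fiber f v)

/-- `g` is not a multiple of `f`. -/
def Transversal (f g : Dual V) : Prop := ∀ t : ZMod 3, g ≠ t • f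

lemma Transversal.exists_ker {f g : Dual V} (hf : f ≠ 0) (h : Transversal f g) :
    ∃ v, f v = 0 ∧ g v ≠ 0 := by
  by_contra! H
  obtain ⟨u, hu⟩ := exists_eq hf 1
  refine h (g u) (LinearMap.ext fun x => ?_)
  have := H (x - f x • u) (by simp [hu])
  rw [map_sub, map_smul, sub_eq_zero] at this
  simp [this, mul_comm]

lemma Transversal.symm {f g : Dual V} (hf : f ≠ 0) (h : Transversal f g) : Transversal g f := by
  rintro t rfl
  have ht : t ≠ 0 := by
    rintro rfl
    simp at hf
  exact h t⁻¹ (by rw [smul_smul, inv_mul_cancel₀ ht, one_smul])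

lemma Transversal.sub_smul {f g : Dual V} (h : Transversal f g) (t : ZMod 3) :
    Transversal f (g - t • f) := fun s hs => h (s + t) (by rw [add_smul, ← hs, sub_add_cancel])

lemma Transversal.ne_zero {f g : Dual V} (h : Transversal f g) : g ≠ 0 := by
  simpa using h 0

lemma Profile.Valid.ok_cellCard {p : Profile} {n : ℕ} (hp : p.Valid n) [Finite V]
    (hV : Module.finrank (ZMod 3) V = n + 1) {S : Finset V} (hS : IsCapSet S) {f g : Dual V}
    (hf : f ≠ 0) (h : Transversal f g) (i : ZMod 3) :
    p.ok (cellCard S f g i 0) (cellCard S f g i 1) (cellCard S f g i 2) = true := by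
  obtain ⟨u, hu, hfu⟩ := (h.symm hf).exists_ker h.ne_zero
  obtain ⟨v, hv, hgv⟩ := h.exists_ker hf
  have key := hp _ (finrank_ker hV hf) _ (hS.fiber f ((i * (f u)⁻¹) • u))
    (g.domRestrict (LinearMap.ker f)) fun h0 => hgv (LinearMap.congr_fun h0 ⟨v, hv⟩)
  simp only [sliceCard_fiber _ f g (v := (i * (f u)⁻¹) • u) (by simp [hu])] at key
  simpa [hfu] using key

section Loops

/-- `allLt n f` tests whether `f k` holds for all `k < n`. -/
def allLt (n : ℕ) (f : ℕ → Bool) : Bool := Nat.rec true (fun k r => f k && r) n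

/-- `force n f = f n`, but the kernel evaluates `n` to a literal first. -/
def force (n : ℕ) (f : ℕ → Bool) : Bool := Nat.rec (f 0) (fun k _ => f k.succ) n

/-- Loop over the triples with sum `s` that satisfy `p`. -/
def Profile.forRows (p : Profile) (s : ℕ) (f : ℕ → ℕ → ℕ → Bool) : Bool :=
  allLt (min s p.maxSlice +ₙ 1) fun x => allLt (min (s -ₙ x) p.maxSlice +ₙ 1) fun y =>
    force (s -ₙ x -ₙ y) fun z => !p.ok x y z || f x y z

/-- Loop over the triples with sum `s` and entries bounded by `m₀`, `m₁`, `m₂`. -/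
def forBounded (s m₀ m₁ m₂ : ℕ) (f : ℕ → ℕ → ℕ → Bool) : Bool :=
  allLt (min s m₀ +ₙ 1) fun x => force (s -ₙ x) fun t => force (t -ₙ m₂) fun l =>
    allLt (min t m₁ +ₙ 1 -ₙ l) fun k => force (l +ₙ k) fun y => force (t -ₙ y) fun z => f x y z

lemma allLt_eq_true {n : ℕ} {f : ℕ → Bool} (h : allLt n f = true) {k : ℕ} (hk : k < n) :
    f k = true := by
  induction n with
  | zero => omega
  | succ n ih =>
    have h' : (f n && allLt n f) = true := h
    rw [Bool.and_eq_true] at h'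
    rcases Nat.lt_succ_iff_lt_or_eq.1 hk with hk | rfl
    exacts [ih h'.2 hk, h'.1]

@[simp] lemma force_eq (n : ℕ) (f : ℕ → Bool) : force n f = f n := by
  cases n <;> rfl

lemma Profile.forRows_eq_true {p : Profile} {s : ℕ} {f : ℕ → ℕ → ℕ → Bool}
    (h : p.forRows s f = true) {x y z : ℕ} (hp : p.ok x y z = true) (hs : x + y + z = s) :
    f x y z = true := by
  obtain ⟨hx, hy, -⟩ := Profile.ok_iff.1 hp
  have := allLt_eq_true (allLt_eq_true h (k := x) (by simp; omega)) (k := y) (by simp; omega)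
  rw [force_eq, show (s -ₙ x -ₙ y) = z by simp; omega, hp] at this
  simpa using this

lemma forBounded_eq_true {s m₀ m₁ m₂ : ℕ} {f : ℕ → ℕ → ℕ → Bool}
    (h : forBounded s m₀ m₁ m₂ f = true) {x y z : ℕ} (hx : x ≤ m₀) (hy : y ≤ m₁) (hz : z ≤ m₂)
    (hs : x + y + z = s) : f x y z = true := by
  have := allLt_eq_true h (k := x) (by simp; omega)
  simp only [force_eq] at this
  have := allLt_eq_true this (k := y - (s - x - m₂)) (by simp; omega)
  rwa [show (s -ₙ x -ₙ m₂ +ₙ (y - (s - x - m₂))) = y by simp; omega,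
    show (s -ₙ x -ₙ y) = z by simp; omega] at this

end Loops

def sqSum (x y z : ℕ) : ℕ := x *ₙ x +ₙ y *ₙ y +ₙ z *ₙ z

/-- The number of triples in `A ^ 3` on which a functional sums to zero, where `x`, `y`, `z`
are the slice cardinalities of `A`. -/
def cubeCount (x y z : ℕ) : ℕ := cubeSum x y z +ₙ 6 *ₙ (x *ₙ y *ₙ z)

/-- The slice cardinalities of the three slices of a set in one direction with respect to a
second direction. -/
structure Grid where
  (a₀ a₁ a₂ b₀ b₁ b₂ c₀ c₁ c₂ : ℕ)

namespace Grid

def rotate (G : Grid) : Grid := ⟨G.a₁, G.a₂, G.a₀, G.b₁, G.b₂, G.b₀, G.c₁, G.c₂, G.c₀⟩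

def reflect (G : Grid) : Grid := ⟨G.a₀, G.a₂, G.a₁, G.b₀, G.b₂, G.b₁, G.c₀, G.c₂, G.c₁⟩

def shear (G : Grid) : Grid := ⟨G.a₀, G.a₁, G.a₂, G.b₁, G.b₂, G.b₀, G.c₂, G.c₀, G.c₁⟩

/-- The value of `cubeSum` in the direction of the columns. -/
def key₀ (G : Grid) : ℕ :=
  cubeSum (G.a₀ +ₙ G.b₀ +ₙ G.c₀) (G.a₁ +ₙ G.b₁ +ₙ G.c₁) (G.a₂ +ₙ G.b₂ +ₙ G.c₂)

/-- The value of `cubeSum` in the first oblique direction. -/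
def key₁ (G : Grid) : ℕ :=
  cubeSum (G.a₀ +ₙ G.b₁ +ₙ G.c₂) (G.a₁ +ₙ G.b₂ +ₙ G.c₀) (G.a₂ +ₙ G.b₀ +ₙ G.c₁)

/-- The value of `cubeSum` in the second oblique direction. -/
def key₂ (G : Grid) : ℕ :=
  cubeSum (G.a₀ +ₙ G.b₂ +ₙ G.c₁) (G.a₁ +ₙ G.b₀ +ₙ G.c₂) (G.a₂ +ₙ G.b₁ +ₙ G.c₀)

/-- All rows and all lines transversal to the rows satisfy `p`, and the three remaining
directions satisfy `T`. -/
def admissible (p : Profile) (T : ℕ → Bool) (G : Grid) : Bool :=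
  p.ok G.c₀ G.c₁ G.c₂ &&
  (p.ok G.a₀ G.b₀ G.c₀ && (p.ok G.a₁ G.b₁ G.c₁ && p.ok G.a₂ G.b₂ G.c₂)) &&
  (p.ok G.a₀ G.b₁ G.c₂ && (p.ok G.a₁ G.b₂ G.c₀ && p.ok G.a₂ G.b₀ G.c₁)) &&
  (p.ok G.a₀ G.b₂ G.c₁ && (p.ok G.a₁ G.b₀ G.c₂ && p.ok G.a₂ G.b₁ G.c₀)) &&
  (T G.key₀ && (T G.key₁ && T G.key₂)) && (p.ok G.a₀ G.a₁ G.a₂ && p.ok G.b₀ G.b₁ G.b₂)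

lemma admissible_iff {p : Profile} {T : ℕ → Bool} {G : Grid} : G.admissible p T = true ↔
    (p.ok G.a₀ G.a₁ G.a₂ = true ∧ p.ok G.b₀ G.b₁ G.b₂ = true ∧ p.ok G.c₀ G.c₁ G.c₂ = true) ∧
    (p.ok G.a₀ G.b₀ G.c₀ = true ∧ p.ok G.a₁ G.b₁ G.c₁ = true ∧ p.ok G.a₂ G.b₂ G.c₂ = true) ∧
    (p.ok G.a₀ G.b₁ G.c₂ = true ∧ p.ok G.a₁ G.b₂ G.c₀ = true ∧ p.ok G.a₂ G.b₀ G.c₁ = true) ∧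
    (p.ok G.a₀ G.b₂ G.c₁ = true ∧ p.ok G.a₁ G.b₀ G.c₂ = true ∧ p.ok G.a₂ G.b₁ G.c₀ = true) ∧
    T G.key₀ = true ∧ T G.key₁ = true ∧ T G.key₂ = true := by
  simp only [admissible, Bool.and_eq_true]
  tauto

lemma key_rotate (G : Grid) :
    G.rotate.key₀ = G.key₀ ∧ G.rotate.key₁ = G.key₁ ∧ G.rotate.key₂ = G.key₂ :=
  ⟨cubeSum_rotate _ _ _, cubeSum_rotate _ _ _, cubeSum_rotate _ _ _⟩

lemma key_reflect (G : Grid) :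
    G.reflect.key₀ = G.key₀ ∧ G.reflect.key₁ = G.key₂ ∧ G.reflect.key₂ = G.key₁ :=
  ⟨cubeSum_swap _ _ _, cubeSum_swap _ _ _, cubeSum_swap _ _ _⟩

lemma key_shear (G : Grid) :
    G.shear.key₀ = G.key₁ ∧ G.shear.key₁ = G.key₂ ∧ G.shear.key₂ = G.key₀ :=
  ⟨rfl, rfl, rfl⟩

lemma admissible_rotate {p : Profile} {T : ℕ → Bool} {G : Grid} (h : G.admissible p T = true) :
    G.rotate.admissible p T = true := by
  obtain ⟨⟨ha, hb, hc⟩, h₀, h₁, h₂, h₃⟩ := admissible_iff.1 h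
  obtain ⟨k₀, k₁, k₂⟩ := G.key_rotate
  rw [admissible_iff, k₀, k₁, k₂]
  simp only [rotate]
  exact ⟨⟨Profile.ok_rotate ha, Profile.ok_rotate hb, Profile.ok_rotate hc⟩,
    ⟨h₀.2.1, h₀.2.2, h₀.1⟩, ⟨h₁.2.1, h₁.2.2, h₁.1⟩, ⟨h₂.2.1, h₂.2.2, h₂.1⟩, h₃⟩

lemma admissible_reflect {p : Profile} {T : ℕ → Bool} {G : Grid} (h : G.admissible p T = true) :
    G.reflect.admissible p T = true := by
  obtain ⟨⟨ha, hb, hc⟩, h₀, h₁, h₂, h₃⟩ := admissible_iff.1 h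
  obtain ⟨k₀, k₁, k₂⟩ := G.key_reflect
  rw [admissible_iff, k₀, k₁, k₂]
  simp only [reflect]
  exact ⟨⟨Profile.ok_swap ha, Profile.ok_swap hb, Profile.ok_swap hc⟩,
    ⟨h₀.1, h₀.2.2, h₀.2.1⟩, ⟨h₂.1, h₂.2.2, h₂.2.1⟩, ⟨h₁.1, h₁.2.2, h₁.2.1⟩, h₃.1, h₃.2.2, h₃.2.1⟩

lemma admissible_shear {p : Profile} {T : ℕ → Bool} {G : Grid} (h : G.admissible p T = true) :
    G.shear.admissible p T = true := by
  obtain ⟨⟨ha, hb, hc⟩, h₀, h₁, h₂, h₃⟩ := admissible_iff.1 h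
  obtain ⟨k₀, k₁, k₂⟩ := G.key_shear
  rw [admissible_iff, k₀, k₁, k₂]
  simp only [shear]
  exact ⟨⟨ha, Profile.ok_rotate hb, Profile.ok_rotate (Profile.ok_rotate hc)⟩, h₁, h₂, h₀, h₃.2.1,
    h₃.2.2, h₃.1⟩

def Sorted (G : Grid) : Prop := G.a₁ ≤ G.a₀ ∧ G.a₂ ≤ G.a₁ ∧ G.b₁ ≤ G.b₀ ∧ G.b₂ ≤ G.b₀

lemma induction_sorted {P : Grid → Prop} (hr : ∀ G : Grid, P G.rotate → P G)
    (hs : ∀ G : Grid, P G.reflect → P G) (ht : ∀ G : Grid, P G.shear → P G)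
    (h : ∀ G : Grid, G.Sorted → P G) (G : Grid) : P G := by
  have h' (G : Grid) (h₁ : G.a₁ ≤ G.a₀) (h₂ : G.a₂ ≤ G.a₁) : P G := by
    rcases le_total G.b₁ G.b₀ with h01 | h01 <;> rcases le_total G.b₂ G.b₀ with h02 | h02 <;>
      rcases le_total G.b₂ G.b₁ with h12 | h12
    all_goals
      first
      | exact h G ⟨by omega, by omega, by omega, by omega⟩
      | exact ht _ (h _ (by simp only [shear, Sorted]; omega))
      | exact ht _ (ht _ (h _ (by simp only [shear, Sorted]; omega)))
  rcases le_total G.a₁ G.a₀ with h01 | h01 <;> rcases le_total G.a₂ G.a₀ with h02 | h02 <;>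
    rcases le_total G.a₂ G.a₁ with h12 | h12
  all_goals
    first
    | exact h' G (by omega) (by omega)
    | exact hr _ (h' _ (by simp only [rotate]; omega) (by simp only [rotate]; omega))
    | exact hr _ (hr _ (h' _ (by simp only [rotate]; omega) (by simp only [rotate]; omega)))
    | exact hs _ (h' _ (by simp only [reflect]; omega) (by simp only [reflect]; omega))
    | exact hs _ (hr _ (h' _ (by simp only [reflect, rotate]; omega)
        (by simp only [reflect, rotate]; omega)))
    | exact hs _ (hr _ (hr _ (h' _ (by simp only [reflect, rotate]; omega)
        (by simp only [reflect, rotate]; omega))))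

end Grid

/-- A linear combination of the moments of three slices `A`, `B`, `C` with respect to a functional,
together with the intended cardinalities `a`, `b`, `c` of these slices. -/
structure Certificate where
  (a b c : ℕ)
  (k p₀ p₁ p₂ z₀ z₁ z₂ : ℤ)
  w : ℕ

namespace Certificate

def rowValue (p z : ℤ) (x y t : ℕ) : ℤ :=
  p * (x * x + y * y + t * t) + z * (x * x * x + y * y * y + t * t * t + 6 * (x * y * t))

def value (K : Certificate) (G : Grid) : ℤ :=
  K.k + rowValue K.p₀ K.z₀ G.a₀ G.a₁ G.a₂ + rowValue K.p₁ K.z₁ G.b₀ G.b₁ G.b₂ +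
    rowValue K.p₂ K.z₂ G.c₀ G.c₁ G.c₂ -
    K.w * ((G.a₀ * G.b₀ + (G.a₁ * G.b₂ + G.a₂ * G.b₁)) * G.c₀ +
      (G.a₁ * G.b₁ + (G.a₀ * G.b₂ + G.a₂ * G.b₀)) * G.c₁ +
      (G.a₂ * G.b₂ + (G.a₀ * G.b₁ + G.a₁ * G.b₀)) * G.c₂)

lemma value_rotate (K : Certificate) (G : Grid) : K.value G.rotate = K.value G := by
  simp only [value, rowValue, Grid.rotate]
  ring

lemma value_reflect (K : Certificate) (G : Grid) : K.value G.reflect = K.value G := by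
  simp only [value, rowValue, Grid.reflect]
  ring

lemma value_shear (K : Certificate) (G : Grid) : K.value G.shear = K.value G := by
  simp only [value, rowValue, Grid.shear]
  ring

/-- A condition on a grid which is imposed when a certificate takes the value zero. It
depends on the second moment of the first row and on the sum of a weight `σ` over the keys of the
three directions different from that of the rows. -/
structure Tightness where
  σ : ℕ → ℕ
  holds : ℕ → ℕ → Bool

def Tightness.grid (E : Tightness) (G : Grid) : Bool :=
  E.holds (sqSum G.a₀ G.a₁ G.a₂) (E.σ G.key₀ +ₙ E.σ G.key₁ +ₙ E.σ G.key₂)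

def part (p z x y t : ℕ) : ℕ := p *ₙ sqSum x y t +ₙ z *ₙ cubeCount x y t

/-- Test that the certificate is nonpositive on all sorted admissible grids, and that `E` holds
where it vanishes. -/
def check (K : Certificate) (p : Profile) (T : ℕ → Bool) (E : Tightness) : Bool :=
  p.forRows K.a fun a₀ a₁ a₂ => !(Nat.ble a₁ a₀ && Nat.ble a₂ a₁) ||
    (force (K.k.toNat +ₙ part K.p₀.toNat K.z₀.toNat a₀ a₁ a₂) fun X₀ =>
    force ((-K.k).toNat +ₙ part (-K.p₀).toNat (-K.z₀).toNat a₀ a₁ a₂) fun Y₀ =>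
    p.forRows K.b fun b₀ b₁ b₂ => !(Nat.ble b₁ b₀ && Nat.ble b₂ b₀) ||
    (force (X₀ +ₙ part K.p₁.toNat K.z₁.toNat b₀ b₁ b₂) fun X =>
    force (Y₀ +ₙ part (-K.p₁).toNat (-K.z₁).toNat b₀ b₁ b₂) fun Y =>
    force (K.w *ₙ (a₀ *ₙ b₀ +ₙ (a₁ *ₙ b₂ +ₙ a₂ *ₙ b₁))) fun d₀ =>
    force (K.w *ₙ (a₁ *ₙ b₁ +ₙ (a₀ *ₙ b₂ +ₙ a₂ *ₙ b₀))) fun d₁ =>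
    force (K.w *ₙ (a₂ *ₙ b₂ +ₙ (a₀ *ₙ b₁ +ₙ a₁ *ₙ b₀))) fun d₂ =>
    forBounded K.c (p.maxCard -ₙ max (a₀ +ₙ b₀) (max (a₁ +ₙ b₂) (a₂ +ₙ b₁)))
      (p.maxCard -ₙ max (a₁ +ₙ b₁) (max (a₀ +ₙ b₂) (a₂ +ₙ b₀)))
      (p.maxCard -ₙ max (a₂ +ₙ b₂) (max (a₀ +ₙ b₁) (a₁ +ₙ b₀))) fun c₀ c₁ c₂ =>
    (Nat.ble (X +ₙ part K.p₂.toNat K.z₂.toNat c₀ c₁ c₂)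
      (Y +ₙ part (-K.p₂).toNat (-K.z₂).toNat c₀ c₁ c₂ +ₙ (d₀ *ₙ c₀ +ₙ d₁ *ₙ c₁ +ₙ d₂ *ₙ c₂)) &&
    (E.grid ⟨a₀, a₁, a₂, b₀, b₁, b₂, c₀, c₁, c₂⟩ ||
    Nat.ble (X +ₙ part K.p₂.toNat K.z₂.toNat c₀ c₁ c₂ +ₙ 1)
      (Y +ₙ part (-K.p₂).toNat (-K.z₂).toNat c₀ c₁ c₂ +ₙ (d₀ *ₙ c₀ +ₙ d₁ *ₙ c₁ +ₙ d₂ *ₙ c₂)))) ||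
    !Grid.admissible p T ⟨a₀, a₁, a₂, b₀, b₁, b₂, c₀, c₁, c₂⟩))

lemma part_sub_part (p z : ℤ) (x y t : ℕ) :
    (part p.toNat z.toNat x y t : ℤ) - part (-p).toNat (-z).toNat x y t = rowValue p z x y t := by
  have hp := Int.toNat_sub_toNat_neg p
  have hz := Int.toNat_sub_toNat_neg z
  conv_rhs => rw [← hp, ← hz]
  simp only [part, rowValue, sqSum, cubeCount, cubeSum, Nat.add_eq, Nat.mul_eq]
  push_cast
  ring

/-- The certificate is nonpositive at `G`, and `E` holds if it vanishes there. -/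
def Nonpos (K : Certificate) (E : Tightness) (G : Grid) : Prop :=
  K.value G ≤ 0 ∧ (E.grid G = true ∨ K.value G < 0)

lemma nonpos_of_sorted {K : Certificate} {p : Profile} {T : ℕ → Bool} {E : Tightness}
    (h : K.check p T E = true) {G : Grid} (hG : G.Sorted) (ha : G.a₀ + G.a₁ + G.a₂ = K.a)
    (hb : G.b₀ + G.b₁ + G.b₂ = K.b) (hc : G.c₀ + G.c₁ + G.c₂ = K.c)
    (hadm : G.admissible p T = true) : K.Nonpos E G := by
  obtain ⟨⟨hpa, hpb, hpc⟩, h₀, h₁, h₂, -⟩ := Grid.admissible_iff.1 hadm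
  obtain ⟨s₁, s₂, s₃, s₄⟩ := hG
  simp only [Profile.ok_iff] at h₀ h₁ h₂
  have h := Profile.forRows_eq_true h hpa ha
  rw [Nat.ble_eq_true_of_le s₁, Nat.ble_eq_true_of_le s₂] at h
  simp only [Bool.and_self, Bool.not_true, Bool.false_or, force_eq] at h
  have h := Profile.forRows_eq_true h hpb hb
  rw [Nat.ble_eq_true_of_le s₃, Nat.ble_eq_true_of_le s₄] at h
  simp only [Bool.and_self, Bool.not_true, Bool.false_or] at h
  have h := forBounded_eq_true h (x := G.c₀) (y := G.c₁) (z := G.c₂) (by simp; omega)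
    (by simp; omega) (by simp; omega) hc
  change (_ || !Grid.admissible p T G) = true at h
  rw [hadm] at h
  change ((_ && (E.grid G || _)) || _) = true at h
  simp only [Bool.not_true, Bool.or_false, Bool.and_eq_true, Bool.or_eq_true, Nat.ble_eq] at h
  have e₀ := part_sub_part K.p₀ K.z₀ G.a₀ G.a₁ G.a₂
  have e₁ := part_sub_part K.p₁ K.z₁ G.b₀ G.b₁ G.b₂
  have e₂ := part_sub_part K.p₂ K.z₂ G.c₀ G.c₁ G.c₂
  have ek := Int.toNat_sub_toNat_neg K.k
  simp only [Nat.add_eq, Nat.mul_eq] at h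
  zify at h
  unfold Nonpos value
  refine ⟨by linarith [h.1], h.2.imp_right fun h' => by linarith⟩

lemma Tightness.grid_rotate (E : Tightness) (G : Grid) : E.grid G.rotate = E.grid G := by
  obtain ⟨k₀, k₁, k₂⟩ := G.key_rotate
  have h : sqSum G.a₁ G.a₂ G.a₀ = sqSum G.a₀ G.a₁ G.a₂ := by
    simp only [sqSum, Nat.add_eq, Nat.mul_eq]
    ring
  rw [grid, k₀, k₁, k₂]
  simp only [Grid.rotate, h, grid]

lemma Tightness.grid_reflect (E : Tightness) (G : Grid) : E.grid G.reflect = E.grid G := by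
  obtain ⟨k₀, k₁, k₂⟩ := G.key_reflect
  have h : sqSum G.a₀ G.a₂ G.a₁ = sqSum G.a₀ G.a₁ G.a₂ := by
    simp only [sqSum, Nat.add_eq, Nat.mul_eq]
    ring
  rw [grid, k₀, k₁, k₂]
  simp only [Grid.reflect, h, grid, Nat.add_eq, add_right_comm]

lemma Tightness.grid_shear (E : Tightness) (G : Grid) : E.grid G.shear = E.grid G := by
  obtain ⟨k₀, k₁, k₂⟩ := G.key_shear
  have h : E.σ G.key₁ + E.σ G.key₂ + E.σ G.key₀ = E.σ G.key₀ + E.σ G.key₁ + E.σ G.key₂ := by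
    ring
  rw [grid, k₀, k₁, k₂]
  simp only [Grid.shear, h, grid, Nat.add_eq]

lemma nonpos_of_admissible {K : Certificate} {p : Profile} {T : ℕ → Bool} {E : Tightness}
    (h : K.check p T E = true) (G : Grid) (ha : G.a₀ + G.a₁ + G.a₂ = K.a)
    (hb : G.b₀ + G.b₁ + G.b₂ = K.b) (hc : G.c₀ + G.c₁ + G.c₂ = K.c)
    (hadm : G.admissible p T = true) : K.Nonpos E G := by
  revert ha hb hc hadm
  refine Grid.induction_sorted (fun G h ha hb hc hadm => ?_) (fun G h ha hb hc hadm => ?_)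
    (fun G h ha hb hc hadm => ?_) (fun G hG ha hb hc hadm => nonpos_of_sorted h hG ha hb hc hadm) G
  · have := h (by rw [← ha, Grid.rotate]; ring) (by rw [← hb, Grid.rotate]; ring)
      (by rw [← hc, Grid.rotate]; ring) (Grid.admissible_rotate hadm)
    rwa [Nonpos, value_rotate, Tightness.grid_rotate] at this
  · have := h (by rw [← ha, Grid.reflect]; ring) (by rw [← hb, Grid.reflect]; ring)
      (by rw [← hc, Grid.reflect]; ring) (Grid.admissible_reflect hadm)
    rwa [Nonpos, value_reflect, Tightness.grid_reflect] at this
  · have := h (by rw [← ha, Grid.shear]) (by rw [← hb, Grid.shear]; ring)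
      (by rw [← hc, Grid.shear]; ring) (Grid.admissible_shear hadm)
    rwa [Nonpos, value_shear, Tightness.grid_shear] at this

end Certificate

/-- The sum of the cubes of the slice cardinalities, which serves to encode their multiset. -/
def dirKey (S : Finset V) (f : Dual V) : ℕ :=
  cubeSum (sliceCard S f 0) (sliceCard S f 1) (sliceCard S f 2)

def grid (S : Finset V) (f g : Dual V) : Grid :=
  ⟨cellCard S f g 0 0, cellCard S f g 0 1, cellCard S f g 0 2, cellCard S f g 1 0,
    cellCard S f g 1 1, cellCard S f g 1 2, cellCard S f g 2 0, cellCard S f g 2 1,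
    cellCard S f g 2 2⟩

lemma sliceCard_sub_smul (S : Finset V) (f g : Dual V) (t j : ZMod 3) :
    sliceCard S (g - t • f) j =
      cellCard S f g 0 j + cellCard S f g 1 (j + t) + cellCard S f g 2 (j + t * 2) := by
  rw [sliceCard_eq_sum_cellCard S f]
  simp only [cellCard_sub_smul, mul_zero, add_zero, mul_one]

lemma zmod_three_facts : (1 + 1 : ZMod 3) = 2 ∧ (1 + 2 : ZMod 3) = 0 ∧ (2 + 1 : ZMod 3) = 0 ∧
    (2 + 2 : ZMod 3) = 1 ∧ (2 * 2 : ZMod 3) = 1 := by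
  decide

lemma sub_two_smul (f g : Dual V) : g - (2 : ZMod 3) • f = g + f := by
  have h : ∀ a b : ZMod 3, a - 2 * b = a + b := by decide
  ext x
  simp [h]

lemma key_grid (S : Finset V) (f g : Dual V) :
    (grid S f g).key₀ = dirKey S g ∧ (grid S f g).key₁ = dirKey S (g - f) ∧
      (grid S f g).key₂ = dirKey S (g + f) := by
  obtain ⟨h1, h2, h3, h4, h5⟩ := zmod_three_facts
  have e₁ : g - f = g - (1 : ZMod 3) • f := by rw [one_smul]
  refine ⟨?_, ?_, ?_⟩
  · simp only [dirKey, sliceCard_eq_sum_cellCard S f g]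
    rfl
  · simp only [dirKey, e₁, sliceCard_sub_smul, zero_add, one_mul, h1, h2, h3, h4]
    rfl
  · simp only [dirKey, ← sub_two_smul, sliceCard_sub_smul, zero_add, h1, h2, h3, h4, h5]
    rfl

lemma admissible_grid {p : Profile} {n : ℕ} (hp : p.Valid n) [Finite V]
    (hV : Module.finrank (ZMod 3) V = n + 1) {S : Finset V} (hS : IsCapSet S) {f g : Dual V}
    (hf : f ≠ 0) (h : Transversal f g) {T : ℕ → Bool}
    (hT : ∀ g, Transversal f g → T (dirKey S g) = true) :
    (grid S f g).admissible p T = true := by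
  obtain ⟨k₀, k₁, k₂⟩ := key_grid S f g
  have hd (t j : ZMod 3) : p.ok (cellCard S f g 0 j) (cellCard S f g 1 (j + t))
      (cellCard S f g 2 (j + t * 2)) = true := by
    have := hp.ok_cellCard hV hS (h.sub_smul t).ne_zero ((h.sub_smul t).symm hf) j
    simpa only [cellCard_comm S (g - t • f), cellCard_sub_smul, mul_zero, add_zero, mul_one]
      using this
  rw [Grid.admissible_iff, k₀, k₁, k₂]
  refine ⟨⟨hp.ok_cellCard hV hS hf h 0, hp.ok_cellCard hV hS hf h 1, hp.ok_cellCard hV hS hf h 2⟩,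
    ⟨hd 0 0, hd 0 1, hd 0 2⟩, ⟨hd 1 0, hd 1 1, hd 1 2⟩, ⟨hd 2 0, hd 2 1, hd 2 2⟩,
    hT g h, hT _ ?_, hT _ ?_⟩
  · simpa using h.sub_smul 1
  · simpa only [sub_two_smul] using h.sub_smul 2

section Sums

open Classical in
lemma sum_not_transversal [Fintype (Dual V)] {f : Dual V} (hf : f ≠ 0) (F : Dual V → ℤ) :
    ∑ g with ¬ Transversal f g, F g = ∑ t : ZMod 3, F (t • f) := by
  rw [← sum_image fun s _ t _ h => smul_left_injective _ hf h]
  refine sum_congr ?_ fun _ _ => rfl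
  ext g
  simp [Transversal, eq_comm]

/-- The value of a certificate, in terms of moments of the slices of `S`. -/
noncomputable def Certificate.moment (K : Certificate) (S : Finset V) (f g : Dual V) : ℤ :=
  K.k + (K.p₀ * pairMoment (slice S f 0) g +
    K.z₀ * tripleMoment (slice S f 0) (slice S f 0) (slice S f 0) g) +
    (K.p₁ * pairMoment (slice S f 1) g +
    K.z₁ * tripleMoment (slice S f 1) (slice S f 1) (slice S f 1) g) +
    (K.p₂ * pairMoment (slice S f 2) g +
    K.z₂ * tripleMoment (slice S f 2) (slice S f 2) (slice S f 2) g) -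
    K.w * tripleMoment (slice S f 0) (slice S f 1) (slice S f 2) g

lemma Certificate.moment_eq (K : Certificate) (S : Finset V) (f g : Dual V) :
    K.moment S f g = K.value (grid S f g) := by
  simp only [moment, pairMoment_eq, tripleMoment_eq, value, rowValue, grid, cellCard]
  ring

/-- The sum of the values of a certificate over all transversal directions, where `q` is the
cardinality of a hyperplane. -/
def Certificate.total (K : Certificate) (q : ℤ) : ℤ :=
  3 * q * K.k + (K.p₀ * (q * (K.a * K.a) + 2 * q * K.a) +
    K.z₀ * (q * (K.a * K.a * K.a) + 2 * q * K.a))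
    + (K.p₁ * (q * (K.b * K.b) + 2 * q * K.b) + K.z₁ * (q * (K.b * K.b * K.b) + 2 * q * K.b))
    + (K.p₂ * (q * (K.c * K.c) + 2 * q * K.c) + K.z₂ * (q * (K.c * K.c * K.c) + 2 * q * K.c))
    - K.w * (q * (K.a * K.b * K.c))
    - 3 * (K.k + (K.p₀ * (K.a * K.a) + K.z₀ * (K.a * K.a * K.a)) +
      (K.p₁ * (K.b * K.b) + K.z₁ * (K.b * K.b * K.b)) +
      (K.p₂ * (K.c * K.c) + K.z₂ * (K.c * K.c * K.c)) - K.w * (K.a * K.b * K.c))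

open Classical in
lemma Certificate.sum_moment (K : Certificate) {n : ℕ} [Finite V] [Fintype (Dual V)]
    (hV : Module.finrank (ZMod 3) V = n + 1) {S : Finset V} (hS : IsCapSet S) {f : Dual V}
    (hf : f ≠ 0) (ha : sliceCard S f 0 = K.a) (hb : sliceCard S f 1 = K.b)
    (hc : sliceCard S f 2 = K.c) :
    ∑ g with Transversal f g, K.moment S f g = K.total (3 ^ n) := by
  have hslice (i : ZMod 3) : IsCapSet (slice S f i) := hS.mono (slice_subset S f i)
  have hdisj : Disjoint (slice S f 0) (slice S f 1) := disjoint_left.2 fun x h₀ h₁ =>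
    absurd ((mem_slice.1 h₀).2.symm.trans (mem_slice.1 h₁).2) (by decide)
  have hall : ∑ g, K.moment S f g = ∑ g with Transversal f g, K.moment S f g +
      ∑ g with ¬ Transversal f g, K.moment S f g := (sum_filter_add_sum_filter_not _ _ _).symm
  have hcst (t i : ZMod 3) : ∀ x ∈ slice S f i, (t • f) x = t * i := fun x hx => by
    rw [LinearMap.smul_apply, (mem_slice.1 hx).2, smul_eq_mul]
  have hspan (t : ZMod 3) : K.moment S f (t • f) =
      K.k + (K.p₀ * (K.a * K.a) + K.z₀ * (K.a * K.a * K.a)) +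
      (K.p₁ * (K.b * K.b) + K.z₁ * (K.b * K.b * K.b)) +
      (K.p₂ * (K.c * K.c) + K.z₂ * (K.c * K.c * K.c)) - K.w * (K.a * K.b * K.c) := by
    have e : ∀ i : ZMod 3, t * i + t * i + t * i = 0 := fun i => three_smul_eq_zero _
    have e' : t * 0 + t * 1 + t * 2 = 0 := by
      revert t
      decide
    simp only [moment, pairMoment_of_const (hcst t _),
      tripleMoment_of_const (hcst t _) (hcst t _) (hcst t _) (e _),
      tripleMoment_of_const (hcst t _) (hcst t _) (hcst t _) e']
    rw [← ha, ← hb, ← hc]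
    rfl
  rw [sum_not_transversal hf, sum_congr rfl fun t _ => hspan t, sum_const, card_univ,
    ZMod.card] at hall
  rw [← add_right_cancel_iff, ← hall]
  simp only [moment, sum_add_distrib, sum_sub_distrib, ← mul_sum, sum_pairMoment hV,
    sum_tripleMoment_self hV (hslice _), sum_const, card_univ, card_dual hV,
    sum_tripleMoment_of_disjoint hV hS (slice_subset S f 0) (slice_subset S f 1)
      (slice_subset S f 2) hdisj, total, ← ha, ← hb, ← hc, sliceCard, nsmul_eq_mul]
  push_cast
  ring

/-- If a certificate checks, then its total is nonpositive, and if the total vanishes then so does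
the value at every transversal direction. -/
theorem Certificate.sound {K : Certificate} {p : Profile} {T : ℕ → Bool} {E : Tightness} {n : ℕ}
    (hK : K.check p T E = true) (hp : p.Valid n) [Finite V]
    (hV : Module.finrank (ZMod 3) V = n + 1) {S : Finset V} (hS : IsCapSet S) {f : Dual V}
    (hf : f ≠ 0) (ha : sliceCard S f 0 = K.a) (hb : sliceCard S f 1 = K.b)
    (hc : sliceCard S f 2 = K.c) (hT : ∀ g, Transversal f g → T (dirKey S g) = true) :
    K.total (3 ^ n) ≤ 0 ∧
      (K.total (3 ^ n) = 0 → ∀ g, Transversal f g → E.grid (grid S f g) = true) := by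
  classical
  have := Fintype.ofFinite (Dual V)
  have hnon (g : Dual V) (hg : Transversal f g) : K.Nonpos E (grid S f g) :=
    nonpos_of_admissible hK _ (by rw [← ha]; exact (card_eq_sum_sliceCard _ g).symm)
      (by rw [← hb]; exact (card_eq_sum_sliceCard _ g).symm)
      (by rw [← hc]; exact (card_eq_sum_sliceCard _ g).symm) (admissible_grid hp hV hS hf hg hT)
  have hle : ∀ g ∈ ({g | Transversal f g} : Finset (Dual V)), K.moment S f g ≤ 0 := fun g hg => by
    rw [moment_eq]
    exact (hnon g (mem_filter.1 hg).2).1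
  rw [← K.sum_moment hV hS hf ha hb hc]
  refine ⟨sum_nonpos hle, fun h0 g hg => ?_⟩
  have := (sum_eq_zero_iff_of_nonpos hle).1 h0 g (by simpa using hg)
  rw [moment_eq] at this
  exact (hnon g hg).2.resolve_right this.not_lt

end Sums

section Sorting

def translate (S : Finset V) (v : V) : Finset V := S.map (addRightEmbedding v)

omit [Module (ZMod 3) V] in
lemma mem_translate {S : Finset V} {v x : V} : x ∈ translate S v ↔ x - v ∈ S := by
  simp only [translate, mem_map, addRightEmbedding_apply]
  exact ⟨by rintro ⟨y, hy, rfl⟩; simpa, fun h => ⟨_, h, sub_add_cancel x v⟩⟩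

lemma IsCapSet.translate {S : Finset V} (hS : IsCapSet S) (v : V) :
    IsCapSet (translate S v) := by
  intro a ha b hb c hc h
  refine sub_left_injective (hS _ (mem_translate.1 ha) _ (mem_translate.1 hb) _
    (mem_translate.1 hc) ?_)
  calc a - v + (b - v) + (c - v) = (a + b + c) - (v + v + v) := by abel
    _ = 0 := by rw [h, three_smul_eq_zero, sub_zero]

lemma sliceCard_translate (S : Finset V) (v : V) (g : Dual V) (j : ZMod 3) :
    sliceCard (translate S v) g j = sliceCard S g (j - g v) := by
  have h : slice (translate S v) g j = translate (slice S g (j - g v)) v := by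
    ext x
    simp [mem_translate]
  rw [sliceCard, h, translate, card_map, sliceCard]

lemma sliceCard_neg (S : Finset V) (g : Dual V) (j : ZMod 3) :
    sliceCard S (-g) j = sliceCard S g (-j) := by
  unfold sliceCard slice
  simp [neg_eq_iff_eq_neg]

lemma dirKey_translate (S : Finset V) (v : V) (g : Dual V) :
    dirKey (translate S v) g = dirKey S g := by
  simp only [dirKey, sliceCard_translate]
  rcases zmod_three_cases (g v) with h | h | h <;> rw [h]
  · simp
  · exact cubeSum_rotate _ _ _ |>.symm
  · exact cubeSum_rotate _ _ _

lemma dirKey_neg (S : Finset V) (g : Dual V) : dirKey S (-g) = dirKey S g := by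
  simp only [dirKey, sliceCard_neg]
  exact cubeSum_swap _ _ _

lemma exists_sorted_affine (s : ZMod 3 → ℕ) : ∃ i, (s (1 - i) ≤ s (0 - i) ∧ s (2 - i) ≤ s (1 - i)) ∨
    (s (-1 - i) ≤ s (-0 - i) ∧ s (-2 - i) ≤ s (-1 - i)) := by
  by_contra! h
  have h₀ : (_ → s 1 < s 2) ∧ (_ → s 2 < s 1) := h 0
  have h₁ : (_ → s 0 < s 1) ∧ (_ → s 1 < s 0) := h 1
  have h₂ : (_ → s 2 < s 0) ∧ (_ → s 0 < s 2) := h 2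
  change (s 1 ≤ s 0 → _) ∧ (s 2 ≤ s 0 → _) at h₀
  change (s 0 ≤ s 2 → _) ∧ (s 1 ≤ s 2 → _) at h₁
  change (s 2 ≤ s 1 → _) ∧ (s 0 ≤ s 1 → _) at h₂
  omega

/-- After a translation and possibly a change of sign, the slices are sorted by cardinality. -/
lemma exists_sorted {S : Finset V} (hS : IsCapSet S) {f : Dual V} (hf : f ≠ 0) :
    ∃ (S' : Finset V) (f' : Dual V), IsCapSet S' ∧ f' ≠ 0 ∧ sliceCard S' f' 1 ≤ sliceCard S' f' 0 ∧
      sliceCard S' f' 2 ≤ sliceCard S' f' 1 ∧ #S' = #S ∧ (∀ g, dirKey S' g = dirKey S g) ∧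
      (f' = f ∨ f' = -f) := by
  obtain ⟨i, hi⟩ := exists_sorted_affine (sliceCard S f)
  obtain ⟨v, rfl⟩ := exists_eq hf i
  rcases hi with hi | hi
  · exact ⟨translate S v, f, hS.translate v, hf, by simpa only [sliceCard_translate] using hi.1,
      by simpa only [sliceCard_translate] using hi.2, card_map _, dirKey_translate S v, .inl rfl⟩
  · refine ⟨translate S v, -f, hS.translate v, neg_ne_zero.2 hf, ?_, ?_, card_map _,
      dirKey_translate S v, .inr rfl⟩
    · simpa only [sliceCard_neg, sliceCard_translate] using hi.1
    · simpa only [sliceCard_neg, sliceCard_translate] using hi.2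

end Sorting

/-- Loop over the triples with sum `N` and entries at most `M`. -/
def forTriples (M N : ℕ) (f : ℕ → ℕ → ℕ → Bool) : Bool :=
  allLt (M +ₙ 1) fun x => allLt (M +ₙ 1) fun y => force (N -ₙ x -ₙ y) fun z =>
    !(Nat.ble z M && Nat.beq (x +ₙ y +ₙ z) N) || f x y z

lemma forTriples_eq_true {M N : ℕ} {f : ℕ → ℕ → ℕ → Bool} (h : forTriples M N f = true) {x y z : ℕ}
    (hx : x ≤ M) (hy : y ≤ M) (hz : z ≤ M) (hs : x + y + z = N) : f x y z = true := by
  have := allLt_eq_true (allLt_eq_true h (k := x) (by simp; omega)) (k := y) (by simp; omega)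
  rw [force_eq, show (N -ₙ x -ₙ y) = z by simp; omega] at this
  simpa [Nat.ble_eq_true_of_le hz, hs] using this

/-- A linear combination of the moments of a set of `N` points with respect to a functional. -/
structure GlobalCertificate where
  N : ℕ
  (k p z : ℤ)

namespace GlobalCertificate

def value (K : GlobalCertificate) (x y t : ℕ) : ℤ := K.k + Certificate.rowValue K.p K.z x y t

/-- The sum of the values of a certificate over all nonzero functionals, where `q` is the
cardinality of a hyperplane. -/
def total (K : GlobalCertificate) (q : ℤ) : ℤ :=
  3 * q * K.k + (K.p * (q * (K.N * K.N) + 2 * q * K.N) +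
    K.z * (q * (K.N * K.N * K.N) + 2 * q * K.N)) -
  (K.k + (K.p * (K.N * K.N) + K.z * (K.N * K.N * K.N)))

/-- Test that the certificate is nonpositive on all triples with key satisfying `T`, and that `E`
holds for the key if it vanishes. -/
def check (K : GlobalCertificate) (M : ℕ) (T E : ℕ → Bool) : Bool :=
  forTriples M K.N fun x y t => !T (cubeSum x y t) ||
    (Nat.ble (K.k.toNat +ₙ Certificate.part K.p.toNat K.z.toNat x y t)
      ((-K.k).toNat +ₙ Certificate.part (-K.p).toNat (-K.z).toNat x y t) &&
    (E (cubeSum x y t) || Nat.ble (K.k.toNat +ₙ Certificate.part K.p.toNat K.z.toNat x y t +ₙ 1)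
      ((-K.k).toNat +ₙ Certificate.part (-K.p).toNat (-K.z).toNat x y t)))

lemma value_nonpos {K : GlobalCertificate} {M : ℕ} {T E : ℕ → Bool} (h : K.check M T E = true)
    {x y t : ℕ} (hx : x ≤ M) (hy : y ≤ M) (ht : t ≤ M) (hs : x + y + t = K.N)
    (hT : T (cubeSum x y t) = true) :
    K.value x y t ≤ 0 ∧ (E (cubeSum x y t) = true ∨ K.value x y t < 0) := by
  have h := forTriples_eq_true h hx hy ht hs
  simp only [hT, Bool.not_true, Bool.false_or, Bool.and_eq_true, Bool.or_eq_true, Nat.ble_eq,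
    Nat.add_eq] at h
  have e := Certificate.part_sub_part K.p K.z x y t
  have ek := Int.toNat_sub_toNat_neg K.k
  zify at h
  unfold value
  exact ⟨by linarith [h.1], h.2.imp_right fun h' => by linarith⟩

lemma sum_value (K : GlobalCertificate) {n : ℕ} [Finite V] [Fintype (Dual V)] [DecidableEq (Dual V)]
    (hV : Module.finrank (ZMod 3) V = n + 1) {S : Finset V} (hS : IsCapSet S) (hN : #S = K.N) :
    ∑ f ∈ univ.erase (0 : Dual V), K.value (sliceCard S f 0) (sliceCard S f 1) (sliceCard S f 2) =
      K.total (3 ^ n) := by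
  have hval (f : Dual V) : K.value (sliceCard S f 0) (sliceCard S f 1) (sliceCard S f 2) =
      K.k + (K.p * pairMoment S f + K.z * tripleMoment S S S f) := by
    rw [value, Certificate.rowValue, pairMoment_eq, tripleMoment_eq]
    ring
  have h0 : ∀ x ∈ S, (0 : Dual V) x = 0 := fun _ _ => rfl
  simp only [hval]
  rw [← add_right_cancel_iff, sum_erase_add _ _ (mem_univ _), pairMoment_of_const h0,
    tripleMoment_of_const h0 h0 h0 (by simp)]
  simp only [sum_add_distrib, ← mul_sum, sum_pairMoment hV, sum_tripleMoment_self hV hS, sum_const,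
    card_univ, card_dual hV, total, ← hN, nsmul_eq_mul]
  push_cast
  ring

theorem sound {K : GlobalCertificate} {M n : ℕ} {T E : ℕ → Bool} (hK : K.check M T E = true)
    (hM : CapBound n M) [Finite V] (hV : Module.finrank (ZMod 3) V = n + 1) {S : Finset V}
    (hS : IsCapSet S) (hN : #S = K.N) (hT : ∀ f : Dual V, f ≠ 0 → T (dirKey S f) = true) :
    K.total (3 ^ n) ≤ 0 ∧
      (K.total (3 ^ n) = 0 → ∀ f : Dual V, f ≠ 0 → E (dirKey S f) = true) := by
  classical
  have := Fintype.ofFinite (Dual V)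
  have hnon (f : Dual V) (hf : f ≠ 0) := value_nonpos hK (hM.sliceCard_le hV hS hf 0)
    (hM.sliceCard_le hV hS hf 1) (hM.sliceCard_le hV hS hf 2)
    ((card_eq_sum_sliceCard S f).symm.trans hN) (hT f hf)
  have hle : ∀ f ∈ univ.erase (0 : Dual V),
      K.value (sliceCard S f 0) (sliceCard S f 1) (sliceCard S f 2) ≤ 0 :=
    fun f hf => (hnon f (ne_of_mem_erase hf)).1
  rw [← K.sum_value hV hS hN]
  refine ⟨sum_nonpos hle, fun h0 f hf => (hnon f hf).2.resolve_right ?_⟩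
  rw [(sum_eq_zero_iff_of_nonpos hle).1 h0 f (mem_erase.2 ⟨hf, mem_univ f⟩)]
  exact lt_irrefl 0

end GlobalCertificate

section Exclusion

def Certificate.noCondition : Certificate.Tightness := ⟨fun _ => 0, fun _ _ => true⟩

/-- The keys different from those of the types of the certificates in `L`. -/
def excluding (L : List Certificate) (k : ℕ) : Bool :=
  L.all fun K => !Nat.beq k (cubeSum K.a K.b K.c)

/-- Test that the keys of the types of the certificates in `L` determine these types. -/
def keysFaithful (M N : ℕ) (L : List Certificate) : Bool :=
  forTriples M N fun x y z => !(Nat.ble y x && Nat.ble z y) || (excluding L (cubeSum x y z) ||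
    L.any fun K => Nat.beq x K.a && (Nat.beq y K.b && Nat.beq z K.c))

lemma exists_sorted_of_key {M N n : ℕ} {L : List Certificate} (hL : keysFaithful M N L = true)
    (hM : CapBound n M) [Finite V] (hV : Module.finrank (ZMod 3) V = n + 1) {S : Finset V}
    (hS : IsCapSet S) (hN : #S = N) {f : Dual V} (hf : f ≠ 0)
    (h : excluding L (dirKey S f) ≠ true) :
    ∃ K ∈ L, ∃ (S' : Finset V) (f' : Dual V), IsCapSet S' ∧ f' ≠ 0 ∧ sliceCard S' f' 0 = K.a ∧
      sliceCard S' f' 1 = K.b ∧ sliceCard S' f' 2 = K.c ∧ #S' = #S ∧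
      (∀ g, dirKey S' g = dirKey S g) ∧ (f' = f ∨ f' = -f) := by
  obtain ⟨S', f', hS', hf', h₁, h₂, hcard, hkey, hff⟩ := exists_sorted hS hf
  have hk : dirKey S' f' = dirKey S f := by
    rw [hkey]
    rcases hff with rfl | rfl
    exacts [rfl, dirKey_neg S f]
  have := forTriples_eq_true hL (hM.sliceCard_le hV hS' hf' 0) (hM.sliceCard_le hV hS' hf' 1)
    (hM.sliceCard_le hV hS' hf' 2) (by rw [← card_eq_sum_sliceCard, hcard, hN])
  change (_ || (excluding L (dirKey S' f') || _)) = true at this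
  rw [hk, Bool.eq_false_of_not_eq_true h] at this
  simp only [Nat.ble_eq_true_of_le h₁, Nat.ble_eq_true_of_le h₂, Bool.and_self, Bool.not_true,
    Bool.false_or, List.any_eq_true, Bool.and_eq_true, Nat.beq_eq] at this
  obtain ⟨K, hK, ha, hb, hc⟩ := this
  exact ⟨K, hK, S', f', hS', hf', ha, hb, hc, hcard, hkey, hff⟩

/-- Directions whose slices have the cardinalities of a certificate with positive total do not
occur. -/
theorem exclude {M N n : ℕ} {L : List Certificate} {p : Profile} {T : ℕ → Bool}
    (hL : ∀ K ∈ L, K.check p T Certificate.noCondition = true)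
    (hpos : ∀ K ∈ L, 0 < K.total (3 ^ n)) (hfaith : keysFaithful M N L = true)
    (hM : CapBound n M) (hp : p.Valid n) [Finite V] (hV : Module.finrank (ZMod 3) V = n + 1)
    {S : Finset V} (hS : IsCapSet S) (hN : #S = N)
    (hT : ∀ f : Dual V, f ≠ 0 → T (dirKey S f) = true) {f : Dual V} (hf : f ≠ 0) :
    excluding L (dirKey S f) = true := by
  by_contra h
  obtain ⟨K, hK, S', f', hS', hf', ha, hb, hc, hcard, hkey, -⟩ :=
    exists_sorted_of_key hfaith hM hV hS hN hf h
  have := (Certificate.sound (hL K hK) hp hV hS' hf' ha hb hc fun g hg => by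
    rw [hkey]
    exact hT g hg.ne_zero).1
  exact this.not_gt (hpos K hK)

lemma key_of_forTriples {M N n : ℕ} {T A : ℕ → Bool}
    (h : forTriples M N (fun x y z => !T (cubeSum x y z) || A (cubeSum x y z)) = true)
    (hM : CapBound n M) [Finite V] (hV : Module.finrank (ZMod 3) V = n + 1) {S : Finset V}
    (hS : IsCapSet S) (hN : #S = N) {f : Dual V} (hf : f ≠ 0) (hT : T (dirKey S f) = true) :
    A (dirKey S f) = true := by
  have := forTriples_eq_true h (hM.sliceCard_le hV hS hf 0) (hM.sliceCard_le hV hS hf 1)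
    (hM.sliceCard_le hV hS hf 2) (by rw [← card_eq_sum_sliceCard, hN])
  change (!T (dirKey S f) || A (dirKey S f)) = true at this
  rwa [hT] at this

lemma capBound_of_card_ne {n m : ℕ}
    (h : ∀ (V : Type) [AddCommGroup V] [Module (ZMod 3) V] [Finite V],
      Module.finrank (ZMod 3) V = n → ∀ S : Finset V, IsCapSet S → #S ≠ m + 1) :
    CapBound n m := by
  intro V _ _ _ hV S hS
  by_contra! hlt
  obtain ⟨T, hTS, hT⟩ := exists_subset_card_eq hlt
  exact h V hV T (hS.mono hTS) hT

lemma capBound_of_total_pos {n M : ℕ} {K : GlobalCertificate} (hM : CapBound n M)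
    (hK : K.check M (fun _ => true) (fun _ => true) = true) {m : ℕ} (hm : K.N = m + 1)
    (hpos : 0 < K.total (3 ^ n)) : CapBound (n + 1) m :=
  capBound_of_card_ne fun _ _ _ _ hV _ hS hN =>
    (GlobalCertificate.sound hK hM hV hS (hN.trans hm.symm) fun _ _ => rfl).1.not_gt hpos

lemma Profile.valid_of_capBound {p : Profile} {n : ℕ} (h₁ : CapBound n p.maxSlice)
    (h₂ : CapBound (n + 1) p.maxCard)
    (h : ∀ (V : Type) [AddCommGroup V] [Module (ZMod 3) V] [Finite V],
      Module.finrank (ZMod 3) V = n + 1 → ∀ S : Finset V, IsCapSet S → ∀ f : Dual V, f ≠ 0 →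
        p.allow #S (dirKey S f) = true) : p.Valid (n + 1) := fun V _ _ _ hV S hS f hf => by
  rw [ok_iff, ← card_eq_sum_sliceCard]
  exact ⟨h₁.sliceCard_le hV hS hf 0, h₁.sliceCard_le hV hS hf 1, h₁.sliceCard_le hV hS hf 2,
    h₂ V hV S hS, h V hV S hS f hf⟩

end Exclusion

lemma not_beq_or {a b : ℕ} {c : Bool} (h : a = b → c = true) : (!Nat.beq a b || c) = true := by
  by_cases hab : a = b
  · rw [h hab, Bool.or_true]
  · rw [Bool.eq_false_of_not_eq_true (mt Nat.eq_of_beq_eq_true hab), Bool.not_false, Bool.true_or]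

lemma dirKey_eq_of_not_transversal {S : Finset V} {f g : Dual V} (hg : g ≠ 0)
    (h : ¬Transversal f g) : dirKey S g = dirKey S f := by
  simp only [Transversal, not_forall, not_not] at h
  obtain ⟨t, rfl⟩ := h
  rcases zmod_three_cases t with rfl | rfl | rfl
  · simp at hg
  · rw [one_smul]
  · rw [show (2 : ZMod 3) • f = -f by ext x; simp [show (2 : ZMod 3) = -1 from rfl], dirKey_neg]

section LowDimension

/-- Slices of a 9-cap in dimension three have cardinalities `4, 4, 1` or `3, 3, 3`. -/
def profile₃ : Profile := ⟨4, 9, fun s k => !Nat.beq s 9 || (Nat.beq k 129 || Nat.beq k 81)⟩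

lemma capBound_zero : CapBound 0 1 := fun V _ _ _ hV S _ => by
  have := Module.finrank_zero_iff.1 hV
  exact card_le_one.2 fun a _ b _ => Subsingleton.elim a b

lemma capBound_one : CapBound 1 2 :=
  capBound_of_total_pos (K := ⟨3, 9, 0, -1⟩) capBound_zero (by decide +kernel) rfl (by decide)

lemma capBound_two : CapBound 2 4 :=
  capBound_of_total_pos (K := ⟨5, -9, 1, 0⟩) capBound_one (by decide +kernel) rfl (by decide)

lemma capBound_three : CapBound 3 9 :=
  capBound_of_total_pos (K := ⟨10, -36, 1, 0⟩) capBound_two (by decide +kernel) rfl (by decide)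

lemma profile₃_valid : profile₃.Valid 3 :=
  Profile.valid_of_capBound capBound_two capBound_three fun V _ _ _ hV S hS f hf => by
    exact not_beq_or fun hN => (GlobalCertificate.sound (K := ⟨9, 972, -9, -3⟩) (T := fun _ => true)
    (E := fun k => Nat.beq k 129 || Nat.beq k 81) (by decide +kernel) capBound_two hV hS hN
      fun _ _ => rfl).2 (by decide) f hf

end LowDimension

section DimensionFour

def certificates₂₁ : List Certificate :=
  [⟨9, 9, 3, 1059, 1, 1, 1, -2, -2, 2, 2⟩]

lemma capBound_four : CapBound 4 20 := capBound_of_card_ne fun V _ _ _ hV S hS hN => by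
  have h₁ := (GlobalCertificate.sound (K := ⟨21, 11907, -18, -3⟩) (T := fun _ => true)
    (E := fun k => Nat.beq k 1485 || Nat.beq k 1029) (by decide +kernel) capBound_three hV hS hN
    fun _ _ => rfl).2 (by decide)
  have h₂ (f : Dual V) (hf : f ≠ 0) := exclude (L := certificates₂₁)
    (T := fun k => Nat.beq k 1485 || Nat.beq k 1029) (by decide +kernel) (by decide)
    (by decide +kernel) capBound_three profile₃_valid hV hS hN h₁ hf
  exact absurd (by decide) (GlobalCertificate.sound (K := ⟨21, -147, 1, 0⟩)
    (T := fun k => (Nat.beq k 1485 || Nat.beq k 1029) && excluding certificates₂₁ k)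
    (E := fun _ => true) (by decide +kernel) capBound_three hV hS hN fun f hf => by
      rw [h₁ f hf, h₂ f hf, Bool.and_self]).1.not_gt

def certificates₂₀ : List Certificate :=
  [⟨9, 8, 3, 1307, -2, -8, 3, -2, -2, 0, 4⟩,
    ⟨9, 7, 4, 98, 1, 1, 1, 0, 0, 0, 2⟩,
    ⟨9, 6, 5, 1181, 11, 8, -2, -4, -4, -2, 4⟩,
    ⟨8, 8, 4, 5886, -23, -23, -76, -2, -2, -8, 42⟩,
    ⟨8, 7, 5, 526, 2, -1, 3, -2, 0, -2, 2⟩,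
    ⟨7, 7, 6, 684, 5, 5, 3, -4, -4, 2, 2⟩]

lemma key_of_card_eq_twenty [Finite V] (hV : Module.finrank (ZMod 3) V = 4) {S : Finset V}
    (hS : IsCapSet S) (hN : #S = 20) {f : Dual V} (hf : f ≠ 0) :
    (Nat.beq (dirKey S f) 1466 || Nat.beq (dirKey S f) 944) = true := by
  have h₁ := exclude (L := certificates₂₀) (T := fun _ => true) (by decide +kernel) (by decide)
    (by decide +kernel) capBound_three profile₃_valid hV hS hN (fun _ _ => rfl) hf
  exact key_of_forTriples (A := fun k => Nat.beq k 1466 || Nat.beq k 944) (by decide +kernel)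
    capBound_three hV hS hN hf h₁

def certificates₁₉ : List Certificate :=
  [⟨9, 7, 3, 1898, -9, -6, -9, -4, -2, 4, 6⟩,
    ⟨9, 6, 4, 3202, -22, -4, -3, -8, -2, -2, 6⟩,
    ⟨9, 5, 5, 3281, -25, -4, -2, -8, -2, -2, 6⟩]

def certificates₉₉₁ : List Certificate :=
  [⟨9, 9, 1, 162, -1, -1, 0, 0, 0, 0, 4⟩]

def certificates₈₇₄ : List Certificate :=
  [⟨8, 7, 4, 7299, -22, -49, -66, -2, -6, -12, 58⟩]

def certificates₈₈₃ : List Certificate :=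
  [⟨8, 8, 3, -9, 0, 0, 0, 0, 0, 1, 0⟩]

/-- No direction of a 19-cap in dimension four has slices of cardinalities `8, 7, 4`, neither if
there is a direction with slices `9, 9, 1` nor otherwise. -/
lemma excluding_certificates₈₇₄ [Finite V] (hV : Module.finrank (ZMod 3) V = 4) {S : Finset V}
    (hS : IsCapSet S) (hN : #S = 19)
    (h₁ : ∀ f : Dual V, f ≠ 0 → excluding certificates₁₉ (dirKey S f) = true) {g : Dual V}
    (hg : g ≠ 0) : excluding certificates₈₇₄ (dirKey S g) = true := by
  by_cases h : ∃ f : Dual V, f ≠ 0 ∧ dirKey S f = 1459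
  · obtain ⟨f, hf, hkey⟩ := h
    obtain ⟨K, hK, S', f', hS', hf', ha, hb, hc, hcard, hkey', hff⟩ := exists_sorted_of_key
      (L := certificates₉₉₁) (by decide +kernel) capBound_three hV hS hN hf (by rw [hkey]; decide)
    obtain rfl := List.mem_singleton.1 hK
    have hf'' : dirKey S f' = 1459 := by
      rcases hff with rfl | rfl
      exacts [hkey, (dirKey_neg S f).trans hkey]
    simp only [excluding, certificates₈₇₄, List.all_cons, List.all_nil, Bool.and_true]
    by_cases hgf : Transversal f' g
    · have := (Certificate.sound (p := profile₃) (T := fun _ => true)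
        (E := ⟨fun k => bif Nat.beq k 919 then 1 else 0, fun _ n => Nat.beq n 0⟩)
        (by decide +kernel) profile₃_valid hV hS' hf' ha hb hc fun _ _ => rfl).2 (by decide) g hgf
      simp only [Certificate.Tightness.grid, key_grid, hkey'] at this
      change Nat.beq _ _ = true at this
      change (!Nat.beq (dirKey S g) 919) = true
      cases h : Nat.beq (dirKey S g) 919
      · rfl
      · simp [h] at this
    · rw [dirKey_eq_of_not_transversal hg hgf, hf'']
      rfl
  · push Not at h
    exact exclude (T := fun k => excluding certificates₁₉ k && !Nat.beq k 1459) (by decide +kernel)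
      (by decide) (by decide +kernel) capBound_three profile₃_valid hV hS hN
      (fun f hf => by
        simp [h₁ f hf, Bool.eq_false_of_not_eq_true (mt Nat.eq_of_beq_eq_true (h f hf))]) hg

lemma key_of_card_eq_nineteen [Finite V] (hV : Module.finrank (ZMod 3) V = 4) {S : Finset V}
    (hS : IsCapSet S) (hN : #S = 19) {f : Dual V} (hf : f ≠ 0) :
    (Nat.beq (dirKey S f) 1459 || (Nat.beq (dirKey S f) 1249 || (Nat.beq (dirKey S f) 853 ||
      (Nat.beq (dirKey S f) 811 || Nat.beq (dirKey S f) 775)))) = true := by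
  have h₁ (f : Dual V) (hf : f ≠ 0) := exclude (L := certificates₁₉) (T := fun _ => true)
    (by decide +kernel) (by decide) (by decide +kernel) capBound_three profile₃_valid hV hS hN
    (fun _ _ => rfl) hf
  have h₂ (f : Dual V) (hf : f ≠ 0) :
      (excluding certificates₁₉ (dirKey S f) && excluding certificates₈₇₄ (dirKey S f)) = true := by
    rw [h₁ f hf, excluding_certificates₈₇₄ hV hS hN h₁ hf, Bool.and_self]
  have h₃ := exclude (L := certificates₈₈₃)
    (T := fun k => excluding certificates₁₉ k && excluding certificates₈₇₄ k) (by decide +kernel)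
    (by decide) (by decide +kernel) capBound_three profile₃_valid hV hS hN h₂ hf
  exact key_of_forTriples
    (T := fun k => (excluding certificates₁₉ k && excluding certificates₈₇₄ k) &&
      excluding certificates₈₈₃ k)
    (A := fun k => Nat.beq k 1459 || (Nat.beq k 1249 || (Nat.beq k 853 || (Nat.beq k 811 ||
      Nat.beq k 775)))) (by decide +kernel) capBound_three hV hS hN hf (by simp [h₂ f hf, h₃])

/-- Constraints on the slices of caps with 19 or 20 points in dimension four. -/
def profile₄ : Profile := ⟨9, 20, fun s k =>
  (!Nat.beq s 20 || (Nat.beq k 1466 || Nat.beq k 944)) &&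
  (!Nat.beq s 19 || (Nat.beq k 1459 || (Nat.beq k 1249 || (Nat.beq k 853 || (Nat.beq k 811 ||
    Nat.beq k 775)))))⟩

lemma profile₄_valid : profile₄.Valid 4 :=
  Profile.valid_of_capBound capBound_three capBound_four fun V _ _ _ hV S hS f hf => by
    simp only [profile₄, not_beq_or fun h => key_of_card_eq_twenty hV hS h hf,
      not_beq_or fun h => key_of_card_eq_nineteen hV hS h hf, Bool.and_self]

end DimensionFour

section DimensionFive

def certificates₄₅ : List Certificate :=
  [⟨20, 20, 5, 90605, 18, -203, -15, 4, -24, 2, 18⟩,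
    ⟨20, 19, 6, 111822, -203, -2, -42, -24, 2, 4, 32⟩,
    ⟨20, 18, 7, 339573, -620, -68, -35, -76, -6, -6, 38⟩,
    ⟨20, 17, 8, 333349, -620, -55, -40, -78, -6, -6, 26⟩,
    ⟨20, 16, 9, 651471, -1246, -78, -71, -154, -6, -8, 54⟩,
    ⟨20, 15, 10, 257661, -468, -63, -8, -60, -6, 0, 22⟩,
    ⟨20, 14, 11, 17483, -33, -2, -3, -4, 0, 0, 2⟩,
    ⟨20, 13, 12, 234535, -407, -57, -45, -52, -6, -6, 26⟩,
    ⟨19, 19, 7, 34755, -33, -26, -7, -3, -2, -1, 19⟩,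
    ⟨19, 15, 11, 19654, -3, -24, -29, 2, 0, 0, 20⟩,
    ⟨19, 14, 12, 17438, -2, -19, -29, 2, 0, 0, 18⟩]

def certificates₄₅' : List Certificate :=
  [⟨19, 18, 8, 84863, -3, -116, -90, 2, -12, -12, 54⟩,
    ⟨19, 17, 9, 546646, -91, -819, -456, 22, -72, -26, 382⟩,
    ⟨19, 16, 10, 2455, -1, -2, -4, 0, 0, 0, 2⟩,
    ⟨19, 13, 13, 2603, -1, -4, -2, 0, 0, 0, 2⟩]

lemma key_of_card_eq_forty_five [Finite V] (hV : Module.finrank (ZMod 3) V = 5) {S : Finset V}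
    (hS : IsCapSet S) (hN : #S = 45) {f : Dual V} (hf : f ≠ 0) :
    (Nat.beq (dirKey S f) 12393 || Nat.beq (dirKey S f) 10125) = true := by
  have h₁ (f : Dual V) (hf : f ≠ 0) := exclude (L := certificates₄₅) (T := fun _ => true)
    (by decide +kernel) (by decide) (by decide +kernel) capBound_four profile₄_valid hV hS hN
    (fun _ _ => rfl) hf
  have h₂ (f : Dual V) (hf : f ≠ 0) := exclude (L := certificates₄₅')
    (T := excluding certificates₄₅) (by decide +kernel) (by decide) (by decide +kernel) capBound_four
    profile₄_valid hV hS hN h₁ hf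
  exact (GlobalCertificate.sound (K := ⟨45, 109350, -27, -3⟩)
    (T := fun k => excluding certificates₄₅ k && excluding certificates₄₅' k)
    (E := fun k => Nat.beq k 12393 || Nat.beq k 10125) (by decide +kernel) capBound_four hV hS hN
    fun f hf => by rw [h₁ f hf, h₂ f hf, Bool.and_self]).2 (by decide) f hf

lemma exists_dual_ne_zero [Finite V] {n : ℕ} (hV : Module.finrank (ZMod 3) V = n + 1) :
    ∃ f : Dual V, f ≠ 0 := by
  have : Nontrivial V := Module.nontrivial_of_finrank_pos (R := ZMod 3) (by omega)
  have : Nontrivial (Dual V) := inferInstance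
  exact exists_ne 0

lemma sliceCard_erase [DecidableEq V] {S : Finset V} {v : V} (hv : v ∈ S) (f : Dual V)
    (i : ZMod 3) :
    sliceCard (S.erase v) f i = if f v = i then sliceCard S f i - 1 else sliceCard S f i := by
  rw [sliceCard, slice, filter_erase]
  split_ifs with h
  · exact card_erase_of_mem (mem_filter.2 ⟨hv, h⟩)
  · exact congrArg card (erase_eq_of_notMem fun h' => h (mem_filter.1 h').2)

/-- If the keys of all caps with `N` points satisfy `A`, but no triple with sum `N + 1` satisfies
this after reducing its first or second entry, then there is no cap with `N + 1` points. -/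
lemma capBound_of_erase {n M N : ℕ} {A : ℕ → Bool} (hM : CapBound n M)
    (hA : ∀ (V : Type) [AddCommGroup V] [Module (ZMod 3) V] [Finite V],
      Module.finrank (ZMod 3) V = n + 1 → ∀ S : Finset V, IsCapSet S → #S = N →
        ∀ f : Dual V, f ≠ 0 → A (dirKey S f) = true) (hN : 2 * M ≤ N)
    (h : forTriples M (N + 1) (fun x y z =>
      !(A (cubeSum (x - 1) y z) && A (cubeSum x (y - 1) z))) = true) : CapBound (n + 1) N := by
  classical
  refine capBound_of_card_ne fun V _ _ _ hV S hS hcard => ?_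
  obtain ⟨f, hf⟩ := exists_dual_ne_zero hV
  have hle (i : ZMod 3) := hM.sliceCard_le hV hS hf i
  have hsum := card_eq_sum_sliceCard S f
  have key (i : ZMod 3) (hi : 0 < sliceCard S f i) : ∃ v, f v = i ∧ v ∈ S ∧
      A (dirKey (S.erase v) f) = true := by
    obtain ⟨v, hv⟩ := card_pos.1 hi
    obtain ⟨hv, hi⟩ := mem_filter.1 hv
    exact ⟨v, hi, hv, hA V hV _ (hS.mono (erase_subset v S))
      (by rw [card_erase_of_mem hv, hcard, Nat.add_sub_cancel]) f hf⟩
  have h0 := hle 0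
  have h1 := hle 1
  have h2 := hle 2
  obtain ⟨v, hv, hvS, hv'⟩ := key 0 (by omega)
  obtain ⟨w, hw, hwS, hw'⟩ := key 1 (by omega)
  have := forTriples_eq_true h h0 h1 h2 (by omega)
  simp only [dirKey, sliceCard_erase hvS, sliceCard_erase hwS, hv, hw] at hv' hw'
  simp only [show (0 : ZMod 3) ≠ 1 by decide, show (0 : ZMod 3) ≠ 2 by decide,
    show (1 : ZMod 3) ≠ 0 by decide, show (1 : ZMod 3) ≠ 2 by decide, if_true, if_false] at hv' hw'
  simp [hv', hw'] at this

lemma capBound_five : CapBound 5 45 :=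
  capBound_of_erase (A := fun k => Nat.beq k 12393 || Nat.beq k 10125) capBound_four
    (fun _ _ _ _ hV _ hS hN _ hf => key_of_card_eq_forty_five hV hS hN hf) (by omega)
    (by decide +kernel)

/-- Slices of a 45-cap in dimension five have cardinalities `18, 18, 9` or `15, 15, 15`. -/
def profile₅ : Profile := ⟨20, 45, fun s k => !Nat.beq s 45 || (Nat.beq k 12393 || Nat.beq k 10125)⟩

lemma profile₅_valid : profile₅.Valid 5 :=
  Profile.valid_of_capBound capBound_four capBound_five fun _ _ _ _ hV _ hS _ hf =>
    not_beq_or fun hN => key_of_card_eq_forty_five hV hS hN hf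

end DimensionFive

section DimensionSix

def certificates₁₁₄ : List Certificate :=
  [⟨45, 45, 24, 18225, -3, 0, 0, 0, 0, 0, 1⟩]

lemma card_ne_hundred_fourteen [Finite V] (hV : Module.finrank (ZMod 3) V = 6) {S : Finset V}
    (hS : IsCapSet S) : #S ≠ 114 := fun hN => by
  have h (f : Dual V) (hf : f ≠ 0) := exclude (L := certificates₁₁₄) (T := fun _ => true)
    (by decide +kernel) (by decide) (by decide +kernel) capBound_five profile₅_valid hV hS hN
    (fun _ _ => rfl) hf
  exact absurd (by decide) (GlobalCertificate.sound (K := ⟨114, 17401644, -597, -30⟩)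
    (T := excluding certificates₁₁₄) (E := fun _ => true) (by decide +kernel) capBound_five hV hS hN
    h).1.not_gt

def certificates₁₁₂ : List Certificate :=
  [⟨45, 44, 23, 1223117, -203, -96, -20, -18, -6, 0, 20⟩,
    ⟨45, 43, 24, 2118805, -354, -177, -38, -32, -10, 0, 34⟩,
    ⟨44, 44, 24, 47252472, -5798, -5798, -2231, -332, -332, -48, 1308⟩]

lemma exists_special [Finite V] (hV : Module.finrank (ZMod 3) V = 6) {S : Finset V}
    (hS : IsCapSet S) (hN : #S = 112) : ∃ f : Dual V, f ≠ 0 ∧ dirKey S f = 192898 := by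
  by_contra! hne
  have h (f : Dual V) (hf : f ≠ 0) := exclude (L := certificates₁₁₂) (T := fun _ => true)
    (by decide +kernel) (by decide) (by decide +kernel) capBound_five profile₅_valid hV hS hN
    (fun _ _ => rfl) hf
  exact absurd (by decide) (GlobalCertificate.sound (K := ⟨112, 16445184, -573, -30⟩)
    (T := fun k => excluding certificates₁₁₂ k && !Nat.beq k 192898) (E := fun _ => true)
    (by decide +kernel) capBound_five hV hS hN fun f hf => by
      simp [h f hf, Bool.eq_false_of_not_eq_true (mt Nat.eq_of_beq_eq_true (hne f hf))]).1.not_gt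

end DimensionSix

section SpecialDirections

/-- A certificate for the directions with slices of cardinalities `45, 45, 22`. -/
def specialCertificate : Certificate := ⟨45, 45, 22, 18225, -5, 0, 0, 0, 0, 0, 1⟩

/-- Either exactly one of the three keys is that of `45, 45, 22` and the other two are that of
`40, 36, 36`, or none of the keys is that of `45, 45, 22`. -/
def specialTightness : Certificate.Tightness :=
  ⟨fun k => bif Nat.beq k 192898 then 1 else bif Nat.beq k 157312 then 0 else 4,
    fun q n => (Nat.beq q 729 && Nat.beq n 1) || (Nat.beq q 675 && Nat.beq (n % 4) 0)⟩

lemma specialTightness_sigma (k : ℕ) : k = 192898 ∧ specialTightness.σ k = 1 ∨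
    k = 157312 ∧ specialTightness.σ k = 0 ∨ k ≠ 192898 ∧ specialTightness.σ k = 4 := by
  by_cases h : k = 192898
  · exact .inl ⟨h, by rw [h]; rfl⟩
  by_cases h' : k = 157312
  · exact .inr (.inl ⟨h', by rw [h']; rfl⟩)
  · refine .inr (.inr ⟨h, ?_⟩)
    simp [specialTightness, Bool.eq_false_of_not_eq_true (mt Nat.eq_of_beq_eq_true h),
      Bool.eq_false_of_not_eq_true (mt Nat.eq_of_beq_eq_true h')]

lemma specialTightness_holds {q n : ℕ} (h : specialTightness.holds q n = true) :
    q = 729 ∧ n = 1 ∨ q = 675 ∧ n % 4 = 0 := by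
  simpa [specialTightness] using h

lemma specialCertificate_sound [Finite V] (hV : Module.finrank (ZMod 3) V = 6) {S : Finset V}
    (hS : IsCapSet S) {f : Dual V} (hf : f ≠ 0) (ha : sliceCard S f 0 = 45)
    (hb : sliceCard S f 1 = 45) (hc : sliceCard S f 2 = 22) {g : Dual V} (hg : Transversal f g) :
    specialTightness.grid (grid S f g) = true :=
  (Certificate.sound (K := specialCertificate) (T := fun _ => true) (by decide +kernel)
    profile₅_valid hV hS hf ha hb hc fun _ _ => rfl).2 (by decide) g hg

lemma exists_special_sorted [Finite V] (hV : Module.finrank (ZMod 3) V = 6) {S : Finset V}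
    (hS : IsCapSet S) (hN : #S = 112) {f : Dual V} (hf : f ≠ 0) (hkey : dirKey S f = 192898) :
    ∃ (S' : Finset V) (f' : Dual V), IsCapSet S' ∧ f' ≠ 0 ∧ sliceCard S' f' 0 = 45 ∧
      sliceCard S' f' 1 = 45 ∧ sliceCard S' f' 2 = 22 ∧ (∀ g, dirKey S' g = dirKey S g) ∧
      (f' = f ∨ f' = -f) := by
  obtain ⟨K, hK, S', f', hS', hf', ha, hb, hc, -, hkey, hff⟩ := exists_sorted_of_key
    (L := [specialCertificate]) (by decide +kernel) capBound_five hV hS hN hf (by rw [hkey]; decide)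
  obtain rfl := List.mem_singleton.1 hK
  exact ⟨S', f', hS', hf', ha, hb, hc, hkey, hff⟩

lemma dirKey_zero (S : Finset V) : dirKey S 0 = #S * #S * #S := by
  simp [dirKey, sliceCard, slice, cubeSum, show (0 : ZMod 3) ≠ 2 by decide]

lemma dirKey_add_of_special [Finite V] (hV : Module.finrank (ZMod 3) V = 6) {S : Finset V}
    (hS : IsCapSet S) (hN : #S = 112) {f g : Dual V} (hf : dirKey S f = 192898)
    (hg : dirKey S g = 192898) : f = g ∨ f + g = 0 ∨ dirKey S (f + g) = 157312 := by
  have ne_zero {h : Dual V} (hh : dirKey S h = 192898) : h ≠ 0 := by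
    rintro rfl
    simp [dirKey_zero, hN] at hh
  obtain ⟨S', f', hS', hf', ha, hb, hc, hkey, hff⟩ := exists_special_sorted hV hS hN (ne_zero hf) hf
  by_cases hfg : Transversal f' g
  · right; right
    have := specialCertificate_sound hV hS' hf' ha hb hc hfg
    simp only [Certificate.Tightness.grid, key_grid, hkey, Nat.add_eq] at this
    have := specialTightness_holds this
    have h₀ := specialTightness_sigma (dirKey S g)
    have h₁ := specialTightness_sigma (dirKey S (g - f'))
    have h₂ := specialTightness_sigma (dirKey S (g + f'))
    rcases hff with rfl | rfl
    · rw [add_comm f' g]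
      omega
    · rw [sub_neg_eq_add] at *
      rw [add_comm f g]
      omega
  · simp only [Transversal, not_forall, not_not] at hfg
    obtain ⟨t, ht⟩ := hfg
    have ht' : g = 0 ∨ g = f' ∨ g = -f' := by
      rcases zmod_three_cases t with rfl | rfl | rfl
      · exact .inl (by rw [ht, zero_smul])
      · exact .inr (.inl (by rw [ht, one_smul]))
      · refine .inr (.inr (ht.trans ?_))
        ext x
        simp [show (2 : ZMod 3) = -1 from rfl]
    rcases ht' with rfl | rfl | rfl
    · exact absurd rfl (ne_zero hg)
    · rcases hff with rfl | rfl
      exacts [.inl rfl, .inr (.inl (add_neg_cancel f))]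
    · rcases hff with rfl | rfl
      exacts [.inr (.inl (add_neg_cancel _)), .inl (neg_neg f).symm]

/-- Exactly 112 functionals have slices of cardinalities `45, 45, 22`. -/
lemma card_special [Finite V] [Fintype (Dual V)] (hV : Module.finrank (ZMod 3) V = 6)
    {S : Finset V} (hS : IsCapSet S) (hN : #S = 112) :
    #{g : Dual V | dirKey S g = 192898} = 112 := by
  classical
  obtain ⟨f₀, hf₀, hkey₀⟩ := exists_special hV hS hN
  obtain ⟨S', f, hS', hf, ha, hb, hc, hkey, hff⟩ := exists_special_sorted hV hS hN hf₀ hkey₀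
  have hkeyf : dirKey S f = 192898 := by
    rcases hff with rfl | rfl
    exacts [hkey₀, (dirKey_neg S f₀).trans hkey₀]
  set s : Dual V → ℤ := fun g => if dirKey S g = 192898 then 1 else 0 with hs
  have hmoment (g : Dual V) (hg : Transversal f g) :
      (⟨45, 45, 22, -675, 1, 0, 0, 0, 0, 0, 0⟩ : Certificate).moment S' f g =
        54 * (s g + s (g - f) + s (g + f)) := by
    have := specialCertificate_sound hV hS' hf ha hb hc hg
    simp only [Certificate.Tightness.grid, key_grid, hkey, Nat.add_eq] at this
    have := specialTightness_holds this
    have h₀ := specialTightness_sigma (dirKey S g)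
    have h₁ := specialTightness_sigma (dirKey S (g - f))
    have h₂ := specialTightness_sigma (dirKey S (g + f))
    have hsq : ((sqSum (grid S' f g).a₀ (grid S' f g).a₁ (grid S' f g).a₂ : ℕ) : ℤ) - 675 =
        54 * (s g + s (g - f) + s (g + f)) := by
      simp only [hs]
      split_ifs <;> omega
    rw [Certificate.moment_eq, ← hsq]
    simp only [Certificate.value, Certificate.rowValue, sqSum, Nat.add_eq, Nat.mul_eq]
    push_cast
    ring
  have hsum := Certificate.sum_moment ⟨45, 45, 22, -675, 1, 0, 0, 0, 0, 0, 0⟩ hV hS' hf ha hb hc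
  have hshift (t : ZMod 3) : ∑ g with Transversal f g, s (g - t • f) =
      ∑ g with Transversal f g, s g :=
    sum_bij' (fun g _ => g - t • f) (fun g _ => g + t • f)
      (fun g hg => mem_filter.2 ⟨mem_univ _, (mem_filter.1 hg).2.sub_smul t⟩)
      (fun g hg => mem_filter.2 ⟨mem_univ _, by
        have h := (mem_filter.1 hg).2.sub_smul (-t)
        rwa [show g - -t • f = g + t • f by ext x; simp] at h⟩) (by simp) (by simp) (by simp)
  have h₁ := hshift 1
  have h₂ := hshift 2
  rw [sum_congr rfl fun g hg => hmoment g (mem_filter.1 hg).2, ← mul_sum, sum_add_distrib,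
    sum_add_distrib] at hsum
  simp only [one_smul, sub_two_smul] at h₁ h₂
  rw [h₁, h₂] at hsum
  have hspan := sum_not_transversal hf s
  have hs0 : s 0 = 0 := by simp [hs, dirKey_zero, hN]
  have hs1 : s f = 1 := by simp [hs, hkeyf]
  have hs2 : s (-f) = 1 := by simp [hs, dirKey_neg, hkeyf]
  have hspan' : ∑ t : ZMod 3, s (t • f) = 2 := by
    have h2 : (2 : ZMod 3) • f = -f := by ext x; simp [show (2 : ZMod 3) = -1 from rfl]
    let F : ZMod 3 → ℤ := fun t => s (t • f)
    calc ∑ t : ZMod 3, s (t • f) = s ((0 : ZMod 3) • f) + s ((1 : ZMod 3) • f) +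
          s ((2 : ZMod 3) • f) := Fin.sum_univ_three (fun t : Fin 3 => F t)
      _ = 2 := by rw [zero_smul, one_smul, h2, hs0, hs1, hs2]; rfl
  have hall := sum_filter_add_sum_filter_not (univ : Finset (Dual V)) (Transversal f) s
  rw [hspan, hspan'] at hall
  have hcard : ∑ g, s g = #{g : Dual V | dirKey S g = 192898} := by
    rw [hs, sum_boole]
  norm_num [Certificate.total] at hsum
  have hsum' : 54 * (∑ g with Transversal f g, s g + ∑ g with Transversal f g, s g +
      ∑ g with Transversal f g, s g) = 17820 := hsum
  have : (#{g : Dual V | dirKey S g = 192898} : ℤ) = 112 := by linarith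
  exact_mod_cast this

/-- Every functional other than those with slices of cardinalities `45, 45, 22` has slices of
cardinalities `40, 36, 36`, since otherwise it could be added, together with its negative, to the
cap formed by the former. -/
lemma dirKey_eq_or_eq [Finite V] (hV : Module.finrank (ZMod 3) V = 6) {S : Finset V}
    (hS : IsCapSet S) (hN : #S = 112) {d : Dual V} (hd : d ≠ 0) :
    dirKey S d = 192898 ∨ dirKey S d = 157312 := by
  classical
  have := Fintype.ofFinite (Dual V)
  by_contra! h
  set P : Finset (Dual V) := {g | dirKey S g = 192898} with hP
  have hmem {x : Dual V} : x ∈ insert d (insert (-d) P) ↔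
      (x = d ∨ x = -d) ∨ dirKey S x = 192898 := by
    simp [hP, or_assoc]
  have hkey {x : Dual V} (hx : x ∈ insert d (insert (-d) P)) : x ≠ 0 ∧ dirKey S x ≠ 157312 := by
    rcases hmem.1 hx with (rfl | rfl) | hx
    · exact ⟨hd, h.2⟩
    · exact ⟨neg_ne_zero.2 hd, by rw [dirKey_neg]; exact h.2⟩
    · refine ⟨?_, by omega⟩
      rintro rfl
      simp [dirKey_zero, hN] at hx
  have hpair {x y z : Dual V} (hxy : ((x = d ∨ x = -d) ∧ (y = d ∨ y = -d)) ∨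
      (dirKey S x = 192898 ∧ dirKey S y = 192898)) (hz : z ∈ insert d (insert (-d) P))
      (h0 : x + y + z = 0) : x = y ∧ z = x := by
    have hz' : dirKey S (x + y) = dirKey S z := by rw [eq_neg_of_add_eq_zero_left h0, dirKey_neg]
    have hxy' : x = y ∨ x + y = 0 ∨ dirKey S (x + y) = 157312 := by
      rcases hxy with ⟨rfl | rfl, rfl | rfl⟩ | ⟨hx, hy⟩
      · exact .inl rfl
      · exact .inr (.inl (add_neg_cancel _))
      · exact .inr (.inl (neg_add_cancel _))
      · exact .inl rfl
      · exact dirKey_add_of_special hV hS hN hx hy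
    rcases hxy' with rfl | h' | h'
    · exact ⟨rfl, add_left_cancel (h0.trans (three_smul_eq_zero x).symm)⟩
    · rw [h', zero_add] at h0
      exact absurd h0 (hkey hz).1
    · exact absurd (hz'.symm.trans h') (hkey hz).2
  have hcap : IsCapSet (insert d (insert (-d) P)) := by
    intro a ha b hb c hc h0
    have h0' : a + c + b = 0 := by rw [add_right_comm, h0]
    have h0'' : b + c + a = 0 := by rw [← h0]; abel
    rcases hmem.1 ha with ha' | ha' <;> rcases hmem.1 hb with hb' | hb' <;>
      rcases hmem.1 hc with hc' | hc'
    all_goals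
      first
      | exact (hpair (.inl ⟨ha', hb'⟩) hc h0).1
      | exact (hpair (.inr ⟨ha', hb'⟩) hc h0).1
      | exact (hpair (.inl ⟨ha', hc'⟩) hb h0').2.symm
      | exact (hpair (.inr ⟨ha', hc'⟩) hb h0').2.symm
      | exact (hpair (.inl ⟨hb', hc'⟩) ha h0'').2
      | exact (hpair (.inr ⟨hb', hc'⟩) ha h0'').2
  refine card_ne_hundred_fourteen (Subspace.dual_finrank_eq.trans hV) hcap ?_
  rw [card_insert_of_notMem, card_insert_of_notMem, card_special hV hS hN]
  · simp [hP, dirKey_neg, h.1]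
  · simp [hP, ne_neg_of_ne_zero hd, h.1]

end SpecialDirections

section Lines

lemma span_singleton_eq_iff {x y : V} :
    Submodule.span (ZMod 3) {x} = Submodule.span (ZMod 3) {y} ↔ x = y ∨ x = -y := by
  rw [Submodule.span_singleton_eq_span_singleton]
  constructor
  · rintro ⟨z, rfl⟩
    have hz : ∀ z : (ZMod 3)ˣ, z = 1 ∨ z = -1 := by decide
    rcases hz z with rfl | rfl
    · exact .inl (one_smul _ x).symm
    · exact .inr (by rw [Units.neg_smul, one_smul, neg_neg])
  · rintro (rfl | rfl)
    · exact ⟨1, one_smul _ x⟩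
    · exact ⟨-1, by rw [Units.neg_smul, one_smul, neg_neg]⟩

/-- Each line is spanned by exactly two vectors. -/
lemma natCard_span_singleton_mul_two [Fintype V] (P : V → Prop) [DecidablePred P]
    (hP : ∀ x, P x → P (-x)) (h0 : ¬P 0) :
    Nat.card {W : Submodule (ZMod 3) V // ∃ x, P x ∧ W = Submodule.span (ZMod 3) {x}} * 2 =
      #{x | P x} := by
  classical
  let line (x : V) : Submodule (ZMod 3) V := Submodule.span (ZMod 3) {x}
  rw [Nat.subtype_card (({x | P x} : Finset V).image line) (by simp [line, eq_comm]),
    card_eq_sum_card_image line]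
  refine (sum_const_nat fun W hW => ?_).symm
  obtain ⟨x, hx, rfl⟩ := mem_image.1 hW
  have hx := (mem_filter.1 hx).2
  have hx0 : x ≠ 0 := by
    rintro rfl
    exact h0 hx
  rw [← card_pair (ne_neg_of_ne_zero hx0)]
  congr 1
  ext y
  simp only [mem_filter, mem_univ, true_and, mem_insert, mem_singleton, line,
    span_singleton_eq_iff]
  refine ⟨fun h => h.2, ?_⟩
  rintro (rfl | rfl)
  exacts [⟨hx, .inl rfl⟩, ⟨hP x hx, .inr rfl⟩]

lemma finrank_eq_one_iff_exists_span {W : Submodule (ZMod 3) V} :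
    Module.finrank (ZMod 3) W = 1 ↔ ∃ x, x ≠ 0 ∧ W = Submodule.span (ZMod 3) {x} := by
  constructor
  · intro h
    obtain ⟨x, hx, hspan⟩ := finrank_eq_one_iff'.1 h
    refine ⟨x, by simpa using hx, le_antisymm (fun y hy => ?_) (by simp)⟩
    obtain ⟨c, hc⟩ := hspan ⟨y, hy⟩
    exact Submodule.mem_span_singleton.2 ⟨c, congrArg Subtype.val hc⟩
  · rintro ⟨x, hx, rfl⟩
    exact finrank_span_singleton hx

end Lines

section SliceMultiset

lemma isCapSet_of_isCap {n : ℕ} {S : Finset (Fin n → ZMod 3)} (hS : IsCap S) : IsCapSet S := by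
  intro a ha b hb c hc h
  by_contra hab
  refine hS a ha b hb c hc hab ?_ ?_ h
  · rintro rfl
    rw [add_right_comm] at h
    exact hab (add_left_cancel ((three_smul_eq_zero a).trans h.symm))
  · rintro rfl
    exact hab (add_right_cancel (b := b + b) (by
      rw [← add_assoc, h, ← add_assoc, three_smul_eq_zero]))

lemma sliceMul_eq {n : ℕ} (S : Finset (Fin n → ZMod 3)) (f : Dual (Fin n → ZMod 3)) :
    sliceMul S f = {sliceCard S f 0, sliceCard S f 1, sliceCard S f 2} := rfl

lemma dirKey_eq_sum_sliceMul {n : ℕ} (S : Finset (Fin n → ZMod 3)) (f : Dual (Fin n → ZMod 3)) :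
    dirKey S f = ((sliceMul S f).map fun k => k * k * k).sum := by
  rw [sliceMul_eq]
  simp [dirKey, cubeSum, add_assoc]

/-- The key of a functional determines its slice multiset. -/
lemma sliceMul_eq_of_dirKey {S : Finset (Fin 6 → ZMod 3)} (hS : IsCapSet S) (hN : #S = 112)
    {f : Dual (Fin 6 → ZMod 3)} (hf : f ≠ 0) :
    (dirKey S f = 192898 → sliceMul S f = {45, 45, 22}) ∧
      (dirKey S f = 157312 → sliceMul S f = {40, 36, 36}) := by
  have h : forTriples 45 112 (fun x y z =>
      (!Nat.beq (cubeSum x y z) 192898 || decide (List.Perm [x, y, z] [45, 45, 22])) &&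
      (!Nat.beq (cubeSum x y z) 157312 || decide (List.Perm [x, y, z] [40, 36, 36]))) = true := by
    decide +kernel
  have hle := capBound_five.sliceCard_le (Module.finrank_fin_fun (ZMod 3)) hS hf
  have := forTriples_eq_true h (hle 0) (hle 1) (hle 2) (by rw [← card_eq_sum_sliceCard, hN])
  simp only [Bool.and_eq_true, Bool.or_eq_true, Bool.not_eq_true', decide_eq_true_eq] at this
  refine ⟨fun h => ?_, fun h => ?_⟩
  · exact Multiset.coe_eq_coe.2 (this.1.resolve_left (by
      rw [show cubeSum _ _ _ = 192898 from h]; decide))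
  · exact Multiset.coe_eq_coe.2 (this.2.resolve_left (by
      rw [show cubeSum _ _ _ = 157312 from h]; decide))

lemma sliceMul_eq_special_iff {S : Finset (Fin 6 → ZMod 3)} (hS : IsCapSet S) (hN : #S = 112)
    {f : Dual (Fin 6 → ZMod 3)} (hf : f ≠ 0) :
    sliceMul S f = {45, 45, 22} ↔ dirKey S f = 192898 :=
  ⟨fun h => by rw [dirKey_eq_sum_sliceMul, h]; rfl, (sliceMul_eq_of_dirKey hS hN hf).1⟩

lemma sliceMul_eq_ordinary_iff {S : Finset (Fin 6 → ZMod 3)} (hS : IsCapSet S) (hN : #S = 112)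
    {f : Dual (Fin 6 → ZMod 3)} (hf : f ≠ 0) :
    sliceMul S f = {40, 36, 36} ↔ dirKey S f = 157312 :=
  ⟨fun h => by rw [dirKey_eq_sum_sliceMul, h]; rfl, (sliceMul_eq_of_dirKey hS hN hf).2⟩

lemma natCard_line_sliceMul_mul_two {n : ℕ} [Fintype (Dual (Fin n → ZMod 3))]
    {S : Finset (Fin n → ZMod 3)} {m : Multiset ℕ} {k : ℕ} (hk : #S * #S * #S ≠ k)
    (hm : ∀ f : Dual (Fin n → ZMod 3), f ≠ 0 → (sliceMul S f = m ↔ dirKey S f = k)) :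
    Nat.card {W : Submodule (ZMod 3) (Dual (Fin n → ZMod 3)) //
      ∃ f : Dual (Fin n → ZMod 3), f ≠ 0 ∧ W = Submodule.span (ZMod 3) {f} ∧
        sliceMul S f = m} * 2 = #{f : Dual (Fin n → ZMod 3) | dirKey S f = k} := by
  rw [← dirKey_zero] at hk
  rw [← natCard_span_singleton_mul_two (fun f : Dual (Fin n → ZMod 3) => dirKey S f = k)
    (fun f hf => (dirKey_neg S f).trans hf) hk]
  congr 3
  funext W
  refine propext <| exists_congr fun f =>
    ⟨fun ⟨hf, hW, h⟩ => ⟨(hm f hf).1 h, hW⟩, fun ⟨h, hW⟩ => ?_⟩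
  have hf : f ≠ 0 := by
    rintro rfl
    exact hk h
  exact ⟨hf, hW, (hm f hf).2 h⟩

end SliceMultiset

section Counting

variable [Finite V] [Fintype (Dual V)]

lemma card_dual_ne_zero [DecidablePred fun f : Dual V => f ≠ 0]
    (hV : Module.finrank (ZMod 3) V = 6) : #{f : Dual V | f ≠ 0} = 728 := by
  classical
  have h : ({f : Dual V | f ≠ 0} : Finset (Dual V)) = univ.erase 0 := by ext; simp
  rw [h, card_erase_of_mem (mem_univ _), card_univ, card_dual hV]
  rfl

/-- Exactly 616 functionals have slices of cardinalities `40, 36, 36`. -/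
lemma card_ordinary (hV : Module.finrank (ZMod 3) V = 6) {S : Finset V} (hS : IsCapSet S)
    (hN : #S = 112) : #{f : Dual V | dirKey S f = 157312} = 616 := by
  classical
  have h : #{f : Dual V | dirKey S f = 192898} + #{f : Dual V | dirKey S f = 157312} = 728 := by
    rw [← card_dual_ne_zero hV, ← card_union_of_disjoint]
    · congr 1
      ext f
      simp only [mem_union, mem_filter, mem_univ, true_and]
      refine ⟨?_, dirKey_eq_or_eq hV hS hN⟩
      rintro h rfl
      rw [dirKey_zero, hN] at h
      omega
    · exact disjoint_filter.2 fun f _ h h' => by omega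
  rw [card_special hV hS hN] at h
  omega

lemma natCard_finrank_eq_one (hV : Module.finrank (ZMod 3) V = 6) :
    Nat.card {W : Submodule (ZMod 3) (Dual V) // Module.finrank (ZMod 3) W = 1} = 364 := by
  classical
  simp only [finrank_eq_one_iff_exists_span]
  refine Nat.eq_of_mul_eq_mul_right two_pos ((natCard_span_singleton_mul_two
    (fun f : Dual V => f ≠ 0) (fun f hf => neg_ne_zero.2 hf) (by simp)).trans ?_)
  exact card_dual_ne_zero hV

end Counting

end TernaryCap

/-- Hyperplane directions of the 112-cap 6-flat: every nonzero functional has slice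
multiset {45,45,22} or {40,36,36}; among the 364 lines of the dual space, exactly 56
give {45,45,22} and exactly 308 give {40,36,36}. -/
theorem cap112_hyperplane_directions (S : Finset (Fin 6 → ZMod 3)) (hS : IsCap S)
    (hcard : S.card = 112) :
    (∀ ℓ : (Fin 6 → ZMod 3) →ₗ[ZMod 3] ZMod 3, ℓ ≠ 0 →
      sliceMul S ℓ = {45, 45, 22} ∨ sliceMul S ℓ = {40, 36, 36}) ∧
    Nat.card {W : Submodule (ZMod 3) (Module.Dual (ZMod 3) (Fin 6 → ZMod 3)) //
      Module.finrank (ZMod 3) W = 1} = 364 ∧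
    Nat.card {W : Submodule (ZMod 3) (Module.Dual (ZMod 3) (Fin 6 → ZMod 3)) //
      ∃ ℓ : Module.Dual (ZMod 3) (Fin 6 → ZMod 3), ℓ ≠ 0 ∧
        W = Submodule.span (ZMod 3) {ℓ} ∧ sliceMul S ℓ = {45, 45, 22}} = 56 ∧
    Nat.card {W : Submodule (ZMod 3) (Module.Dual (ZMod 3) (Fin 6 → ZMod 3)) //
      ∃ ℓ : Module.Dual (ZMod 3) (Fin 6 → ZMod 3), ℓ ≠ 0 ∧
        W = Submodule.span (ZMod 3) {ℓ} ∧ sliceMul S ℓ = {40, 36, 36}} = 308 := by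
  have hV : Module.finrank (ZMod 3) (Fin 6 → ZMod 3) = 6 := Module.finrank_fin_fun _
  have hS' := TernaryCap.isCapSet_of_isCap hS
  have := Fintype.ofFinite (Module.Dual (ZMod 3) (Fin 6 → ZMod 3))
  refine ⟨fun f hf => ?_, TernaryCap.natCard_finrank_eq_one hV, ?_, ?_⟩
  · rw [TernaryCap.sliceMul_eq_special_iff hS' hcard hf,
      TernaryCap.sliceMul_eq_ordinary_iff hS' hcard hf]
    exact TernaryCap.dirKey_eq_or_eq hV hS' hcard hf
  · refine Nat.eq_of_mul_eq_mul_right two_pos ((TernaryCap.natCard_line_sliceMul_mul_two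
      (by rw [hcard]; decide) fun f hf => TernaryCap.sliceMul_eq_special_iff hS' hcard hf).trans ?_)
    exact TernaryCap.card_special hV hS' hcard
  · refine Nat.eq_of_mul_eq_mul_right two_pos ((TernaryCap.natCard_line_sliceMul_mul_two
      (by rw [hcard]; decide) fun f hf =>
        TernaryCap.sliceMul_eq_ordinary_iff hS' hcard hf).trans ?_)
    exact TernaryCap.card_ordinary hV hS' hcard
end

section
/- Let S be a cap of size 112 in F = (Fin 6 → ZMod 3). For every nonzero linear functional ℓ : F → ZMod 3 whose slice multiset is {40, 36, 36}, there exist linearly independent linear functionals y₁, y₂ : F → ZMod 3, each with slice multiset {45, 45, 22}, such that ℓ spans the same line of the dual space as y₁ − y₂. -/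
section CapSets

open Module Finset
open scoped Classical

/-- Cap sets in an arbitrary vector space over the field of three elements. -/
def CapSet {V : Type} [AddCommGroup V] (S : Finset V) : Prop :=
  ∀ a ∈ S, ∀ b ∈ S, ∀ c ∈ S, a ≠ b → a ≠ c → b ≠ c → a + b + c ≠ 0

/-- The number of points of `X` on each hyperplane parallel to the kernel of `η`. -/
def row {V : Type} [AddCommGroup V] [Module (ZMod 3) V] (X : Finset V)
    (η : Dual (ZMod 3) V) (j : ZMod 3) : ℕ :=
  (X.filter fun x => η x = j).card

/-- The sum of the squares of a profile. -/
def sqSum (r : ZMod 3 → ℕ) : ℕ := ∑ j, r j * r j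

/-- The number of zero-sum triples counted by three profiles. -/
def zeroSum (r s t : ZMod 3 → ℕ) : ℕ := ∑ i, ∑ j, r i * s j * t (-i - j)

section Counting

variable {V : Type} [AddCommGroup V] [Module (ZMod 3) V]

theorem three_add (x : V) : x + x + x = 0 := by
  have : ((3 : ZMod 3)) • x = 0 := by rw [show (3 : ZMod 3) = 0 from rfl, zero_smul]
  rw [← this, show (3 : ZMod 3) = 1 + 1 + 1 from rfl, add_smul, add_smul, one_smul]

theorem sum_row (X : Finset V) (η : Dual (ZMod 3) V) : ∑ j, row X η j = X.card :=
  (card_eq_sum_card_fiberwise fun x _ => mem_univ (η x)).symm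

theorem sum_apply_eq_sum_row (X : Finset V) (η : Dual (ZMod 3) V) (f : ZMod 3 → ℕ) :
    ∑ x ∈ X, f (η x) = ∑ j, row X η j * f j := by
  rw [← sum_fiberwise X (fun x => η x) fun x => f (η x)]
  refine sum_congr rfl fun j _ => ?_
  rw [sum_congr rfl fun x hx => by rw [(mem_filter.1 hx).2], sum_const, smul_eq_mul, row]

theorem sqSum_row (X : Finset V) (η : Dual (ZMod 3) V) :
    sqSum (row X η) = ∑ x ∈ X, ∑ y ∈ X, if η (x - y) = 0 then 1 else 0 := by
  rw [sqSum, ← sum_apply_eq_sum_row X η (row X η)]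
  refine sum_congr rfl fun x _ => ?_
  rw [row, card_filter]
  exact sum_congr rfl fun y _ => by
    simp only [map_sub, sub_eq_zero, eq_comm (a := η x)]

theorem zeroSum_row (X Y Z : Finset V) (η : Dual (ZMod 3) V) :
    zeroSum (row X η) (row Y η) (row Z η) =
      ∑ x ∈ X, ∑ y ∈ Y, ∑ z ∈ Z, if η (x + y + z) = 0 then 1 else 0 := by
  have h : ∀ x y, (∑ z ∈ Z, if η (x + y + z) = 0 then 1 else 0) = row Z η (-η x - η y) := by
    intro x y
    rw [row, card_filter]
    refine sum_congr rfl fun z _ => ?_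
    congr 1
    rw [map_add, map_add, eq_sub_iff_add_eq, eq_neg_iff_add_eq_zero]
    exact propext ⟨fun h => by rw [← h]; abel, fun h => by rw [← h]; abel⟩
  simp only [h]
  rw [sum_apply_eq_sum_row X η fun i => ∑ y ∈ Y, row Z η (-i - η y)]
  refine sum_congr rfl fun i _ => ?_
  rw [sum_apply_eq_sum_row Y η fun j => row Z η (-i - j), mul_sum]
  exact sum_congr rfl fun j _ => by ring

variable [Finite V]

noncomputable instance : Fintype (Dual (ZMod 3) V) :=
  have : Finite (Dual (ZMod 3) V) := DFunLike.finite _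
  Fintype.ofFinite _

theorem card_dual {n : ℕ} (hn : finrank (ZMod 3) V = n) :
    Fintype.card (Dual (ZMod 3) V) = 3 ^ n := by
  have := card_eq_pow_finrank (K := ZMod 3) (V := Dual (ZMod 3) V)
  rw [this, Subspace.dual_finrank_eq, hn, ZMod.card]

theorem card_dual_vanish {n : ℕ} (hn : finrank (ZMod 3) V = n + 1) (v : V) :
    (∑ η : Dual (ZMod 3) V, if η v = 0 then 1 else 0) = 3 ^ n + if v = 0 then 2 * 3 ^ n else 0 := by
  split_ifs with hv
  · simp [hv, card_dual hn]; ring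
  · rw [← card_filter, add_zero]
    obtain ⟨g, hg⟩ := Projective.exists_dual_eq_one (ZMod 3) hv
    have h1 : ∀ j : ZMod 3, (univ.filter fun η : Dual (ZMod 3) V => η v = j).card =
        (univ.filter fun η : Dual (ZMod 3) V => η v = 0).card := fun j =>
      card_bij' (fun η _ => η - j • g) (fun η _ => η + j • g) (by simp [hg, sub_eq_zero])
        (by simp [hg]) (by simp) (by simp)
    have h2 := card_eq_sum_card_fiberwise (s := (univ : Finset (Dual (ZMod 3) V)))
      (f := fun η => η v) (t := univ) fun x _ => mem_univ _
    rw [sum_congr rfl fun j _ => h1 j, sum_const, card_univ, card_univ, card_dual hn, ZMod.card,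
      smul_eq_mul, pow_succ] at h2
    omega

theorem sum_sqSum_row {n : ℕ} (hn : finrank (ZMod 3) V = n + 1) (X : Finset V) :
    ∑ η : Dual (ZMod 3) V, sqSum (row X η) = 3 ^ n * X.card ^ 2 + 2 * 3 ^ n * X.card := by
  simp only [sqSum_row]
  rw [sum_comm, sum_congr rfl fun x _ => sum_comm]
  simp only [card_dual_vanish hn, sub_eq_zero, sum_add_distrib, sum_const, smul_eq_mul,
    sum_ite_eq]
  rw [sum_congr rfl fun x hx => if_pos hx, sum_const, smul_eq_mul]
  ring

theorem sum_zeroSum_row {n : ℕ} (hn : finrank (ZMod 3) V = n + 1) (X Y Z : Finset V) :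
    ∑ η : Dual (ZMod 3) V, zeroSum (row X η) (row Y η) (row Z η) =
      3 ^ n * (X.card * Y.card * Z.card) +
        2 * 3 ^ n * ∑ x ∈ X, ∑ y ∈ Y, ∑ z ∈ Z, if x + y + z = 0 then 1 else 0 := by
  simp only [zeroSum_row]
  rw [sum_comm, sum_congr rfl fun x _ => sum_comm,
    sum_congr rfl fun x _ => sum_congr rfl fun y _ => sum_comm]
  simp only [card_dual_vanish hn, sum_add_distrib, sum_const, smul_eq_mul, mul_sum, mul_ite,
    mul_one, mul_zero]
  ring

end Counting

theorem CapSet.mono {V : Type} [AddCommGroup V] {S T : Finset V} (hS : CapSet S)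
    (h : T ⊆ S) : CapSet T :=
  fun a ha b hb c hc => hS a (h ha) b (h hb) c (h hc)

section CapIdentities

variable {V : Type} [AddCommGroup V] [Module (ZMod 3) V]

theorem CapSet.eq_of_add_eq_zero {S : Finset V} (hS : CapSet S) {x y z : V} (hx : x ∈ S)
    (hy : y ∈ S) (hz : z ∈ S) (h : x + y + z = 0) : y = x ∧ z = x := by
  have h3 := three_add x
  have h4 := three_add y
  have key : x = y ∨ x = z ∨ y = z := by
    by_contra! hne
    exact hS x hx y hy z hz hne.1 hne.2.1 hne.2.2 h
  rcases key with rfl | rfl | rfl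
  · exact ⟨rfl, add_left_cancel (h.trans h3.symm)⟩
  · refine ⟨add_right_cancel (b := x) (add_left_cancel (a := x) ?_), rfl⟩
    rw [← add_assoc, ← add_assoc, h, h3]
  · have : x = y := by
      rw [add_assoc] at h h4
      exact add_right_cancel (h.trans h4.symm)
    exact ⟨this.symm, this.symm⟩

theorem CapSet.zeroSum_count {S : Finset V} (hS : CapSet S) :
    (∑ x ∈ S, ∑ y ∈ S, ∑ z ∈ S, if x + y + z = 0 then 1 else 0) = S.card := by
  rw [card_eq_sum_ones]
  refine sum_congr rfl fun x hx => ?_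
  rw [sum_eq_single_of_mem x hx, sum_eq_single_of_mem x hx, if_pos (three_add x)]
  · exact fun z hz hzx => if_neg fun h => hzx (hS.eq_of_add_eq_zero hx hx hz h).2
  · exact fun y hy hyx => sum_eq_zero fun z hz => if_neg fun h =>
      hyx (hS.eq_of_add_eq_zero hx hy hz h).1

end CapIdentities

/-- The part of `S` on which the functional `f` takes the value `i`. -/
noncomputable def level {V : Type} [AddCommGroup V] [Module (ZMod 3) V] (S : Finset V)
    (f : Dual (ZMod 3) V) (i : ZMod 3) : Finset V :=
  S.filter fun x => f x = i

/-- Coefficients of a polynomial in three profiles: a constant, the number of pairs and of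
zero-sum triples in each profile, and the number of transversal zero-sum triples. -/
structure Coeffs where
  (const qa ca qb cb qc cc tr : ℕ)

/-- The linear form with the given coefficients. -/
def Coeffs.lin (P : Coeffs) (k qa ca qb cb qc cc t : ℕ) : ℕ :=
  P.const * k + P.qa * qa + P.ca * ca + P.qb * qb + P.cb * cb + P.qc * qc + P.cc * cc + P.tr * t

/-- The polynomial with the given coefficients, evaluated at three profiles. -/
def Coeffs.val (P : Coeffs) (r s t : ZMod 3 → ℕ) : ℕ :=
  P.lin 1 (sqSum r) (zeroSum r r r) (sqSum s) (zeroSum s s s) (sqSum t) (zeroSum t t t)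
    (zeroSum r s t)

/-- The sum of `P.val` over all functionals on a space of dimension `n + 1`, for the profiles of
three parallel slices of a cap, of sizes `a`, `b` and `d`. -/
def Coeffs.total (P : Coeffs) (n a b d : ℕ) : ℕ :=
  P.lin (3 ^ (n + 1)) (3 ^ n * a ^ 2 + 2 * 3 ^ n * a) (3 ^ n * (a * a * a) + 2 * 3 ^ n * a)
    (3 ^ n * b ^ 2 + 2 * 3 ^ n * b) (3 ^ n * (b * b * b) + 2 * 3 ^ n * b)
    (3 ^ n * d ^ 2 + 2 * 3 ^ n * d) (3 ^ n * (d * d * d) + 2 * 3 ^ n * d) (3 ^ n * (a * b * d))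

/-- The part of `P.total` coming from the multiples of the slicing functional. -/
def Coeffs.spanPart (P : Coeffs) (a b d : ℕ) : ℕ :=
  3 * P.lin 1 (a ^ 2) (a * a * a) (b ^ 2) (b * b * b) (d ^ 2) (d * d * d) (a * b * d)

section Pencil

variable {V : Type} [AddCommGroup V] [Module (ZMod 3) V]

theorem apply_of_mem_level {S : Finset V} {f : Dual (ZMod 3) V} {i : ZMod 3} {x : V}
    (h : x ∈ level S f i) : f x = i :=
  (mem_filter.1 h).2

theorem level_subset (S : Finset V) (f : Dual (ZMod 3) V) (i : ZMod 3) : level S f i ⊆ S :=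
  filter_subset _ _

theorem card_level (S : Finset V) (f : Dual (ZMod 3) V) (i : ZMod 3) :
    (level S f i).card = row S f i := rfl

theorem sqSum_row_of_const {X : Finset V} {η : Dual (ZMod 3) V} {i : ZMod 3}
    (h : ∀ x ∈ X, η x = i) : sqSum (row X η) = X.card ^ 2 := by
  rw [sqSum_row, sum_congr rfl fun x hx => sum_congr rfl fun y hy =>
    if_pos (by rw [map_sub, h x hx, h y hy, sub_self])]
  simp [sq]

theorem zeroSum_row_of_const {X Y Z : Finset V} {η : Dual (ZMod 3) V} {i j k : ZMod 3}
    (hX : ∀ x ∈ X, η x = i) (hY : ∀ x ∈ Y, η x = j) (hZ : ∀ x ∈ Z, η x = k)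
    (h : i + j + k = 0) :
    zeroSum (row X η) (row Y η) (row Z η) = X.card * Y.card * Z.card := by
  rw [zeroSum_row, sum_congr rfl fun x hx => sum_congr rfl fun y hy => sum_congr rfl fun z hz =>
    if_pos (by rw [map_add, map_add, hX x hx, hY y hy, hZ z hz, h])]
  simp [mul_assoc]

theorem CapSet.zeroSum_levels {S : Finset V} (hS : CapSet S) (f : Dual (ZMod 3) V)
    {i j k : ZMod 3} (hij : i ≠ j) (hik : i ≠ k) (hjk : j ≠ k) :
    (∑ x ∈ level S f i, ∑ y ∈ level S f j, ∑ z ∈ level S f k,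
      if x + y + z = 0 then 1 else 0) = 0 := by
  refine sum_eq_zero fun x hx => sum_eq_zero fun y hy => sum_eq_zero fun z hz => if_neg ?_
  refine hS x (level_subset _ _ _ hx) y (level_subset _ _ _ hy) z (level_subset _ _ _ hz) ?_ ?_ ?_
  · rintro rfl
    exact hij ((apply_of_mem_level hx).symm.trans (apply_of_mem_level hy))
  · rintro rfl
    exact hik ((apply_of_mem_level hx).symm.trans (apply_of_mem_level hz))
  · rintro rfl
    exact hjk ((apply_of_mem_level hy).symm.trans (apply_of_mem_level hz))

theorem Coeffs.sum_val (P : Coeffs) (s : Finset (Dual (ZMod 3) V)) (X Y Z : Finset V) :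
    ∑ η ∈ s, P.val (row X η) (row Y η) (row Z η) =
      P.lin s.card (∑ η ∈ s, sqSum (row X η)) (∑ η ∈ s, zeroSum (row X η) (row X η) (row X η))
        (∑ η ∈ s, sqSum (row Y η)) (∑ η ∈ s, zeroSum (row Y η) (row Y η) (row Y η))
        (∑ η ∈ s, sqSum (row Z η)) (∑ η ∈ s, zeroSum (row Z η) (row Z η) (row Z η))
        (∑ η ∈ s, zeroSum (row X η) (row Y η) (row Z η)) := by
  simp only [Coeffs.val, Coeffs.lin, sum_add_distrib, ← mul_sum, sum_const, smul_eq_mul]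
  ring

variable [Finite V]

theorem sum_span {f : Dual (ZMod 3) V} (hf : f ≠ 0) (g : Dual (ZMod 3) V → ℕ) :
    ∑ η with η ∈ Submodule.span (ZMod 3) {f}, g η = ∑ k : ZMod 3, g (k • f) := by
  symm
  refine sum_bij (fun k _ => k • f) (fun k _ => ?_) (fun k _ l _ h => ?_) (fun η hη => ?_)
    fun _ _ => rfl
  · simpa using Submodule.smul_mem _ k (Submodule.mem_span_singleton_self f)
  · exact smul_left_injective _ hf h
  · obtain ⟨k, hk⟩ := Submodule.mem_span_singleton.1 (mem_filter.1 hη).2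
    exact ⟨k, mem_univ _, hk⟩

theorem Coeffs.sum_off_span {n : ℕ} (hn : finrank (ZMod 3) V = n + 1) {S : Finset V}
    (hS : CapSet S) {f : Dual (ZMod 3) V} (hf : f ≠ 0) {i j k : ZMod 3} (hij : i ≠ j)
    (hik : i ≠ k) (hjk : j ≠ k) (P : Coeffs) :
    (∑ η with η ∉ Submodule.span (ZMod 3) {f},
        P.val (row (level S f i) η) (row (level S f j) η) (row (level S f k) η)) +
      P.spanPart (row S f i) (row S f j) (row S f k) =
    P.total n (row S f i) (row S f j) (row S f k) := by
  have h0 : i + j + k = 0 := by revert i j k; decide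
  have h3 : ∀ x : ZMod 3, x + x + x = 0 := by decide
  have hc : ∀ m l, ∀ x ∈ level S f l, (m • f) x = m * l := fun m l x hx => by
    rw [LinearMap.smul_apply, apply_of_mem_level hx, smul_eq_mul]
  have hspan : ∑ η with η ∈ Submodule.span (ZMod 3) {f},
      P.val (row (level S f i) η) (row (level S f j) η) (row (level S f k) η) =
      P.spanPart (row S f i) (row S f j) (row S f k) := by
    rw [sum_span hf, Coeffs.spanPart, sum_congr rfl fun m _ => ?_, sum_const, card_univ, ZMod.card,
      smul_eq_mul]
    rw [Coeffs.val, sqSum_row_of_const (hc m i), sqSum_row_of_const (hc m j),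
      sqSum_row_of_const (hc m k), zeroSum_row_of_const (hc m i) (hc m i) (hc m i) (h3 _),
      zeroSum_row_of_const (hc m j) (hc m j) (hc m j) (h3 _),
      zeroSum_row_of_const (hc m k) (hc m k) (hc m k) (h3 _),
      zeroSum_row_of_const (hc m i) (hc m j) (hc m k) (by rw [← mul_add, ← mul_add, h0, mul_zero])]
    rfl
  rw [← hspan, add_comm, sum_filter_add_sum_filter_not, Coeffs.sum_val, card_univ, card_dual hn]
  simp only [sum_sqSum_row hn, sum_zeroSum_row hn, hS.zeroSum_levels f hij hik hjk,
    (hS.mono (level_subset S f _)).zeroSum_count, card_level, Coeffs.total, mul_zero, add_zero]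

/-- If `N` is pointwise at most `P` away from the multiples of `f`, the same holds for the sums. -/
theorem Coeffs.total_le {n : ℕ} (hn : finrank (ZMod 3) V = n + 1) {S : Finset V}
    (hS : CapSet S) {f : Dual (ZMod 3) V} (hf : f ≠ 0) {i j k : ZMod 3} (hij : i ≠ j)
    (hik : i ≠ k) (hjk : j ≠ k) (P N : Coeffs)
    (h : ∀ η ∉ Submodule.span (ZMod 3) {f},
      N.val (row (level S f i) η) (row (level S f j) η) (row (level S f k) η) ≤
        P.val (row (level S f i) η) (row (level S f j) η) (row (level S f k) η)) :
    N.total n (row S f i) (row S f j) (row S f k) +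
        P.spanPart (row S f i) (row S f j) (row S f k) ≤
      P.total n (row S f i) (row S f j) (row S f k) +
        N.spanPart (row S f i) (row S f j) (row S f k) := by
  have hN := N.sum_off_span hn hS hf hij hik hjk
  have hP := P.sum_off_span hn hS hf hij hik hjk
  have := sum_le_sum (s := univ.filter (· ∉ Submodule.span (ZMod 3) {f}))
    fun η hη => h η (mem_filter.1 hη).2
  omega

/-- If `N` is pointwise at most `P` away from the multiples of `f`, and the sums show that
equality holds on average, then equality holds pointwise. -/
theorem Coeffs.val_eq {n : ℕ} (hn : finrank (ZMod 3) V = n + 1) {S : Finset V}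
    (hS : CapSet S) {f : Dual (ZMod 3) V} (hf : f ≠ 0) {i j k : ZMod 3} (hij : i ≠ j)
    (hik : i ≠ k) (hjk : j ≠ k) (P N : Coeffs)
    (h : ∀ η ∉ Submodule.span (ZMod 3) {f},
      N.val (row (level S f i) η) (row (level S f j) η) (row (level S f k) η) ≤
        P.val (row (level S f i) η) (row (level S f j) η) (row (level S f k) η))
    (htot : P.total n (row S f i) (row S f j) (row S f k) +
        N.spanPart (row S f i) (row S f j) (row S f k) ≤
      N.total n (row S f i) (row S f j) (row S f k) +
        P.spanPart (row S f i) (row S f j) (row S f k)) :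
    ∀ η ∉ Submodule.span (ZMod 3) {f},
      N.val (row (level S f i) η) (row (level S f j) η) (row (level S f k) η) =
        P.val (row (level S f i) η) (row (level S f j) η) (row (level S f k) η) := by
  have hN := N.sum_off_span hn hS hf hij hik hjk
  have hP := P.sum_off_span hn hS hf hij hik hjk
  have h' : ∀ η ∈ univ.filter (· ∉ Submodule.span (ZMod 3) {f}), _ :=
    fun η hη => h η (mem_filter.1 hη).2
  have hle := sum_le_sum h'
  exact fun η hη => (sum_eq_sum_iff_of_le h').1 (by omega) η (mem_filter.2 ⟨mem_univ _, hη⟩)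

end Pencil

/-- Caps in dimension `n` have at most `c` points. -/
def CapBound (n c : ℕ) : Prop :=
  ∀ (V : Type) [AddCommGroup V] [Module (ZMod 3) V] [Finite V], finrank (ZMod 3) V = n →
    ∀ S : Finset V, CapSet S → S.card ≤ c

/-- In dimension `n`, the size of a cap and the sum of the squares of its slice sizes with respect
to any nonzero functional satisfy the relation `R`. -/
def CapTypes (n : ℕ) (R : ℕ → ℕ → Bool) : Prop :=
  ∀ (V : Type) [AddCommGroup V] [Module (ZMod 3) V] [Finite V], finrank (ZMod 3) V = n →
    ∀ S : Finset V, CapSet S → ∀ f : Dual (ZMod 3) V, f ≠ 0 → R S.card (sqSum (row S f)) = true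

section Restriction

variable {V : Type} [AddCommGroup V] [Module (ZMod 3) V]

theorem domRestrict_ker_ne_zero {f g : Dual (ZMod 3) V}
    (hg : g ∉ Submodule.span (ZMod 3) {f}) : g.domRestrict (LinearMap.ker f) ≠ 0 := by
  intro h
  apply hg
  have := mem_span_of_iInf_ker_le_ker (ι := Unit) (L := fun _ => f) (K := g) (by
    intro x hx
    have hx' : x ∈ LinearMap.ker f := by simpa using hx
    exact LinearMap.congr_fun h ⟨x, hx'⟩)
  simpa using this

theorem row_level_add_smul (S : Finset V) (f g : Dual (ZMod 3) V) (m s l : ZMod 3) :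
    row (level S (g + m • f) s) f l = row (level S f l) g (s - m * l) := by
  unfold row level
  rw [filter_filter, filter_filter]
  congr 1
  refine filter_congr fun x _ => ?_
  simp only [LinearMap.add_apply, LinearMap.smul_apply, smul_eq_mul, eq_sub_iff_add_eq]
  constructor
  · rintro ⟨h, rfl⟩; exact ⟨rfl, h⟩
  · rintro ⟨rfl, h⟩; exact ⟨h, rfl⟩

theorem row_add_smul (S : Finset V) (f g : Dual (ZMod 3) V) (m s : ZMod 3) :
    row S (g + m • f) s = ∑ l, row (level S f l) g (s - m * l) := by
  rw [← card_level, ← sum_row _ f]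
  exact sum_congr rfl fun l _ => row_level_add_smul S f g m s l

variable [Finite V]

theorem CapSet.exists_restrict {S : Finset V} (hS : CapSet S) {f : Dual (ZMod 3) V} (hf : f ≠ 0)
    (i : ZMod 3) :
    ∃ T : Finset (LinearMap.ker f), CapSet T ∧ T.card = (level S f i).card ∧
      ∀ g : Dual (ZMod 3) V, ∃ s, ∀ j,
        row T (g.domRestrict (LinearMap.ker f)) j = row (level S f i) g (j + s) := by
  obtain ⟨v, hv⟩ := LinearMap.surjective hf i
  have := Fintype.ofFinite (LinearMap.ker f)
  have hrow : ∀ g : Dual (ZMod 3) V, ∀ j,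
      row (univ.filter fun w : LinearMap.ker f => (w : V) + v ∈ S)
        (g.domRestrict (LinearMap.ker f)) j = row (level S f i) g (j + g v) := by
    intro g j
    refine card_bij' (fun w _ => (w : V) + v) (fun x hx => ⟨x - v, ?_⟩) (fun w hw => ?_)
      (fun x hx => ?_) (fun w _ => ?_) (fun x _ => ?_)
    · simp [apply_of_mem_level (mem_filter.1 hx).1, hv]
    · obtain ⟨h1, h2⟩ := mem_filter.1 hw
      have h3 : f w = 0 := LinearMap.mem_ker.1 w.2
      rw [LinearMap.domRestrict_apply] at h2
      exact mem_filter.2 ⟨mem_filter.2 ⟨(mem_filter.1 h1).2, by rw [map_add, h3, hv, zero_add]⟩,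
        by rw [map_add, h2]⟩
    · have h2 := (mem_filter.1 hx).2
      have h1 := level_subset _ _ _ (mem_filter.1 hx).1
      exact mem_filter.2 ⟨mem_filter.2 ⟨mem_univ _, by rwa [sub_add_cancel]⟩,
        by rw [LinearMap.domRestrict_apply, map_sub, h2, add_sub_cancel_right]⟩
    · simp
    · simp
  refine ⟨univ.filter fun w => (w : V) + v ∈ S, ?_, ?_, fun g => ⟨g v, hrow g⟩⟩
  · intro a ha b hb c hc hab hac hbc h
    have hi : ∀ w w' : LinearMap.ker f, w ≠ w' → (w : V) + v ≠ w' + v := fun w w' hw h =>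
      hw (Subtype.ext (add_right_cancel h))
    refine hS _ (mem_filter.1 ha).2 _ (mem_filter.1 hb).2 _ (mem_filter.1 hc).2
      (hi _ _ hab) (hi _ _ hac) (hi _ _ hbc) ?_
    have h' : (a : V) + b + c = 0 := by exact_mod_cast congrArg Subtype.val h
    calc (a : V) + v + (b + v) + (c + v) = (a + b + c) + (v + v + v) := by abel
      _ = 0 := by rw [h', three_add, add_zero]
  · rw [← sum_row _ ((0 : Dual (ZMod 3) V).domRestrict _), ← sum_row (level S f i) 0]
    exact sum_congr rfl fun j _ => by rw [hrow]; simp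

theorem finrank_ker {n : ℕ} (hn : finrank (ZMod 3) V = n + 1) {f : Dual (ZMod 3) V}
    (hf : f ≠ 0) : finrank (ZMod 3) (LinearMap.ker f) = n := by
  have := Module.Dual.finrank_ker_add_one_of_ne_zero (f := f) hf
  omega

theorem CapBound.row_le {n c : ℕ} (hc : CapBound n c) (hn : finrank (ZMod 3) V = n + 1)
    {S : Finset V} (hS : CapSet S) {f : Dual (ZMod 3) V} (hf : f ≠ 0) (i : ZMod 3) :
    row S f i ≤ c := by
  obtain ⟨T, hT, h, -⟩ := hS.exists_restrict hf i
  exact h.symm.trans_le (hc _ (finrank_ker hn hf) T hT)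

theorem CapTypes.apply_level {n : ℕ} {R : ℕ → ℕ → Bool} (hR : CapTypes n R)
    (hn : finrank (ZMod 3) V = n + 1) {S : Finset V} (hS : CapSet S) {f g : Dual (ZMod 3) V}
    (hf : f ≠ 0) (hg : g ∉ Submodule.span (ZMod 3) {f}) (i : ZMod 3) :
    R (row S f i) (sqSum (row (level S f i) g)) = true := by
  obtain ⟨T, hT, h, hs⟩ := hS.exists_restrict hf i
  obtain ⟨s, hs⟩ := hs g
  have := hR _ (finrank_ker hn hf) T hT _ (domRestrict_ker_ne_zero hg)
  rw [h, sqSum] at this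
  simp only [hs] at this
  rw [Fintype.sum_equiv (Equiv.addRight s) (fun j => row (level S f i) g (j + s) *
    row (level S f i) g (j + s)) (fun j => row (level S f i) g j * row (level S f i) g j)
      fun _ => rfl] at this
  exact this

theorem CapBound.row_level_le {n c : ℕ} (hc : CapBound n c)
    (hn : finrank (ZMod 3) V = n + 2) {S : Finset V} (hS : CapSet S) {f g : Dual (ZMod 3) V}
    (hf : f ≠ 0) (hg : g ∉ Submodule.span (ZMod 3) {f}) (i j : ZMod 3) :
    row (level S f i) g j ≤ c := by
  obtain ⟨T, hT, h, hs⟩ := hS.exists_restrict hf i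
  obtain ⟨s, hs⟩ := hs g
  rw [← sub_add_cancel j s, ← hs]
  exact hc.row_le (finrank_ker hn hf) hT (domRestrict_ker_ne_zero hg) _

end Restriction

/-- `allBelow n p` tests `p` on all numbers less than `n`. -/
def allBelow (n : ℕ) (p : ℕ → Bool) : Bool :=
  Nat.rec true (fun k ih => p k && ih) n

/-- `evalAt n p` is `p n`, written as a recursion to force the evaluation of `n` first. -/
def evalAt (n : ℕ) (p : ℕ → Bool) : Bool :=
  Nat.rec (p 0) (fun k _ => p k.succ) n

/-- The sum of three squares. -/
def sq3 (x y z : ℕ) : ℕ := x * x + y * y + z * z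

/-- The number of zero-sum triples of a profile `x, y, z`. -/
def cub3 (x y z : ℕ) : ℕ := x * x * x + y * y * y + z * z * z + 6 * (x * y * z)

/-- A search through the normalized triples of profiles of sums `a`, `b`, `d` that have entries at
most `c`, line sums at most `H`, and whose rows and lines satisfy `R`. For all of these, `F` has to
hold for the values of `N` and `P` and the square sums in the three directions off the slicing. -/
def pencilCheck (c H : ℕ) (R : ℕ → ℕ → Bool) (F : ℕ → ℕ → ℕ → ℕ → ℕ → Bool)
    (P N : Coeffs) (a b d : ℕ) : Bool :=
  allBelow (c + 1) fun a0 => allBelow (a0 + 1) fun a1 =>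
  Nat.blt a (a0 + a1) || evalAt (a - a0 - a1) fun a2 => Nat.blt a1 a2 ||
  (evalAt (sq3 a0 a1 a2) fun qa => !R a qa || (
  allBelow (c + 1) fun b0 => allBelow (b0 + 1) fun b1 =>
  Nat.blt b (b0 + b1) || evalAt (b - b0 - b1) fun b2 => Nat.blt b0 b2 ||
  (evalAt (sq3 b0 b1 b2) fun qb => !R b qb || (
  evalAt (min c (H - max (max (a0 + b0) (a1 + b2)) (a2 + b1))) fun u0 =>
  evalAt (min c (H - max (max (a0 + b2) (a2 + b0)) (a1 + b1))) fun u1 =>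
  evalAt (min c (H - max (max (a0 + b1) (a1 + b0)) (a2 + b2))) fun u2 =>
  evalAt (a0 * b0 + a1 * b2 + a2 * b1) fun w0 =>
  evalAt (a0 * b2 + a2 * b0 + a1 * b1) fun w1 =>
  evalAt (a0 * b1 + a1 * b0 + a2 * b2) fun w2 =>
  evalAt (P.const + P.qa * qa + P.ca * cub3 a0 a1 a2 + P.qb * qb + P.cb * cub3 b0 b1 b2) fun kp =>
  evalAt (N.const + N.qa * qa + N.ca * cub3 a0 a1 a2 + N.qb * qb + N.cb * cub3 b0 b1 b2) fun kn =>
  allBelow (u0 + 1) fun c0 => Nat.blt d c0 || evalAt (d - c0 - u2) fun l =>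
  allBelow (u1 + 1 - l) fun i => evalAt (l + i) fun c1 => Nat.blt d (c0 + c1) ||
  evalAt (d - c0 - c1) fun c2 => evalAt (sq3 c0 c1 c2) fun qc => evalAt (cub3 c0 c1 c2) fun cc =>
  evalAt (w0 * c0 + w1 * c1 + w2 * c2) fun t =>
  F (kn + N.qc * qc + N.cc * cc + N.tr * t) (kp + P.qc * qc + P.cc * cc + P.tr * t)
    (sq3 (a0 + b0 + c0) (a1 + b1 + c1) (a2 + b2 + c2))
    (sq3 (a0 + b1 + c2) (a1 + b2 + c0) (a2 + b0 + c1))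
    (sq3 (a0 + b2 + c1) (a1 + b0 + c2) (a2 + b1 + c0)) ||
  !(R d qc &&
    R (a0 + b0 + c0) (sq3 a0 b0 c0) && R (a1 + b1 + c1) (sq3 a1 b1 c1) &&
    R (a2 + b2 + c2) (sq3 a2 b2 c2) && R (a0 + b1 + c2) (sq3 a0 b1 c2) &&
    R (a1 + b2 + c0) (sq3 a1 b2 c0) && R (a2 + b0 + c1) (sq3 a2 b0 c1) &&
    R (a0 + b2 + c1) (sq3 a0 b2 c1) && R (a1 + b0 + c2) (sq3 a1 b0 c2) &&
    R (a2 + b1 + c0) (sq3 a2 b1 c0))))))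

/-- The sum of the squares of the three line sums in direction `d`. -/
def lineSq (r s t : ZMod 3 → ℕ) (d : ZMod 3) : ℕ :=
  ∑ i, (r i + s (i + d) + t (i - d)) * (r i + s (i + d) + t (i - d))

/-- Triples of profiles with entries at most `c`, line sums at most `H`, and all of whose rows and
lines satisfy `R`. -/
structure Admissible (c H : ℕ) (R : ℕ → ℕ → Bool) (r s t : ZMod 3 → ℕ) : Prop where
  r_le : ∀ i, r i ≤ c
  s_le : ∀ i, s i ≤ c
  t_le : ∀ i, t i ≤ c
  r_types : R (∑ i, r i) (sqSum r) = true
  s_types : R (∑ i, s i) (sqSum s) = true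
  t_types : R (∑ i, t i) (sqSum t) = true
  line_le : ∀ i j k, i + j + k = 0 → r i + s j + t k ≤ H
  line_types : ∀ i j k, i + j + k = 0 → R (r i + s j + t k) (sq3 (r i) (s j) (t k)) = true

section Search

theorem allBelow_eq_true {n : ℕ} {p : ℕ → Bool} (h : allBelow n p = true) {k : ℕ} (hk : k < n) :
    p k = true := by
  induction n with
  | zero => omega
  | succ n ih =>
    have h' : (p n && allBelow n p) = true := h
    rw [Bool.and_eq_true] at h'
    rcases Nat.lt_succ_iff_lt_or_eq.1 hk with hk | rfl
    exacts [ih h'.2 hk, h'.1]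

theorem evalAt_eq_true {n : ℕ} {p : ℕ → Bool} (h : evalAt n p = true) {k : ℕ} (hk : n = k) :
    p k = true := by
  subst hk
  cases n <;> exact h

theorem of_blt_or {m n : ℕ} {p : Bool} (h : (Nat.blt m n || p) = true) (hmn : n ≤ m) :
    p = true := by
  rcases Bool.or_eq_true_iff.1 h with h | h
  · rw [Nat.blt_eq] at h
    omega
  · exact h

theorem of_not_or {p q : Bool} (h : (!p || q) = true) (hp : p = true) : q = true := by
  subst hp
  exact h

theorem sum_zmod_three (f : ZMod 3 → ℕ) : ∑ i, f i = f 0 + f 1 + f 2 := Fin.sum_univ_three f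

theorem sqSum_eq_sq3 (r : ZMod 3 → ℕ) : sqSum r = sq3 (r 0) (r 1) (r 2) := sum_zmod_three _

theorem zeroSum_eq (r s t : ZMod 3 → ℕ) : zeroSum r s t =
    (r 0 * s 0 * t 0 + r 0 * s 1 * t 2 + r 0 * s 2 * t 1) +
    (r 1 * s 0 * t 2 + r 1 * s 1 * t 1 + r 1 * s 2 * t 0) +
    (r 2 * s 0 * t 1 + r 2 * s 1 * t 0 + r 2 * s 2 * t 2) := by
  simp only [zeroSum, sum_zmod_three]
  rfl

theorem zeroSum_self (r : ZMod 3 → ℕ) : zeroSum r r r = cub3 (r 0) (r 1) (r 2) := by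
  rw [zeroSum_eq, cub3]
  ring

theorem pencilCheck_sound {c H : ℕ} {R : ℕ → ℕ → Bool} {F : ℕ → ℕ → ℕ → ℕ → ℕ → Bool}
    {P N : Coeffs} {a b d : ℕ} (h : pencilCheck c H R F P N a b d = true) {r s t : ZMod 3 → ℕ}
    (hA : Admissible c H R r s t) (hr : ∑ i, r i = a) (hs : ∑ i, s i = b) (ht : ∑ i, t i = d)
    (hr1 : r 1 ≤ r 0) (hr2 : r 2 ≤ r 1) (hs1 : s 1 ≤ s 0) (hs2 : s 2 ≤ s 0) :
    F (N.val r s t) (P.val r s t) (lineSq r s t 0) (lineSq r s t 1) (lineSq r s t 2) = true := by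
  have R1 := hA.r_types
  have R2 := hA.s_types
  have R3 := hA.t_types
  rw [hr, sqSum_eq_sq3] at R1
  rw [hs, sqSum_eq_sq3] at R2
  rw [ht, sqSum_eq_sq3] at R3
  rw [sum_zmod_three] at hr hs ht
  have ra := hA.r_le 0
  have rb := hA.s_le 0
  have l0 := hA.line_le 0 0 0 (by decide)
  have l1 := hA.line_le 1 1 1 (by decide)
  have l2 := hA.line_le 2 2 2 (by decide)
  have l3 := hA.line_le 0 1 2 (by decide)
  have l4 := hA.line_le 1 2 0 (by decide)
  have l5 := hA.line_le 2 0 1 (by decide)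
  have l6 := hA.line_le 0 2 1 (by decide)
  have l7 := hA.line_le 1 0 2 (by decide)
  have l8 := hA.line_le 2 1 0 (by decide)
  have c0 := hA.t_le 0
  have c1 := hA.t_le 1
  have c2 := hA.t_le 2
  have h := allBelow_eq_true h (k := r 0) (by omega)
  have h := allBelow_eq_true h (k := r 1) (by omega)
  have h := evalAt_eq_true (of_blt_or h (by omega)) (k := r 2) (by omega)
  have h := of_not_or (evalAt_eq_true (of_blt_or h hr2) rfl) R1
  have h := allBelow_eq_true h (k := s 0) (by omega)
  have h := allBelow_eq_true h (k := s 1) (by omega)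
  have h := evalAt_eq_true (of_blt_or h (by omega)) (k := s 2) (by omega)
  have h := of_not_or (evalAt_eq_true (of_blt_or h hs2) rfl) R2
  have h := evalAt_eq_true (evalAt_eq_true (evalAt_eq_true h rfl) rfl) rfl
  have h := evalAt_eq_true (evalAt_eq_true (evalAt_eq_true h rfl) rfl) rfl
  have h := evalAt_eq_true (evalAt_eq_true h rfl) rfl
  have h := allBelow_eq_true h (k := t 0) (by omega)
  have h := evalAt_eq_true (of_blt_or h (by omega)) rfl
  have h := evalAt_eq_true (allBelow_eq_true h
    (k := t 1 - (d - t 0 - min c (H - max (max (r 0 + s 1) (r 1 + s 0)) (r 2 + s 2))))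
    (by omega)) (k := t 1) (by omega)
  have h := evalAt_eq_true (of_blt_or h (by omega)) (k := t 2) (by omega)
  have h := evalAt_eq_true (evalAt_eq_true (evalAt_eq_true h rfl) rfl) rfl
  rw [R3, hA.line_types 0 0 0 (by decide), hA.line_types 1 1 1 (by decide),
    hA.line_types 2 2 2 (by decide), hA.line_types 0 1 2 (by decide),
    hA.line_types 1 2 0 (by decide), hA.line_types 2 0 1 (by decide),
    hA.line_types 0 2 1 (by decide), hA.line_types 1 0 2 (by decide),
    hA.line_types 2 1 0 (by decide)] at h
  have hv : ∀ Q : Coeffs, Q.val r s t =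
      Q.const + Q.qa * sq3 (r 0) (r 1) (r 2) + Q.ca * cub3 (r 0) (r 1) (r 2) +
        Q.qb * sq3 (s 0) (s 1) (s 2) + Q.cb * cub3 (s 0) (s 1) (s 2) +
        Q.qc * sq3 (t 0) (t 1) (t 2) + Q.cc * cub3 (t 0) (t 1) (t 2) +
        Q.tr * ((r 0 * s 0 + r 1 * s 2 + r 2 * s 1) * t 0 +
          (r 0 * s 2 + r 2 * s 0 + r 1 * s 1) * t 1 +
          (r 0 * s 1 + r 1 * s 0 + r 2 * s 2) * t 2) := by
    intro Q
    rw [Coeffs.val, Coeffs.lin, zeroSum_self, zeroSum_self, zeroSum_self, zeroSum_eq,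
      sqSum_eq_sq3, sqSum_eq_sq3, sqSum_eq_sq3]
    ring
  simp only [lineSq, sum_zmod_three, hv]
  exact (Bool.or_false _).symm.trans h

end Search

section Gauge

theorem sum_affine {M : Type} [AddCommMonoid M] {e : ZMod 3} (he : e ≠ 0) (p : ZMod 3)
    (f : ZMod 3 → M) : ∑ i, f (e * i + p) = ∑ i, f i :=
  Fintype.sum_bijective _ (by revert e p; decide) _ _ fun _ => rfl

theorem sqSum_affine {e : ZMod 3} (he : e ≠ 0) (p : ZMod 3) (r : ZMod 3 → ℕ) :
    sqSum (fun i => r (e * i + p)) = sqSum r :=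
  sum_affine he p fun i => r i * r i

theorem zeroSum_affine {e : ZMod 3} (he : e ≠ 0) {p q u : ZMod 3} (h : p + q + u = 0)
    (r s t : ZMod 3 → ℕ) :
    zeroSum (fun i => r (e * i + p)) (fun i => s (e * i + q)) (fun i => t (e * i + u)) =
      zeroSum r s t := by
  unfold zeroSum
  rw [← sum_affine he p fun i => ∑ j, r i * s j * t (-i - j)]
  refine sum_congr rfl fun i _ => ?_
  rw [← sum_affine he q fun j => r (e * i + p) * s j * t (-(e * i + p) - j)]
  refine sum_congr rfl fun j _ => ?_
  have : e * (-i - j) + u = -(e * i + p) - (e * j + q) := by linear_combination h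
  rw [← this]

theorem Coeffs.val_affine {e : ZMod 3} (he : e ≠ 0) {p q u : ZMod 3} (h : p + q + u = 0)
    (P : Coeffs) (r s t : ZMod 3 → ℕ) :
    P.val (fun i => r (e * i + p)) (fun i => s (e * i + q)) (fun i => t (e * i + u)) =
      P.val r s t := by
  have h3 : ∀ x : ZMod 3, x + x + x = 0 := by decide
  simp only [Coeffs.val, sqSum_affine he, zeroSum_affine he h, zeroSum_affine he (h3 _)]

theorem lineSq_affine {e : ZMod 3} (he : e ≠ 0) {p q u : ZMod 3} (h : p + q + u = 0)
    (r s t : ZMod 3 → ℕ) (d : ZMod 3) :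
    lineSq (fun i => r (e * i + p)) (fun i => s (e * i + q)) (fun i => t (e * i + u)) d =
      lineSq r s t (e * d + (q - p)) := by
  have h1 : ∀ i, e * (i + d) + q = e * i + p + (e * d + (q - p)) := fun i => by ring
  have h2 : ∀ i, e * (i - d) + u = e * i + p - (e * d + (q - p)) := by
    revert e p q u d; decide
  unfold lineSq
  simp only [h1, h2]
  exact sum_affine he p fun i => (r i + s (i + (e * d + (q - p))) + t (i - (e * d + (q - p)))) *
    (r i + s (i + (e * d + (q - p))) + t (i - (e * d + (q - p))))

theorem Admissible.affine {c H : ℕ} {R : ℕ → ℕ → Bool} {r s t : ZMod 3 → ℕ}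
    (hA : Admissible c H R r s t) {e : ZMod 3} (he : e ≠ 0) {p q u : ZMod 3} (h : p + q + u = 0) :
    Admissible c H R (fun i => r (e * i + p)) (fun i => s (e * i + q))
      (fun i => t (e * i + u)) := by
  have hl : ∀ i j k, i + j + k = 0 → e * i + p + (e * j + q) + (e * k + u) = 0 :=
    fun i j k hijk => by
      calc _ = e * (i + j + k) + (p + q + u) := by ring
        _ = 0 := by rw [hijk, h, mul_zero, add_zero]
  refine ⟨fun i => hA.r_le _, fun i => hA.s_le _, fun i => hA.t_le _, ?_, ?_, ?_,
    fun i j k hijk => hA.line_le _ _ _ (hl i j k hijk),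
    fun i j k hijk => hA.line_types _ _ _ (hl i j k hijk)⟩
  · rw [sqSum_affine he, sum_affine he p r]; exact hA.r_types
  · rw [sqSum_affine he, sum_affine he q s]; exact hA.s_types
  · rw [sqSum_affine he, sum_affine he u t]; exact hA.t_types

theorem exists_sorted (r : ZMod 3 → ℕ) :
    ∃ e p : ZMod 3, e ≠ 0 ∧ r (e * 1 + p) ≤ r (e * 0 + p) ∧ r (e * 2 + p) ≤ r (e * 1 + p) := by
  rcases le_total (r 0) (r 1) with h1 | h1 <;> rcases le_total (r 1) (r 2) with h2 | h2 <;>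
    rcases le_total (r 0) (r 2) with h3 | h3
  · exact ⟨2, 2, by decide, h2, h1⟩
  · exact ⟨2, 2, by decide, h2, h1⟩
  · exact ⟨1, 1, by decide, h2, h3⟩
  · exact ⟨2, 1, by decide, h1, h3⟩
  · exact ⟨1, 2, by decide, h3, h1⟩
  · exact ⟨2, 0, by decide, h3, h2⟩
  · exact ⟨1, 0, by decide, h1, h2⟩
  · exact ⟨1, 0, by decide, h1, h2⟩

theorem exists_max (e : ZMod 3) (s : ZMod 3 → ℕ) :
    ∃ q : ZMod 3, s (e * 1 + q) ≤ s (e * 0 + q) ∧ s (e * 2 + q) ≤ s (e * 0 + q) := by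
  obtain ⟨q, -, hq⟩ := exists_max_image univ s univ_nonempty
  exact ⟨q, by simpa using hq _ (mem_univ _), by simpa using hq _ (mem_univ _)⟩

/-- A predicate on square sums that does not depend on the order of the three directions. -/
def SymmTest (F : ℕ → ℕ → ℕ → ℕ → ℕ → Bool) : Prop :=
  ∀ n p x y z, F n p x y z = F n p y x z ∧ F n p x y z = F n p x z y

theorem SymmTest.affine {F : ℕ → ℕ → ℕ → ℕ → ℕ → Bool} (hF : SymmTest F) (n p : ℕ)
    (g : ZMod 3 → ℕ) {e : ZMod 3} (he : e ≠ 0) (c : ZMod 3) :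
    F n p (g (e * 0 + c)) (g (e * 1 + c)) (g (e * 2 + c)) = F n p (g 0) (g 1) (g 2) := by
  have h1 := fun x y z => (hF n p x y z).1
  have h2 := fun x y z => (hF n p x y z).2
  have : ∀ e c : ZMod 3, e ≠ 0 →
      (e * 0 + c, e * 1 + c, e * 2 + c) ∈ ([(0, 1, 2), (1, 2, 0), (2, 0, 1), (0, 2, 1), (2, 1, 0),
        (1, 0, 2)] : List (ZMod 3 × ZMod 3 × ZMod 3)) := by decide
  have := this e c he
  simp only [List.mem_cons, Prod.mk.injEq, List.not_mem_nil, or_false] at this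
  rcases this with ⟨h, h', h''⟩ | ⟨h, h', h''⟩ | ⟨h, h', h''⟩ | ⟨h, h', h''⟩ | ⟨h, h', h''⟩ |
    ⟨h, h', h''⟩ <;> rw [h, h', h'']
  · rw [h2, h1]
  · rw [h1, h2]
  · rw [h2]
  · rw [h2, h1, h2]
  · rw [h1]

theorem Admissible.of_pencilCheck {c H : ℕ} {R : ℕ → ℕ → Bool} {F : ℕ → ℕ → ℕ → ℕ → ℕ → Bool}
    (hF : SymmTest F) {P N : Coeffs} {r s t : ZMod 3 → ℕ} (hA : Admissible c H R r s t)
    (h : pencilCheck c H R F P N (∑ i, r i) (∑ i, s i) (∑ i, t i) = true) :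
    F (N.val r s t) (P.val r s t) (lineSq r s t 0) (lineSq r s t 1) (lineSq r s t 2) = true := by
  obtain ⟨e, p, he, h1, h2⟩ := exists_sorted r
  obtain ⟨q, h3, h4⟩ := exists_max e s
  have hu : p + q + (-p - q) = 0 := by ring
  have := pencilCheck_sound h (hA.affine he hu) (sum_affine he _ _) (sum_affine he _ _)
    (sum_affine he _ _) h1 h2 h3 h4
  rw [P.val_affine he hu, N.val_affine he hu, lineSq_affine he hu, lineSq_affine he hu,
    lineSq_affine he hu, hF.affine _ _ (lineSq r s t) he] at this
  exact this

end Gauge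

section Lines

variable {V : Type} [AddCommGroup V] [Module (ZMod 3) V]

theorem sum_distinct {i j k : ZMod 3} (hij : i ≠ j) (hik : i ≠ k) (hjk : j ≠ k) (f : ZMod 3 → ℕ) :
    ∑ l, f l = f i + f j + f k := by
  have : (univ : Finset (ZMod 3)) = {i, j, k} := by revert i j k; decide
  rw [this, sum_insert (by simp [hij, hik]), sum_insert (by simp [hjk]), sum_singleton, add_assoc]

theorem add_smul_notMem {f g : Dual (ZMod 3) V} (hg : g ∉ Submodule.span (ZMod 3) {f})
    (m : ZMod 3) : g + m • f ∉ Submodule.span (ZMod 3) {f} := fun h =>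
  hg ((Submodule.add_mem_iff_left _
    (Submodule.smul_mem _ m (Submodule.mem_span_singleton_self f))).1 h)

theorem notMem_span_add_smul {f g : Dual (ZMod 3) V} (hf : f ≠ 0)
    (hg : g ∉ Submodule.span (ZMod 3) {f}) (m : ZMod 3) :
    f ∉ Submodule.span (ZMod 3) {g + m • f} := by
  intro h
  obtain ⟨c, hc⟩ := Submodule.mem_span_singleton.1 h
  have hc0 : c ≠ 0 := by
    rintro rfl
    exact hf (by rw [← hc, zero_smul])
  exact add_smul_notMem hg m (Submodule.mem_span_singleton.2
    ⟨c⁻¹, (inv_smul_eq_iff₀ hc0).2 hc.symm⟩)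

theorem sqSum_add_smul (S : Finset V) (f g : Dual (ZMod 3) V) {i j k : ZMod 3} (hij : i ≠ j)
    (hik : i ≠ k) (hjk : j ≠ k) (m : ZMod 3) :
    sqSum (row S (g + m • f)) =
      lineSq (row (level S f i) g) (row (level S f j) g) (row (level S f k) g) (m * (i - j)) := by
  unfold sqSum lineSq
  rw [← sum_affine one_ne_zero (m * i)]
  refine sum_congr rfl fun x _ => ?_
  have h1 : 1 * x + m * i - m * i = x := by ring
  have h2 : 1 * x + m * i - m * j = x + m * (i - j) := by ring
  have h3 : 1 * x + m * i - m * k = x - m * (i - j) := by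
    revert i j k m x; decide
  rw [row_add_smul, sum_distinct hij hik hjk, h1, h2, h3]

variable [Finite V]

theorem admissible_levels {n c H : ℕ} {R : ℕ → ℕ → Bool} (hc : CapBound n c)
    (hH : CapBound (n + 1) H) (hR : CapTypes (n + 1) R) (hn : finrank (ZMod 3) V = n + 2)
    {S : Finset V} (hS : CapSet S) {f g : Dual (ZMod 3) V} (hf : f ≠ 0)
    (hg : g ∉ Submodule.span (ZMod 3) {f}) {i j k : ZMod 3} (hij : i ≠ j)
    (hik : i ≠ k) (hjk : j ≠ k) :
    Admissible c H R (row (level S f i) g) (row (level S f j) g) (row (level S f k) g) := by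
  have hline : ∀ x y z : ZMod 3, x + y + z = 0 →
      ∃ m s, s - m * i = x ∧ s - m * j = y ∧ s - m * k = z := by
    revert i j k; decide
  have hne : ∀ m : ZMod 3, g + m • f ≠ 0 := fun m h =>
    add_smul_notMem hg m (h ▸ Submodule.zero_mem _)
  refine ⟨hc.row_level_le hn hS hf hg i, hc.row_level_le hn hS hf hg j,
    hc.row_level_le hn hS hf hg k, ?_, ?_, ?_, fun x y z h => ?_, fun x y z h => ?_⟩
  · rw [sum_row]; exact hR.apply_level hn hS hf hg i
  · rw [sum_row]; exact hR.apply_level hn hS hf hg j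
  · rw [sum_row]; exact hR.apply_level hn hS hf hg k
  · obtain ⟨m, s, rfl, rfl, rfl⟩ := hline x y z h
    have := hH.row_le hn hS (hne m) s
    rwa [row_add_smul, sum_distinct hij hik hjk] at this
  · obtain ⟨m, s, rfl, rfl, rfl⟩ := hline x y z h
    have := hR.apply_level hn hS (hne m) (notMem_span_add_smul hf hg m) s
    rwa [row_add_smul, sum_distinct hij hik hjk, sqSum, sum_distinct hij hik hjk,
      row_level_add_smul, row_level_add_smul, row_level_add_smul] at this

end Lines

/-- `S` has no hyperplane direction for which the sum of the squares of the slice sizes is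
in `l`. -/
def Avoids {V : Type} [AddCommGroup V] [Module (ZMod 3) V] (S : Finset V) (l : List ℕ) : Prop :=
  ∀ f : Dual (ZMod 3) V, f ≠ 0 → sqSum (row S f) ∉ l

/-- `forTypes H M p` tests `p` on all `x ≥ y ≥ z` with `x ≤ H` and `x + y + z = M`. -/
def forTypes (H M : ℕ) (p : ℕ → ℕ → ℕ → Bool) : Bool :=
  allBelow (H + 1) fun x => allBelow (x + 1) fun y =>
  Nat.blt M (x + y) || evalAt (M - x - y) fun z => Nat.blt y z || p x y z

/-- The test that `N` is at most `P`, or one of the three square sums is in `l`. -/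
def leOrMem (l : List ℕ) (n p x y z : ℕ) : Bool :=
  Nat.ble n p || (l.elem x || l.elem y || l.elem z)

/-- The test that `N` is at most `P`, with equality only if all three square sums are in `l`. -/
def ltOrMem (l : List ℕ) (n p x y z : ℕ) : Bool :=
  Nat.blt n p || (Nat.ble n p && (l.elem x && l.elem y && l.elem z))

section Types

variable {V : Type} [AddCommGroup V] [Module (ZMod 3) V]

theorem exists_sorted_distinct (r : ZMod 3 → ℕ) :
    ∃ i j k : ZMod 3, i ≠ j ∧ i ≠ k ∧ j ≠ k ∧ r j ≤ r i ∧ r k ≤ r j := by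
  obtain ⟨e, p, he, h1, h2⟩ := exists_sorted r
  have : ∀ e p : ZMod 3, e ≠ 0 → e * 0 + p ≠ e * 1 + p ∧ e * 0 + p ≠ e * 2 + p ∧
      e * 1 + p ≠ e * 2 + p := by decide
  obtain ⟨h3, h4, h5⟩ := this e p he
  exact ⟨_, _, _, h3, h4, h5, h1, h2⟩

theorem exists_of_forTypes {H M : ℕ} {p : ℕ → ℕ → ℕ → Bool} (h : forTypes H M p = true)
    {r : ZMod 3 → ℕ} (hH : ∀ i, r i ≤ H) (hM : ∑ i, r i = M) :
    ∃ i j k : ZMod 3, i ≠ j ∧ i ≠ k ∧ j ≠ k ∧ p (r i) (r j) (r k) = true := by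
  obtain ⟨i, j, k, hij, hik, hjk, h1, h2⟩ := exists_sorted_distinct r
  refine ⟨i, j, k, hij, hik, hjk, ?_⟩
  rw [sum_distinct hij hik hjk] at hM
  have := hH i
  have h := allBelow_eq_true (allBelow_eq_true h (k := r i) (by omega)) (k := r j) (by omega)
  exact of_blt_or (evalAt_eq_true (of_blt_or h (by omega)) (k := r k) (by omega)) h2

theorem sqSum_distinct {i j k : ZMod 3} (hij : i ≠ j) (hik : i ≠ k) (hjk : j ≠ k)
    (r : ZMod 3 → ℕ) : sqSum r = sq3 (r i) (r j) (r k) :=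
  sum_distinct hij hik hjk _

theorem exists_of_sqSum_eq {q H M a b d : ℕ} (htype : forTypes H M (fun x y z =>
      !Nat.beq (sq3 x y z) q || (Nat.beq x a && Nat.beq y b && Nat.beq z d)) = true)
    {r : ZMod 3 → ℕ} (hH : ∀ i, r i ≤ H) (hM : ∑ i, r i = M) (hq : sqSum r = q) :
    ∃ i j k : ZMod 3, i ≠ j ∧ i ≠ k ∧ j ≠ k ∧ r i = a ∧ r j = b ∧ r k = d := by
  obtain ⟨i, j, k, hij, hik, hjk, ht⟩ := exists_of_forTypes htype hH hM
  rw [← sqSum_distinct hij hik hjk, hq] at ht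
  simp only [Nat.beq_refl, Bool.not_true, Bool.false_or, Bool.and_eq_true, Nat.beq_eq] at ht
  exact ⟨i, j, k, hij, hik, hjk, ht.1.1, ht.1.2, ht.2⟩

theorem zeroSum_distinct {i j k : ZMod 3} (hij : i ≠ j) (hik : i ≠ k) (hjk : j ≠ k)
    (r : ZMod 3 → ℕ) : zeroSum r r r = cub3 (r i) (r j) (r k) := by
  have hu : (univ : Finset (ZMod 3)) = {i, j, k} := by revert i j k; decide
  have h : zeroSum r r r = ∑ l, r l * r l * r l + 6 * ∏ l, r l := by
    have : ∏ l, r l = r 0 * r 1 * r 2 := Fin.prod_univ_three r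
    rw [zeroSum_self, cub3, sum_zmod_three, this]
  rw [h, sum_distinct hij hik hjk, hu, prod_insert (by simp [hij, hik]),
    prod_insert (by simp [hjk]), prod_singleton, cub3]
  ring

theorem sqSum_row_smul (S : Finset V) (f : Dual (ZMod 3) V) {m : ZMod 3} (hm : m ≠ 0) :
    sqSum (row S (m • f)) = sqSum (row S f) := by
  simp only [sqSum_row, LinearMap.smul_apply, smul_eq_mul, mul_eq_zero, hm, false_or]

theorem exists_sqSum_erase {S : Finset V} {f : Dual (ZMod 3) V} {i j k : ZMod 3} (hij : i ≠ j)
    (hik : i ≠ k) (hjk : j ≠ k) (hi : row S f i ≠ 0) :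
    ∃ x ∈ S, sqSum (row (S.erase x) f) = sq3 (row S f i - 1) (row S f j) (row S f k) := by
  obtain ⟨x, hx⟩ := card_ne_zero.1 hi
  obtain ⟨hxS, rfl⟩ := mem_filter.1 hx
  refine ⟨x, hxS, ?_⟩
  have h : ∀ l, row (S.erase x) f l = if f x = l then row S f l - 1 else row S f l := by
    intro l
    simp only [row, filter_erase]
    split_ifs with hl
    · exact card_erase_of_mem (mem_filter.2 ⟨hxS, hl⟩)
    · have : x ∉ S.filter fun y => f y = l := fun hx => hl (mem_filter.1 hx).2
      rw [erase_eq_of_notMem this]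
  rw [sqSum_distinct hij hik hjk, h, h, h, if_pos rfl, if_neg hij, if_neg hik]

theorem Avoids.mono {S : Finset V} {l l' : List ℕ} (h : Avoids S l) (hl : l' ⊆ l) :
    Avoids S l' := fun f hf hm => h f hf (hl hm)

theorem Avoids.nil (S : Finset V) : Avoids S [] := fun _ _ h => by simp at h

theorem Avoids.cons {S : Finset V} {l : List ℕ} {q : ℕ}
    (hq : ∀ f : Dual (ZMod 3) V, f ≠ 0 → sqSum (row S f) ≠ q) (hl : Avoids S l) :
    Avoids S (q :: l) := fun f hf h => by
  rcases List.mem_cons.1 h with h | h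
  exacts [hq f hf h, hl f hf h]

theorem symmTest_leOrMem (l : List ℕ) : SymmTest (leOrMem l) := by
  intro n p x y z
  unfold leOrMem
  cases Nat.ble n p <;> cases l.elem x <;> cases l.elem y <;> cases l.elem z <;> decide

theorem symmTest_ltOrMem (l : List ℕ) : SymmTest (ltOrMem l) := by
  intro n p x y z
  unfold ltOrMem
  cases Nat.blt n p <;> cases Nat.ble n p <;> cases l.elem x <;> cases l.elem y <;>
    cases l.elem z <;> decide

variable [Finite V]

/-- Removing points: the sizes of the slices of a cap are restricted by the possible slice sizes
of the caps with one point less. -/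
theorem CapSet.sqSum_mem_of_erase {n H M : ℕ} {R : ℕ → ℕ → Bool} (hH : CapBound n H)
    (hR : CapTypes (n + 1) R) (hn : finrank (ZMod 3) V = n + 1) {S : Finset V} (hS : CapSet S)
    (hM : S.card = M + 1) {l : List ℕ}
    (h : forTypes H (M + 1) (fun x y z =>
      !Nat.beq x 0 && !R M (sq3 (x - 1) y z) || !Nat.beq y 0 && !R M (sq3 (y - 1) x z) ||
        !Nat.beq z 0 && !R M (sq3 (z - 1) x y) || l.elem (sq3 x y z)) = true)
    {f : Dual (ZMod 3) V} (hf : f ≠ 0) : sqSum (row S f) ∈ l := by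
  have key : ∀ {i j k : ZMod 3}, i ≠ j → i ≠ k → j ≠ k →
      ¬ (!Nat.beq (row S f i) 0 && !R M (sq3 (row S f i - 1) (row S f j) (row S f k))) = true := by
    intro i j k hij hik hjk hi
    rw [Bool.and_eq_true, Bool.not_eq_true', Bool.not_eq_true'] at hi
    obtain ⟨x, hx, hq⟩ := exists_sqSum_erase hij hik hjk
      (Nat.ne_of_beq_eq_false hi.1)
    have := hR V hn (S.erase x) (hS.mono (erase_subset _ _)) f hf
    rw [card_erase_of_mem hx, hM, hq, Nat.add_sub_cancel, hi.2] at this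
    cases this
  obtain ⟨i, j, k, hij, hik, hjk, h⟩ := exists_of_forTypes h (hH.row_le hn hS hf)
    ((sum_row S f).trans hM)
  rw [sqSum_distinct hij hik hjk]
  rcases Bool.or_eq_true_iff.1 h with h | h
  · rcases Bool.or_eq_true_iff.1 h with h | h
    · rcases Bool.or_eq_true_iff.1 h with h | h
      · exact (key hij hik hjk h).elim
      · exact (key hij.symm hjk hik h).elim
    · exact (key hik.symm hjk.symm hij h).elim
  · exact List.elem_iff.1 h

theorem sum_ne_zero {n M : ℕ} (hn : finrank (ZMod 3) V = n + 1) {S : Finset V} (hS : CapSet S)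
    (hM : S.card = M) (α β : ℕ) :
    (∑ f : Dual (ZMod 3) V with f ≠ 0,
        (α * sqSum (row S f) + β * zeroSum (row S f) (row S f) (row S f))) +
      (α * M ^ 2 + β * (M * M * M)) =
    α * (3 ^ n * M ^ 2 + 2 * 3 ^ n * M) + β * (3 ^ n * (M * M * M) + 2 * 3 ^ n * M) := by
  have h0 : ∀ x ∈ S, (0 : Dual (ZMod 3) V) x = 0 := fun _ _ => rfl
  have h1 := sqSum_row_of_const h0
  have h2 := zeroSum_row_of_const h0 h0 h0 (by rfl)
  have h3 := sum_zeroSum_row hn S S S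
  rw [hS.zeroSum_count] at h3
  rw [← hM, ← sum_sqSum_row hn, ← h3, ← h1, ← h2, mul_sum, mul_sum, ← sum_add_distrib,
    filter_ne']
  exact sum_erase_add _ _ (mem_univ (0 : Dual (ZMod 3) V))

/-- A lower bound for a combination of the square sum and the zero sum over all directions, compared
with the average. -/
theorem CapSet.le_of_forTypes {n c M : ℕ} (hc : CapBound n c) (hn : finrank (ZMod 3) V = n + 1)
    {S : Finset V} (hS : CapSet S) (hM : S.card = M) {l' : List ℕ} (hl' : Avoids S l')
    {α β k : ℕ} {l : List ℕ}
    (h : forTypes c M (fun x y z => l'.elem (sq3 x y z) ||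
      (Nat.blt k (α * sq3 x y z + β * cub3 x y z) ||
        (Nat.ble k (α * sq3 x y z + β * cub3 x y z) && l.elem (sq3 x y z)))) = true) :
    (3 ^ (n + 1) - 1) * k + (α * M ^ 2 + β * (M * M * M)) ≤
      α * (3 ^ n * M ^ 2 + 2 * 3 ^ n * M) + β * (3 ^ n * (M * M * M) + 2 * 3 ^ n * M) ∧
    (α * (3 ^ n * M ^ 2 + 2 * 3 ^ n * M) + β * (3 ^ n * (M * M * M) + 2 * 3 ^ n * M) ≤
      (3 ^ (n + 1) - 1) * k + (α * M ^ 2 + β * (M * M * M)) →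
      ∀ f : Dual (ZMod 3) V, f ≠ 0 → sqSum (row S f) ∈ l) := by
  have hcard : (univ.filter fun f : Dual (ZMod 3) V => f ≠ 0).card = 3 ^ (n + 1) - 1 := by
    rw [filter_ne', card_erase_of_mem (mem_univ _), card_univ, card_dual hn]
  have hpt : ∀ f : Dual (ZMod 3) V, f ≠ 0 →
      k ≤ α * sqSum (row S f) + β * zeroSum (row S f) (row S f) (row S f) ∧
      (k = α * sqSum (row S f) + β * zeroSum (row S f) (row S f) (row S f) →
        sqSum (row S f) ∈ l) := by
    intro f hf
    obtain ⟨x, y, z, hxy, hxz, hyz, h⟩ := exists_of_forTypes h (hc.row_le hn hS hf)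
      ((sum_row S f).trans hM)
    have havoid := hl' f hf
    rw [sqSum_distinct hxy hxz hyz] at havoid ⊢
    rw [zeroSum_distinct hxy hxz hyz]
    rcases Bool.or_eq_true_iff.1 ((Bool.or_eq_true_iff.1 h).resolve_left fun h =>
      havoid (List.elem_iff.1 h)) with h | h
    · rw [Nat.blt_eq] at h
      exact ⟨h.le, fun h' => absurd h' h.ne⟩
    · rw [Bool.and_eq_true, Nat.ble_eq] at h
      exact ⟨h.1, fun _ => List.elem_iff.1 h.2⟩
  have hpt' : ∀ f ∈ univ.filter fun f : Dual (ZMod 3) V => f ≠ 0, _ :=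
    fun f hf => (hpt f (mem_filter.1 hf).2).1
  have hsum := sum_ne_zero hn hS hM α β
  have hle := sum_le_sum hpt'
  rw [sum_const, smul_eq_mul, hcard] at hle
  refine ⟨by omega, fun htot f hf => (hpt f hf).2 ?_⟩
  refine (sum_eq_sum_iff_of_le hpt').1 ?_ f (mem_filter.2 ⟨mem_univ _, hf⟩)
  rw [sum_const, smul_eq_mul, hcard]
  omega

theorem CapSet.of_pencilCheck {n c H : ℕ} {R : ℕ → ℕ → Bool} (hc : CapBound n c)
    (hH : CapBound (n + 1) H) (hR : CapTypes (n + 1) R) (hn : finrank (ZMod 3) V = n + 2)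
    {S : Finset V} (hS : CapSet S) {f g : Dual (ZMod 3) V} (hf : f ≠ 0)
    (hg : g ∉ Submodule.span (ZMod 3) {f}) {i j k : ZMod 3} (hij : i ≠ j)
    (hik : i ≠ k) (hjk : j ≠ k) {F : ℕ → ℕ → ℕ → ℕ → ℕ → Bool} (hF : SymmTest F) {P N : Coeffs}
    (h : pencilCheck c H R F P N (row S f i) (row S f j) (row S f k) = true) :
    F (N.val (row (level S f i) g) (row (level S f j) g) (row (level S f k) g))
      (P.val (row (level S f i) g) (row (level S f j) g) (row (level S f k) g))
      (sqSum (row S g)) (sqSum (row S (g + (1 : ZMod 3) • f)))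
      (sqSum (row S (g + (2 : ZMod 3) • f))) = true := by
  have hA := admissible_levels hc hH hR hn hS hf hg hij hik hjk
  have := hA.of_pencilCheck (F := F) (P := P) (N := N) hF (by rwa [sum_row, sum_row, sum_row])
  rw [← hF.affine _ _ _ (sub_ne_zero.2 hij) 0] at this
  have e : ∀ m : ZMod 3, (i - j) * m + 0 = m * (i - j) := fun m => by ring
  rw [e, e, e, ← sqSum_add_smul _ _ _ hij hik hjk, ← sqSum_add_smul _ _ _ hij hik hjk,
    ← sqSum_add_smul _ _ _ hij hik hjk, zero_smul, add_zero] at this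
  exact this

/-- If a search finds that `N ≤ P` unless a square sum satisfies `bad`, and `P` is less than `N` on
average, there is a direction where `bad` holds. -/
theorem CapSet.exists_bad {n c H a b d : ℕ} {R : ℕ → ℕ → Bool} (hc : CapBound n c)
    (hH : CapBound (n + 1) H) (hR : CapTypes (n + 1) R) (hn : finrank (ZMod 3) V = n + 2)
    {S : Finset V} (hS : CapSet S) {f : Dual (ZMod 3) V} (hf : f ≠ 0) {i j k : ZMod 3}
    (hij : i ≠ j) (hik : i ≠ k) (hjk : j ≠ k) (hi : row S f i = a) (hj : row S f j = b)
    (hk : row S f k = d) {bad : ℕ → ℕ → ℕ → Bool}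
    (hF : SymmTest fun n p x y z => Nat.ble n p || bad x y z) {P N : Coeffs}
    (h : pencilCheck c H R (fun n p x y z => Nat.ble n p || bad x y z) P N a b d = true)
    (htot : P.total (n + 1) a b d + N.spanPart a b d < N.total (n + 1) a b d + P.spanPart a b d) :
    ∃ g ∉ Submodule.span (ZMod 3) {f}, bad (sqSum (row S g))
      (sqSum (row S (g + (1 : ZMod 3) • f))) (sqSum (row S (g + (2 : ZMod 3) • f))) = true := by
  subst hi hj hk
  by_contra! hbad
  refine htot.not_ge (Coeffs.total_le hn hS hf hij hik hjk P N fun g hg => ?_)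
  have := hS.of_pencilCheck hc hH hR hn hf hg hij hik hjk hF h
  rw [Bool.or_eq_true_iff] at this
  exact Nat.le_of_ble_eq_true (this.resolve_right (hbad g hg))

/-- Excluding one type of hyperplane direction by a search, given that others are excluded. -/
theorem Avoids.cons_of_pencilCheck {n c H M q a b d : ℕ} {R : ℕ → ℕ → Bool} (hc : CapBound n c)
    (hH : CapBound (n + 1) H) (hR : CapTypes (n + 1) R) (hn : finrank (ZMod 3) V = n + 2)
    {S : Finset V} (hS : CapSet S) (hM : S.card = M) {l : List ℕ} (hl : Avoids S l)
    (P N : Coeffs)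
    (htype : forTypes H M (fun x y z =>
      !Nat.beq (sq3 x y z) q || (Nat.beq x a && Nat.beq y b && Nat.beq z d)) = true)
    (htot : P.total (n + 1) a b d + N.spanPart a b d < N.total (n + 1) a b d + P.spanPart a b d)
    (h : pencilCheck c H R (leOrMem l) P N a b d = true) :
    Avoids S (q :: l) := by
  refine Avoids.cons (fun f hf hq => ?_) hl
  obtain ⟨i, j, k, hij, hik, hjk, hi, hj, hk⟩ :=
    exists_of_sqSum_eq htype (hH.row_le hn hS hf) ((sum_row S f).trans hM) hq
  obtain ⟨g, hg, hb⟩ := hS.exists_bad hc hH hR hn hf hij hik hjk hi hj hk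
    (symmTest_leOrMem l) h htot
  have hne : ∀ m : ZMod 3, g + m • f ≠ 0 := fun m h =>
    add_smul_notMem hg m (h ▸ Submodule.zero_mem _)
  have h0 : g ≠ 0 := by simpa using hne 0
  simp only [Bool.or_eq_true_iff, List.elem_iff] at hb
  rcases hb with (hb | hb) | hb
  exacts [hl _ h0 hb, hl _ (hne 1) hb, hl _ (hne 2) hb]

/-- If a search finds that `N ≤ P`, with equality only for square sums in `l`, and the averages of
`N` and `P` agree, then all other square sums are in `l`. -/
theorem CapSet.sqSum_mem_of_pencilCheck {n c H M q a b d : ℕ} {R : ℕ → ℕ → Bool}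
    (hc : CapBound n c) (hH : CapBound (n + 1) H) (hR : CapTypes (n + 1) R)
    (hn : finrank (ZMod 3) V = n + 2) {S : Finset V} (hS : CapSet S) (hM : S.card = M)
    {l : List ℕ} (P N : Coeffs)
    (htype : forTypes H M (fun x y z =>
      !Nat.beq (sq3 x y z) q || (Nat.beq x a && Nat.beq y b && Nat.beq z d)) = true)
    (htot : P.total (n + 1) a b d + N.spanPart a b d ≤ N.total (n + 1) a b d + P.spanPart a b d)
    (h : pencilCheck c H R (ltOrMem l) P N a b d = true) {f : Dual (ZMod 3) V} (hf : f ≠ 0)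
    (hq : sqSum (row S f) = q) {g : Dual (ZMod 3) V} (hg : g ≠ 0) :
    sqSum (row S g) = q ∨ sqSum (row S g) ∈ l := by
  by_cases hgf : g ∈ Submodule.span (ZMod 3) {f}
  · obtain ⟨m, rfl⟩ := Submodule.mem_span_singleton.1 hgf
    exact Or.inl ((sqSum_row_smul S f fun h => hg (by rw [h, zero_smul])).trans hq)
  obtain ⟨i, j, k, hij, hik, hjk, rfl, rfl, rfl⟩ :=
    exists_of_sqSum_eq htype (hH.row_le hn hS hf) ((sum_row S f).trans hM) hq
  have hF := fun g hg => hS.of_pencilCheck hc hH hR hn (g := g) hf hg hij hik hjk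
    (symmTest_ltOrMem l) h
  simp only [ltOrMem, Bool.or_eq_true_iff, Bool.and_eq_true, Nat.blt_eq, Nat.ble_eq,
    List.elem_iff] at hF
  have heq := Coeffs.val_eq hn hS hf hij hik hjk P N
    (fun g hg => (hF g hg).elim (fun h => h.le) fun h => h.1) htot g hgf
  exact Or.inr ((hF g hgf).resolve_left heq.not_lt).2.1.1

end Types

/-- Slice sizes `4, 3, 2` do not occur for caps of size 9 in dimension 3. -/
def rule3 (s q : ℕ) : Bool := !Nat.beq s 9 || !Nat.beq q 29

/-- Slice sizes that do not occur for caps of size 19 in dimension 4. -/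
def rule4' (s q : ℕ) : Bool := !Nat.beq s 19 || !([139, 133, 131, 137, 129].elem q)

/-- Slice sizes of caps of size 19 and 20 in dimension 4. -/
def rule4 (s q : ℕ) : Bool := rule4' s q && (!Nat.beq s 20 || [136, 166].elem q)

/-- Slice sizes of caps of size 45 in dimension 5. -/
def rule5 (s q : ℕ) : Bool := !Nat.beq s 45 || [729, 675].elem q

section Classification

theorem CapBound.of_ne {n M : ℕ}
    (h : ∀ (V : Type) [AddCommGroup V] [Module (ZMod 3) V] [Finite V], finrank (ZMod 3) V = n →
      ∀ S : Finset V, CapSet S → S.card ≠ M + 1) : CapBound n M := by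
  intro V _ _ _ hn S hS
  by_contra! hlt
  obtain ⟨T, hT, hcard⟩ := exists_subset_card_eq (Nat.succ_le_of_lt hlt)
  exact h V hn T (hS.mono hT) hcard

theorem CapBound.succ {n c M α β k : ℕ} {l : List ℕ} (hc : CapBound n c)
    (h : forTypes c (M + 1) (fun x y z => [].elem (sq3 x y z) ||
      (Nat.blt k (α * sq3 x y z + β * cub3 x y z) ||
        (Nat.ble k (α * sq3 x y z + β * cub3 x y z) && l.elem (sq3 x y z)))) = true)
    (htot : α * (3 ^ n * (M + 1) ^ 2 + 2 * 3 ^ n * (M + 1)) +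
        β * (3 ^ n * ((M + 1) * (M + 1) * (M + 1)) + 2 * 3 ^ n * (M + 1)) <
      (3 ^ (n + 1) - 1) * k + (α * (M + 1) ^ 2 + β * ((M + 1) * (M + 1) * (M + 1)))) :
    CapBound (n + 1) M :=
  CapBound.of_ne fun _ _ _ _ hn S hS hM =>
    htot.not_ge (hS.le_of_forTypes hc hn hM (Avoids.nil S) h).1

theorem CapBound.succ_of_erase {n H M : ℕ} {R : ℕ → ℕ → Bool} (hH : CapBound n H)
    (hR : CapTypes (n + 1) R)
    (h : forTypes H (M + 1) (fun x y z =>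
      !Nat.beq x 0 && !R M (sq3 (x - 1) y z) || !Nat.beq y 0 && !R M (sq3 (y - 1) x z) ||
        !Nat.beq z 0 && !R M (sq3 (z - 1) x y) || [].elem (sq3 x y z)) = true) :
    CapBound (n + 1) M :=
  CapBound.of_ne fun V _ _ _ hn S hS hM => by
    have : Nontrivial V := nontrivial_of_finrank_pos (R := ZMod 3) (by omega)
    obtain ⟨f, hf⟩ := exists_ne (0 : Dual (ZMod 3) V)
    have := hS.sqSum_mem_of_erase hH hR hn hM h hf
    simp at this

theorem rule_of_card {M s : ℕ} {b : Bool} (h : s = M → b = true) :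
    (!Nat.beq s M || b) = true := by
  cases hs : Nat.beq s M
  · rfl
  · exact h (Nat.eq_of_beq_eq_true hs)

theorem capBound_zero : CapBound 0 1 := fun V _ _ _ hn S _ => by
  have : Subsingleton V := finrank_zero_iff.1 hn
  exact card_le_one_of_subsingleton S

theorem capBound_one : CapBound 1 2 :=
  capBound_zero.succ (α := 0) (β := 1) (k := 9) (l := [3]) (by decide +kernel) (by decide +kernel)

theorem capBound_two : CapBound 2 4 :=
  capBound_one.succ (α := 0) (β := 1) (k := 41) (l := [9]) (by decide +kernel) (by decide +kernel)

theorem capBound_three : CapBound 3 9 :=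
  capBound_two.succ (α := 0) (β := 1) (k := 328) (l := [36]) (by decide +kernel)
    (by decide +kernel)

theorem capTypes_three : CapTypes 3 rule3 := fun _ _ _ _ hn S hS f hf =>
  rule_of_card fun hM => by
    have := (hS.le_of_forTypes capBound_two hn hM (Avoids.nil S) (α := 3) (β := 1) (k := 324)
      (l := [33, 27]) (by decide +kernel)).2 (by decide +kernel) f hf
    simp only [List.mem_cons, List.not_mem_nil, or_false] at this
    rcases this with h | h <;> rw [h] <;> rfl

/-- Caps of size 19 in dimension 4 without slice sizes `9, 9, 1`. -/
theorem CapSet.avoids_of_card_19 {V : Type} [AddCommGroup V] [Module (ZMod 3) V] [Finite V]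
    (hn : finrank (ZMod 3) V = 4) {S : Finset V} (hS : CapSet S) (hM : S.card = 19)
    (h0 : Avoids S [163]) : Avoids S [137, 129, 131, 133, 139, 163] := by
  have h1 := h0.cons_of_pencilCheck (q := 139) (a := 9) (b := 7) (d := 3)
    capBound_two capBound_three capTypes_three hn hS hM
    ⟨0, 0, 0, 3, 1, 4, 0, 3⟩ ⟨61, 2, 1, 0, 0, 0, 1, 0⟩
    (by decide +kernel) (by decide +kernel) (by decide +kernel)
  have h2 := h1.cons_of_pencilCheck (q := 133) (a := 9) (b := 6) (d := 4)
    capBound_two capBound_three capTypes_three hn hS hM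
    ⟨0, 0, 0, 4, 1, 1, 1, 4⟩ ⟨135, 2, 1, 0, 0, 0, 0, 0⟩
    (by decide +kernel) (by decide +kernel) (by decide +kernel)
  have h3 := h2.cons_of_pencilCheck (q := 131) (a := 9) (b := 5) (d := 5)
    capBound_two capBound_three capTypes_three hn hS hM
    ⟨0, 0, 0, 0, 2, 1, 1, 3⟩ ⟨243, 3, 0, 1, 0, 0, 0, 0⟩
    (by decide +kernel) (by decide +kernel) (by decide +kernel)
  have h4 := h3.cons_of_pencilCheck (q := 129) (a := 8) (b := 7) (d := 4)
    capBound_two capBound_three capTypes_three hn hS hM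
    ⟨0, 9, 1, 21, 3, 28, 5, 25⟩ ⟨3191, 0, 0, 0, 0, 0, 0, 0⟩
    (by decide +kernel) (by decide +kernel) (by decide +kernel)
  have h5 := h4.cons_of_pencilCheck (q := 137) (a := 8) (b := 8) (d := 3)
    capBound_two capBound_three capTypes_three hn hS hM
    ⟨9, 0, 0, 0, 0, 0, 0, 0⟩ ⟨0, 0, 0, 0, 0, 0, 1, 0⟩
    (by decide +kernel) (by decide +kernel) (by decide +kernel)
  exact h5

theorem capTypes_four' : CapTypes 4 rule4' := fun V _ _ _ hn S hS f hf =>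
  rule_of_card fun hM => by
    have hav : Avoids S [139, 133, 131, 137, 129] := by
      by_cases h : ∃ g : Dual (ZMod 3) V, g ≠ 0 ∧ sqSum (row S g) = 163
      · obtain ⟨g, hg, hq⟩ := h
        intro f hf hmem
        have := hS.sqSum_mem_of_pencilCheck (l := [121, 125, 149])
          capBound_two capBound_three capTypes_three hn hM
          ⟨0, 1, 0, 1, 0, 0, 0, 4⟩ ⟨162, 0, 0, 0, 0, 0, 0, 0⟩ (a := 9) (b := 9) (d := 1)
          (by decide +kernel) (by decide +kernel) (by decide +kernel) hg hq hf
        revert hmem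
        rcases this with h | h
        · rw [h]
          decide
        · simp only [List.mem_cons, List.not_mem_nil, or_false] at h
          rcases h with h | h | h <;> rw [h] <;> decide
      · refine (hS.avoids_of_card_19 hn hM (Avoids.cons ?_ (Avoids.nil S))).mono (by decide)
        exact fun g hg hq => h ⟨g, hg, hq⟩
    rw [Bool.not_eq_true', ← Bool.not_eq_true, List.elem_iff]
    exact hav f hf

theorem capTypes_four : CapTypes 4 rule4 := fun _ _ _ _ hn S hS f hf => by
  refine Bool.and_eq_true_iff.2 ⟨capTypes_four' _ hn S hS f hf, rule_of_card fun hM => ?_⟩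
  have h0 := Avoids.nil S
  have h1 := h0.cons_of_pencilCheck (q := 134) (a := 7) (b := 7) (d := 6)
    capBound_two capBound_three capTypes_three hn hS hM
    ⟨0, 0, 1, 0, 0, 0, 0, 0⟩ ⟨71, 1, 0, 1, 0, 0, 0, 0⟩
    (by decide +kernel) (by decide +kernel) (by decide +kernel)
  have h2 := hS.sqSum_mem_of_erase (l := [134, 136, 166]) capBound_three capTypes_four' hn hM
    (by decide +kernel) hf
  exact List.elem_iff.2 ((List.mem_cons.1 h2).resolve_left fun h =>
    h1 f hf (h ▸ List.mem_cons_self))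

theorem capBound_four : CapBound 4 20 :=
  capBound_three.succ_of_erase capTypes_four (by decide +kernel)

theorem CapSet.avoids_of_card_45 {V : Type} [AddCommGroup V] [Module (ZMod 3) V] [Finite V]
    (hn : finrank (ZMod 3) V = 5) {S : Finset V} (hS : CapSet S) (hM : S.card = 45) :
    Avoids S [749, 771, 773, 797, 825] := by
  have h0 := Avoids.nil S
  have h1 := h0.cons_of_pencilCheck (q := 825) (a := 20) (b := 20) (d := 5)
    capBound_three capBound_four capTypes_four hn hS hM
    ⟨0, 0, 0, 0, 0, 8, 0, 9⟩ ⟨391, 1, 1, 1, 1, 0, 1, 0⟩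
    (by decide +kernel) (by decide +kernel) (by decide +kernel)
  have h2 := h1.cons_of_pencilCheck (q := 797) (a := 20) (b := 19) (d := 6)
    capBound_three capBound_four capTypes_four hn hS hM
    ⟨0, 0, 0, 0, 0, 10, 0, 10⟩ ⟨1847, 2, 1, 4, 1, 0, 1, 0⟩
    (by decide +kernel) (by decide +kernel) (by decide +kernel)
  have h3 := h2.cons_of_pencilCheck (q := 773) (a := 20) (b := 18) (d := 7)
    capBound_three capBound_four capTypes_four hn hS hM
    ⟨0, 0, 0, 21, 2, 11, 2, 12⟩ ⟨6583, 15, 3, 0, 0, 0, 0, 0⟩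
    (by decide +kernel) (by decide +kernel) (by decide +kernel)
  have h4 := h3.cons_of_pencilCheck (q := 771) (a := 19) (b := 19) (d := 7)
    capBound_three capBound_four capTypes_four hn hS hM
    ⟨0, 17, 1, 11, 0, 15, 0, 15⟩ ⟨18516, 0, 0, 0, 0, 0, 0, 0⟩
    (by decide +kernel) (by decide +kernel) (by decide +kernel)
  have h5 := h4.cons_of_pencilCheck (q := 749) (a := 19) (b := 18) (d := 8)
    capBound_three capBound_four capTypes_four hn hS hM
    ⟨0, 1, 0, 60, 6, 50, 7, 28⟩ ⟨43792, 0, 1, 0, 0, 0, 0, 0⟩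
    (by decide +kernel) (by decide +kernel) (by decide +kernel)
  exact h5

theorem capTypes_five : CapTypes 5 rule5 := fun _ _ _ _ hn S hS f hf =>
  rule_of_card fun hM => List.elem_iff.2 <|
    (hS.le_of_forTypes capBound_four hn hM (hS.avoids_of_card_45 hn hM) (α := 9) (β := 1)
      (k := 36450) (by decide +kernel)).2 (by decide +kernel) f hf

theorem capBound_five : CapBound 5 45 :=
  capBound_four.succ_of_erase capTypes_five (by decide +kernel)

theorem CapSet.avoids_of_card_112 {V : Type} [AddCommGroup V] [Module (ZMod 3) V] [Finite V]
    (hn : finrank (ZMod 3) V = 6) {S : Finset V} (hS : CapSet S) (hM : S.card = 112) :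
    Avoids S [4410, 4448, 4450, 4490] := by
  have h0 := Avoids.nil S
  have h1 := h0.cons_of_pencilCheck (q := 4490) (a := 45) (b := 44) (d := 23)
    capBound_four capBound_five capTypes_five hn hS hM
    ⟨0, 0, 0, 32, 2, 7, 0, 7⟩ ⟨85672, 12, 3, 0, 0, 0, 0, 0⟩
    (by decide +kernel) (by decide +kernel) (by decide +kernel)
  have h2 := h1.cons_of_pencilCheck (q := 4450) (a := 45) (b := 43) (d := 24)
    capBound_four capBound_five capTypes_five hn hS hM
    ⟨0, 0, 0, 34, 2, 7, 0, 7⟩ ⟨83764, 13, 3, 0, 0, 0, 0, 0⟩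
    (by decide +kernel) (by decide +kernel) (by decide +kernel)
  have h3 := h2.cons_of_pencilCheck (q := 4448) (a := 44) (b := 44) (d := 24)
    capBound_four capBound_five capTypes_five hn hS hM
    ⟨0, 88, 5, 88, 5, 34, 1, 20⟩ ⟨718532, 0, 0, 0, 0, 0, 0, 0⟩
    (by decide +kernel) (by decide +kernel) (by decide +kernel)
  have h4 := h3.cons_of_pencilCheck (q := 4410) (a := 44) (b := 43) (d := 25)
    capBound_four capBound_five capTypes_five hn hS hM
    ⟨0, 35, 2, 36, 2, 25, 1, 10⟩ ⟨322678, 0, 0, 0, 0, 0, 0, 0⟩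
    (by decide +kernel) (by decide +kernel) (by decide +kernel)
  exact h4

end Classification

/-- The test that one of the three square sums is in `l`, or at least two of them equal `q`. -/
def memOrTwo (l : List ℕ) (q x y z : ℕ) : Bool :=
  l.elem x || l.elem y || l.elem z || (Nat.beq x q && Nat.beq y q || Nat.beq x q && Nat.beq z q ||
    Nat.beq y q && Nat.beq z q)

theorem symmTest_memOrTwo (l : List ℕ) (q : ℕ) :
    SymmTest fun n p x y z => Nat.ble n p || memOrTwo l q x y z := by
  intro n p x y z
  simp only [memOrTwo]
  cases Nat.ble n p <;> cases l.elem x <;> cases l.elem y <;> cases l.elem z <;>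
    cases Nat.beq x q <;> cases Nat.beq y q <;> cases Nat.beq z q <;> decide

section Directions

variable {V : Type} [AddCommGroup V] [Module (ZMod 3) V]

theorem linearIndependent_add_smul {f g : Dual (ZMod 3) V} (hf : f ≠ 0)
    (hg : g ∉ Submodule.span (ZMod 3) {f}) {m m' : ZMod 3} (hm : m ≠ m') :
    LinearIndependent (ZMod 3) ![g + m • f, g + m' • f] := by
  refine LinearIndependent.pair_iff.2 fun s t h => ?_
  have h' : (s + t) • g = (-(s * m + t * m')) • f := by
    ext x
    have := LinearMap.congr_fun h x
    simp only [LinearMap.add_apply, LinearMap.smul_apply, LinearMap.zero_apply,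
      smul_eq_mul] at this ⊢
    linear_combination this
  have hst : s + t = 0 := by
    by_contra h0
    exact hg ((Submodule.smul_mem_iff _ h0).1 (h' ▸ Submodule.smul_mem _ _
      (Submodule.mem_span_singleton_self f)))
  rw [hst, zero_smul, eq_comm, smul_eq_zero_iff_left hf] at h'
  have hs : s * (m - m') = 0 := by linear_combination -h' - m' * hst
  have hs0 := (mul_eq_zero.1 hs).resolve_right (sub_ne_zero.2 hm)
  exact ⟨hs0, by rwa [hs0, zero_add] at hst⟩

theorem span_singleton_sub_eq {f g : Dual (ZMod 3) V} {m m' : ZMod 3} (hm : m ≠ m') :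
    Submodule.span (ZMod 3) {f} =
      Submodule.span (ZMod 3) {(g + m • f) - (g + m' • f)} := by
  rw [show g + m • f - (g + m' • f) = (m - m') • f by module]
  exact (Submodule.span_singleton_smul_eq (IsUnit.mk0 _ (sub_ne_zero.2 hm)) f).symm

theorem map_univ_of_distinct {i j k : ZMod 3} (hij : i ≠ j) (hik : i ≠ k) (hjk : j ≠ k)
    (r : ZMod 3 → ℕ) : (univ : Finset (ZMod 3)).val.map r = {r i, r j, r k} := by
  have : (univ : Finset (ZMod 3)).val = {i, j, k} := by revert i j k; decide
  rw [this]
  rfl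

variable [Finite V]

/-- Some line of directions parallel to a direction with slice sizes `40, 36, 36` contains two
directions with slice sizes `45, 45, 22`. -/
theorem CapSet.exists_pair_of_card_112 (hn : finrank (ZMod 3) V = 6) {S : Finset V}
    (hS : CapSet S) (hM : S.card = 112) {f : Dual (ZMod 3) V} (hf : f ≠ 0)
    (hq : sqSum (row S f) = 4192) :
    ∃ g ∉ Submodule.span (ZMod 3) {f}, ∃ m m' : ZMod 3, m ≠ m' ∧
      sqSum (row S (g + m • f)) = 4534 ∧ sqSum (row S (g + m' • f)) = 4534 := by
  obtain ⟨i, j, k, hij, hik, hjk, hi, hj, hk⟩ := exists_of_sqSum_eq (H := 45) (M := 112)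
    (a := 40) (b := 36) (d := 36) (by decide +kernel) (capBound_five.row_le hn hS hf)
    ((sum_row S f).trans hM) hq
  obtain ⟨g, hg, hb⟩ := hS.exists_bad capBound_four capBound_five capTypes_five hn hf
    hij hik hjk hi hj hk (symmTest_memOrTwo [4410, 4448, 4450, 4490] 4534)
    (P := ⟨0, 63, 3, 167, 5, 153, 8, 43⟩) (N := ⟨1181100, 0, 0, 0, 0, 0, 0, 0⟩)
    (by decide +kernel) (by decide +kernel)
  refine ⟨g, hg, ?_⟩
  have hav := fun m => hS.avoids_of_card_112 hn hM (g + m • f) fun h =>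
    add_smul_notMem hg m (h ▸ Submodule.zero_mem _)
  rw [show g = g + (0 : ZMod 3) • f by rw [zero_smul, add_zero], add_assoc, add_assoc,
    ← add_smul, ← add_smul, zero_add, zero_add] at hb
  simp only [memOrTwo, Bool.or_eq_true_iff, Bool.and_eq_true, Nat.beq_eq, List.elem_iff, hav,
    false_or] at hb
  rcases hb with (⟨h, h'⟩ | ⟨h, h'⟩) | ⟨h, h'⟩
  exacts [⟨0, 1, by decide, h, h'⟩, ⟨0, 2, by decide, h, h'⟩, ⟨1, 2, by decide, h, h'⟩]

end Directions

/-- The slice multiset in terms of the sizes of the slices. -/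
theorem sliceMul_eq_map_row {n : ℕ} (S : Finset (Fin n → ZMod 3))
    (f : Dual (ZMod 3) (Fin n → ZMod 3)) :
    sliceMul S f = (univ : Finset (ZMod 3)).val.map (row S f) := by
  unfold sliceMul row
  congr! 3

theorem sqSum_row_eq_of_sliceMul {n : ℕ} {S : Finset (Fin n → ZMod 3)}
    {f : Dual (ZMod 3) (Fin n → ZMod 3)} {a b d : ℕ} (h : sliceMul S f = {a, b, d}) :
    sqSum (row S f) = sq3 a b d := by
  rw [sliceMul_eq_map_row] at h
  have := congrArg (fun s => (s.map fun x => x * x).sum) h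
  simp only [Multiset.map_map] at this
  exact this.trans (by simp [sq3, add_assoc])

theorem IsCap.sliceMul_eq_of_sqSum {S : Finset (Fin 6 → ZMod 3)} (hS : IsCap S)
    (hcard : S.card = 112) {f : Dual (ZMod 3) (Fin 6 → ZMod 3)} (hf : f ≠ 0)
    (hq : sqSum (row S f) = 4534) : sliceMul S f = {45, 45, 22} := by
  obtain ⟨i, j, k, hij, hik, hjk, hi, hj, hk⟩ := exists_of_sqSum_eq (H := 45) (M := 112)
    (a := 45) (b := 45) (d := 22) (by decide +kernel)
    (capBound_five.row_le (finrank_fin_fun (ZMod 3)) hS hf) ((sum_row S f).trans hcard) hq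
  rw [sliceMul_eq_map_row, map_univ_of_distinct hij hik hjk, hi, hj, hk]

end CapSets

/-- Every {40,36,36} hyperplane direction of the 112-cap 6-flat is the difference of
two independent {45,45,22} hyperplane directions. -/
theorem cap112_403636_from_454522 (S : Finset (Fin 6 → ZMod 3)) (hS : IsCap S)
    (hcard : S.card = 112) (ℓ : (Fin 6 → ZMod 3) →ₗ[ZMod 3] ZMod 3) (hℓ : ℓ ≠ 0)
    (hslice : sliceMul S ℓ = {40, 36, 36}) :
    ∃ y₁ y₂ : (Fin 6 → ZMod 3) →ₗ[ZMod 3] ZMod 3,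
      LinearIndependent (ZMod 3) ![y₁, y₂] ∧
      sliceMul S y₁ = {45, 45, 22} ∧ sliceMul S y₂ = {45, 45, 22} ∧
      Submodule.span (ZMod 3) {ℓ} = Submodule.span (ZMod 3) {y₁ - y₂} := by
  obtain ⟨g, hg, m, m', hm, h, h'⟩ := CapSet.exists_pair_of_card_112
    (Module.finrank_fin_fun (ZMod 3)) hS hcard hℓ (sqSum_row_eq_of_sliceMul hslice)
  have hne : ∀ m : ZMod 3, g + m • ℓ ≠ 0 := fun m h =>
    add_smul_notMem hg m (h ▸ Submodule.zero_mem _)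
  exact ⟨g + m • ℓ, g + m' • ℓ, linearIndependent_add_smul hℓ hg hm,
    hS.sliceMul_eq_of_sqSum hcard (hne m) h, hS.sliceMul_eq_of_sqSum hcard (hne m') h',
    span_singleton_sub_eq hm⟩
end
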